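/- Special case of the Aleksandrov–Fenchel inequality: if Σ is the boundary of a compact convex body in ℝⁿ with smooth boundary, mean curvature H₀ and surface area |Σ|, then (1/(2(n−1)ω_{n−1})) ∫_Σ H₀ dΣ ≥ (1/2) (|Σ|/ω_{n−1})^{(n−2)/(n−1)}. -/

import Mathlib

open MeasureTheory Filter
open scoped Topology

noncomputable section

/-- The `i`-th partial derivative of `f` on `ℝⁿ`. -/
def pd {n : ℕ} (f : EuclideanSpace ℝ (Fin n) → ℝ) (i : Fin n)
    (x : EuclideanSpace ℝ (Fin n)) : ℝ :=
  fderiv ℝ f x (EuclideanSpace.single i 1)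

/-- Second partial derivatives `f_{ij}`. -/
def pd2 {n : ℕ} (f : EuclideanSpace ℝ (Fin n) → ℝ) (i j : Fin n)
    (x : EuclideanSpace ℝ (Fin n)) : ℝ :=
  pd (pd f i) j x

/-- `|∇f|²`, the squared Euclidean norm of the gradient of `f`. -/
def gradSq {n : ℕ} (f : EuclideanSpace ℝ (Fin n) → ℝ)
    (x : EuclideanSpace ℝ (Fin n)) : ℝ :=
  ∑ i, (pd f i x) ^ 2

/-- `ω_{n-1}`, the (n-1)-dimensional volume of the unit sphere in `ℝⁿ`. -/
def sphereVol (n : ℕ) : ℝ :=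
  (μH[(n : ℝ) - 1] (Metric.sphere (0 : EuclideanSpace ℝ (Fin n)) 1)).toReal

/-- (unused here) The mass flux integral `∫_{S_r} (f_{ii} f_j - f_{ij} f_i) ν_j dS_r` over the
coordinate sphere of radius `r`, with outward unit normal `ν_j = x_j / r`. -/
def flux {n : ℕ} (f : EuclideanSpace ℝ (Fin n) → ℝ) (r : ℝ) : ℝ :=
  ∫ x in Metric.sphere (0 : EuclideanSpace ℝ (Fin n)) r,
    (∑ j, ((∑ i, pd2 f i i x) * pd f j x - ∑ i, pd2 f i j x * pd f i x) * (x j / r))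
    ∂(μH[(n : ℝ) - 1])

/-- Asymptotic flatness of `f : ℝⁿ → ℝ`:  `f_i = O(|x|^{-p/2})` and
`|x| |f_{ij}| + |x|² |f_{ijk}| = O(|x|^{-p/2})` for some `p > (n-2)/2`. -/
def AsympFlat {n : ℕ} (f : EuclideanSpace ℝ (Fin n) → ℝ) : Prop :=
  ∃ p C : ℝ, p > ((n : ℝ) - 2) / 2 ∧
    ∀ x : EuclideanSpace ℝ (Fin n), 1 ≤ ‖x‖ →
      (∀ i, |pd f i x| ≤ C * ‖x‖ ^ (-(p / 2))) ∧
      (∀ i j k, ‖x‖ * |pd2 f i j x| + ‖x‖ ^ 2 * |pd (pd (pd f i) j) k x| ≤ C * ‖x‖ ^ (-(p / 2)))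



section matlem
variable {n : ℕ}

def detCM (n : ℕ) : ContinuousMultilinearMap ℝ (fun _ : Fin n => (Fin n → ℝ)) ℝ :=
  { (Matrix.detRowAlternating (n := Fin n) (R := ℝ)).toMultilinearMap with
    cont := by
      change Continuous (fun M : Matrix (Fin n) (Fin n) ℝ => M.det)
      exact continuous_id.matrix_det }

lemma detCM_apply (M : Matrix (Fin n) (Fin n) ℝ) : detCM n M = M.det := rfl

lemma hasDerivAt_mdet {M : ℝ → Matrix (Fin n) (Fin n) ℝ} {M' : Matrix (Fin n) (Fin n) ℝ} {t : ℝ}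
    (h : ∀ i j, HasDerivAt (fun s => M s i j) (M' i j) t) :
    HasDerivAt (fun s => (M s).det) (((M t).adjugate * M').trace) t := by
  have h1 : ∀ i, HasFDerivAt (fun s => (M s) i)
      ((1 : ℝ →L[ℝ] ℝ).smulRight (M' i)) t := fun i =>
    (hasDerivAt_pi.2 (fun j => h i j)).hasFDerivAt
  have h2 := HasFDerivAt.multilinear_comp (f := detCM n) h1
  have h3 := h2.hasDerivAt
  refine h3.congr_deriv ?_
  simp only [_root_.sum_apply, ContinuousLinearMap.comp_apply,
    ContinuousMultilinearMap.toContinuousLinearMap_apply]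
  rw [Matrix.trace_mul_comm, Matrix.trace]
  refine Finset.sum_congr rfl fun i _ => ?_
  have : detCM n (Function.update (fun j => M t j) i (M' i)) =
      ((M t).updateRow i (M' i)).det := rfl
  simp only [ContinuousLinearMap.smulRight_apply, one_apply_eq_self, one_smul]
  rw [this, ← Matrix.cramer_transpose_apply, Matrix.cramer_eq_adjugate_mulVec,
    ← Matrix.adjugate_transpose]
  simp [Matrix.mulVec, dotProduct, Matrix.mul_apply, mul_comm]

/-- polarized second derivative of the determinant -/
def CC (M X Y : Matrix (Fin n) (Fin n) ℝ) : ℝ :=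
  ∑ i, ∑ j, ((M.updateRow j (Pi.single i 1)).adjugate * Y.updateRow j 0).trace * X j i

lemma hasDerivAt_adj_entry {M : ℝ → Matrix (Fin n) (Fin n) ℝ} {M' : Matrix (Fin n) (Fin n) ℝ}
    {t : ℝ} (h : ∀ i j, HasDerivAt (fun s => M s i j) (M' i j) t) (i j : Fin n) :
    HasDerivAt (fun s => (M s).adjugate i j)
      ((((M t).updateRow j (Pi.single i 1)).adjugate * M'.updateRow j 0).trace) t := by
  simp only [Matrix.adjugate_apply]
  refine hasDerivAt_mdet (M := fun s => (M s).updateRow j (Pi.single i 1)) fun a b => ?_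
  by_cases ha : a = j
  · subst ha; simpa using hasDerivAt_const t _
  · simpa [Matrix.updateRow_ne ha] using h a b

lemma hasDerivAt_tr_adj {M : ℝ → Matrix (Fin n) (Fin n) ℝ} {M' X : Matrix (Fin n) (Fin n) ℝ}
    {t : ℝ} (h : ∀ i j, HasDerivAt (fun s => M s i j) (M' i j) t) :
    HasDerivAt (fun s => ((M s).adjugate * X).trace) (CC (M t) X M') t := by
  simp only [Matrix.trace, Matrix.diag, Matrix.mul_apply, CC]
  refine HasDerivAt.fun_sum fun i _ => HasDerivAt.fun_sum fun j _ => ?_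
  have := (hasDerivAt_adj_entry h i j).mul_const (X j i)
  simpa [Matrix.trace, Matrix.diag, Matrix.mul_apply] using this

lemma dadj_eq {M Y : Matrix (Fin n) (Fin n) ℝ} (hM : M.det ≠ 0) (i j : Fin n) :
    ((M.updateRow j (Pi.single i 1)).adjugate * Y.updateRow j 0).trace =
      M.det * ((M⁻¹ * Y).trace * M⁻¹ i j - (M⁻¹ * Y * M⁻¹) i j) := by
  have hlin : ∀ a b, HasDerivAt (fun s : ℝ => (M + s • Y) a b) (Y a b) 0 := fun a b => by
    simpa using ((hasDerivAt_id (0:ℝ)).mul_const (Y a b)).const_add (M a b)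
  set D : Matrix (Fin n) (Fin n) ℝ := fun i j =>
    ((M.updateRow j (Pi.single i 1)).adjugate * Y.updateRow j 0).trace with hD
  have hu : IsUnit M.det := isUnit_iff_ne_zero.2 hM
  have hadj : M.adjugate = M.det • M⁻¹ := by
    rw [Matrix.inv_def, smul_smul, Ring.mul_inverse_cancel _ hu, one_smul]
  have key : D * M + M.adjugate * Y = (M.adjugate * Y).trace • 1 := by
    ext a b
    have h1 : HasDerivAt (fun s : ℝ => ((M + s • Y).adjugate * (M + s • Y)) a b)
        ((D * M + M.adjugate * Y) a b) 0 := by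
      simp only [Matrix.mul_apply, Matrix.add_apply (D * M), ← Finset.sum_add_distrib]
      refine HasDerivAt.fun_sum fun c _ => ?_
      have := (hasDerivAt_adj_entry hlin a c).mul (hlin c b)
      simp only [zero_smul, add_zero] at this
      exact this
    have h2 : HasDerivAt (fun s : ℝ => ((M + s • Y).adjugate * (M + s • Y)) a b)
        (((M.adjugate * Y).trace • (1 : Matrix (Fin n) (Fin n) ℝ)) a b) 0 := by
      simp only [Matrix.adjugate_mul, Matrix.smul_apply, smul_eq_mul]
      have := (hasDerivAt_mdet hlin).mul_const ((1 : Matrix (Fin n) (Fin n) ℝ) a b)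
      simpa using this
    exact h1.unique h2
  have : D = M.det • ((M⁻¹ * Y).trace • M⁻¹ - M⁻¹ * Y * M⁻¹) := by
    have h3 : D * M * M⁻¹ = ((M.adjugate * Y).trace • 1 - M.adjugate * Y) * M⁻¹ := by
      rw [← key]; simp
    rw [Matrix.mul_assoc, Matrix.mul_nonsing_inv _ hu, Matrix.mul_one, hadj] at h3
    rw [h3]; simp [sub_mul, smul_sub, Matrix.trace_smul, smul_smul]
  simpa using congrFun (congrFun this i) j

lemma hasDerivAt_adj_inv {M : ℝ → Matrix (Fin n) (Fin n) ℝ} {M' : Matrix (Fin n) (Fin n) ℝ}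
    {t : ℝ} (h : ∀ i j, HasDerivAt (fun s => M s i j) (M' i j) t) (hM : (M t).det ≠ 0)
    (i j : Fin n) :
    HasDerivAt (fun s => (M s).adjugate i j)
      ((M t).det * (((M t)⁻¹ * M').trace * (M t)⁻¹ i j - ((M t)⁻¹ * M' * (M t)⁻¹) i j)) t := by
  rw [← dadj_eq hM]; exact hasDerivAt_adj_entry h i j

/-- normalized form -/
def cc (G X Y : Matrix (Fin n) (Fin n) ℝ) : ℝ :=
  (G * X).trace * (G * Y).trace - (G * X * (G * Y)).trace

lemma CC_eq {M : Matrix (Fin n) (Fin n) ℝ} (hM : M.det ≠ 0) (X Y : Matrix (Fin n) (Fin n) ℝ) :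
    CC M X Y = M.det * cc M⁻¹ X Y := by
  unfold CC cc
  simp only [dadj_eq hM]
  have : (M⁻¹ * X * (M⁻¹ * Y)).trace = ((M⁻¹ * Y * M⁻¹) * X).trace := by
    rw [Matrix.trace_mul_comm, Matrix.mul_assoc (M⁻¹ * Y)]
  have tr2 : ∀ A : Matrix (Fin n) (Fin n) ℝ, (A * X).trace = ∑ i, ∑ j, A i j * X j i :=
    fun A => by simp [Matrix.trace, Matrix.mul_apply]
  rw [this, tr2, tr2]
  generalize (M⁻¹ * Y).trace = y
  generalize M⁻¹ * Y * M⁻¹ = B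
  simp only [Finset.sum_mul, ← Finset.sum_sub_distrib, Finset.mul_sum]
  exact Finset.sum_congr rfl fun i _ => Finset.sum_congr rfl fun j _ => by ring

lemma cc_comm (G X Y : Matrix (Fin n) (Fin n) ℝ) : cc G X Y = cc G Y X := by
  unfold cc; rw [Matrix.trace_mul_comm (G * X), mul_comm]

lemma cc_add_left (G X X' Y : Matrix (Fin n) (Fin n) ℝ) :
    cc G (X + X') Y = cc G X Y + cc G X' Y := by
  unfold cc; simp [mul_add, add_mul]; ring

lemma cc_smul_left (G X Y : Matrix (Fin n) (Fin n) ℝ) (a : ℝ) :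
    cc G (a • X) Y = a * cc G X Y := by
  unfold cc; simp; ring

lemma continuous_CC {α : Type*} [TopologicalSpace α] {M X Y : α → Matrix (Fin n) (Fin n) ℝ}
    (hM : Continuous M) (hX : Continuous X) (hY : Continuous Y) :
    Continuous fun a => CC (M a) (X a) (Y a) := by
  unfold CC
  refine continuous_finsetSum _ fun i _ => continuous_finsetSum _ fun j _ => ?_
  refine Continuous.mul ?_ (hX.matrix_elem j i)
  refine Continuous.matrix_trace (Continuous.matrix_mul ?_ ?_)
  · exact (hM.matrix_updateRow j continuous_const).matrix_adjugate
  · exact hY.matrix_updateRow j continuous_const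

end matlem

section psd
variable {n : ℕ}
open Matrix

lemma psd_factor {P : Matrix (Fin n) (Fin n) ℝ} (hP : P.PosSemidef) :
    ∃ B : Matrix (Fin n) (Fin n) ℝ, P = Bᵀ * B := by
  open scoped MatrixOrder in
  obtain ⟨B, hB⟩ := CStarAlgebra.nonneg_iff_eq_star_mul_self.1 hP.nonneg
  exact ⟨B, by simpa [Matrix.star_eq_conjTranspose] using hB⟩

lemma psd_trace_mul_le {P Q : Matrix (Fin n) (Fin n) ℝ} (hP : P.PosSemidef) (hQ : Q.PosSemidef) :
    (P * Q).trace ≤ P.trace * Q.trace := by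
  obtain ⟨B, rfl⟩ := psd_factor hP
  obtain ⟨C, rfl⟩ := psd_factor hQ
  have h1 : (Bᵀ * B * (Cᵀ * C)).trace = ∑ i, ∑ j, (∑ k, B i k * C j k) ^ 2 := by
    rw [← Matrix.mul_assoc, Matrix.trace_mul_comm, ← Matrix.mul_assoc, ← Matrix.mul_assoc,
      Matrix.mul_assoc]
    rw [Matrix.trace_mul_comm, Matrix.trace]
    simp only [Matrix.diag, Matrix.mul_apply (M := B * Cᵀ)]
    refine Finset.sum_congr rfl fun i _ => Finset.sum_congr rfl fun j _ => ?_
    simp [Matrix.mul_apply, sq, mul_comm]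
  have h2 : ∀ B : Matrix (Fin n) (Fin n) ℝ, (Bᵀ * B).trace = ∑ i, ∑ k, B i k ^ 2 := by
    intro B
    rw [Matrix.trace_mul_comm]
    simp [Matrix.trace, Matrix.mul_apply, sq]
  rw [h1, h2, h2, Finset.sum_mul_sum]
  exact Finset.sum_le_sum fun i _ => Finset.sum_le_sum fun j _ =>
    Finset.sum_mul_sq_le_sq_mul_sq _ _ _

lemma cc_factor (B X Y : Matrix (Fin n) (Fin n) ℝ) :
    cc (Bᵀ * B) X Y = (B * X * Bᵀ).trace * (B * Y * Bᵀ).trace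
      - ((B * X * Bᵀ) * (B * Y * Bᵀ)).trace := by
  unfold cc
  rw [Matrix.trace_mul_comm (B * X) Bᵀ, Matrix.trace_mul_comm (B * Y) Bᵀ,
    Matrix.mul_assoc Bᵀ, Matrix.mul_assoc Bᵀ]
  congr 1
  simp only [Matrix.mul_assoc]
  rw [Matrix.trace_mul_comm Bᵀ]
  simp only [Matrix.mul_assoc]

lemma cc_nonneg {G X Y : Matrix (Fin n) (Fin n) ℝ} (hG : G.PosSemidef) (hX : X.PosSemidef)
    (hY : Y.PosSemidef) : 0 ≤ cc G X Y := by
  obtain ⟨B, rfl⟩ := psd_factor hG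
  rw [cc_factor]
  have h1 := hX.mul_mul_conjTranspose_same B
  have h2 := hY.mul_mul_conjTranspose_same B
  rw [conjTranspose_eq_transpose_of_trivial] at h1 h2
  linarith [psd_trace_mul_le h1 h2]

lemma posdef_lower {G : Matrix (Fin n) (Fin n) ℝ} (hG : G.PosDef) :
    ∃ l : ℝ, 0 < l ∧ (G - l • (1 : Matrix (Fin n) (Fin n) ℝ)).PosSemidef := by
  obtain ⟨B, hB⟩ := psd_factor hG.posSemidef
  have hdet : IsUnit B.det := by
    have := hG.det_pos
    rw [hB, det_mul, det_transpose] at this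
    exact isUnit_iff_ne_zero.2 fun h => by simp [h] at this
  set Q := (B⁻¹)ᵀ * B⁻¹ with hQ
  have hQp : Q.PosSemidef := by
    have := posSemidef_conjTranspose_mul_self B⁻¹
    rwa [conjTranspose_eq_transpose_of_trivial] at this
  have htr := hQp.trace_nonneg
  refine ⟨1 / (Q.trace + 1), by positivity, ?_⟩
  have hl : (0:ℝ) < Q.trace + 1 := by positivity
  refine .of_dotProduct_mulVec_nonneg ?_ fun x => ?_
  · exact hG.isHermitian.sub (by simp [Matrix.IsHermitian])
  set y := B *ᵥ x with hy
  have hx : x = B⁻¹ *ᵥ y := by rw [hy, mulVec_mulVec, nonsing_inv_mul _ hdet, one_mulVec]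
  have e1 : x ⬝ᵥ (G *ᵥ x) = y ⬝ᵥ y := by
    rw [hB, ← mulVec_mulVec, dotProduct_mulVec, vecMul_transpose]
  have e2 : x ⬝ᵥ x = y ⬝ᵥ (Q *ᵥ y) := by
    rw [hQ, ← mulVec_mulVec, dotProduct_mulVec y, vecMul_transpose, ← hx]
  have e3 : y ⬝ᵥ (Q *ᵥ y) ≤ (y ⬝ᵥ y) * Q.trace := by
    have h := psd_trace_mul_le (posSemidef_vecMulVec_self_star y) hQp
    rw [trace_mul_comm, star_trivial, trace_vecMulVec, mul_vecMulVec, trace_vecMulVec,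
      dotProduct_comm] at h
    exact h
  have e4 : 0 ≤ y ⬝ᵥ y := Finset.sum_nonneg fun i _ => mul_self_nonneg (y i)
  simp only [star_trivial, sub_mulVec, dotProduct_sub, smul_mulVec, one_mulVec, dotProduct_smul,
    smul_eq_mul, e1]
  rw [e2, sub_nonneg, div_mul_eq_mul_div, one_mul, div_le_iff₀ hl]
  nlinarith

lemma tr_GYGY_pos {G Y : Matrix (Fin n) (Fin n) ℝ} (hG : G.PosDef) (hY : Yᵀ = Y) (h0 : Y ≠ 0) :
    0 < (G * Y * (G * Y)).trace := by
  obtain ⟨B, hB⟩ := psd_factor hG.posSemidef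
  have hdet : IsUnit B.det := by
    have := hG.det_pos
    rw [hB, det_mul, det_transpose] at this
    exact isUnit_iff_ne_zero.2 fun h => by simp [h] at this
  have h1 : (G * Y * (G * Y)).trace = ((B * Y * Bᵀ)ᵀ * (B * Y * Bᵀ)).trace := by
    have : (B * Y * Bᵀ)ᵀ = B * Y * Bᵀ := by
      simp [transpose_mul, hY, Matrix.mul_assoc]
    rw [this, hB]
    have := cc_factor B Y Y
    unfold cc at this
    have h3 : (B * Y * Bᵀ).trace = (Bᵀ * B * Y).trace := by
      rw [Matrix.trace_mul_comm, Matrix.mul_assoc]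
    rw [h3] at this
    linarith
  rw [h1]
  have h2 : (0:ℝ) ≤ ((B * Y * Bᵀ)ᵀ * (B * Y * Bᵀ)).trace := by
    have := (posSemidef_conjTranspose_mul_self (B * Y * Bᵀ)).trace_nonneg
    rwa [conjTranspose_eq_transpose_of_trivial] at this
  refine lt_of_le_of_ne h2 fun h => h0 ?_
  have h4 := trace_conjTranspose_mul_self_eq_zero_iff (A := B * Y * Bᵀ)
  rw [conjTranspose_eq_transpose_of_trivial] at h4
  have h5 := h4.1 h.symm
  have hdt : IsUnit Bᵀ.det := by rwa [det_transpose]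
  calc Y = B⁻¹ * (B * Y * Bᵀ) * Bᵀ⁻¹ := by
        rw [Matrix.mul_assoc B, ← Matrix.mul_assoc, nonsing_inv_mul _ hdet, Matrix.one_mul,
          Matrix.mul_assoc, mul_nonsing_inv _ hdt, Matrix.mul_one]
    _ = 0 := by rw [h5]; simp

/-- `θθᵀ` -/
def NN (v : Fin n → ℝ) : Matrix (Fin n) (Fin n) ℝ := vecMulVec v v
/-- `1 - θθᵀ` -/
def PP (v : Fin n → ℝ) : Matrix (Fin n) (Fin n) ℝ := 1 - NN v

variable {v : Fin n → ℝ}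
lemma NN_sq (hv : v ⬝ᵥ v = 1) : NN v * NN v = NN v := by
  simp [NN, vecMulVec_mul_vecMulVec, hv]
lemma NN_tr (hv : v ⬝ᵥ v = 1) : (NN v).trace = 1 := by simp [NN, hv]
lemma PP_sq (hv : v ⬝ᵥ v = 1) : PP v * PP v = PP v := by
  simp [PP, mul_sub, sub_mul, NN_sq hv]
lemma PP_tr (hv : v ⬝ᵥ v = 1) : (PP v).trace = n - 1 := by simp [PP, NN_tr hv]
lemma NN_symm : (NN v)ᵀ = NN v := by simp [NN, transpose_vecMulVec]
lemma PP_symm : (PP v)ᵀ = PP v := by simp [PP, NN_symm]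
lemma PP_psd (hv : v ⬝ᵥ v = 1) : (PP v).PosSemidef := by
  have := posSemidef_conjTranspose_mul_self (PP v)
  rwa [conjTranspose_eq_transpose_of_trivial, PP_symm, PP_sq hv] at this

lemma tr_GP_pos (hn : 3 ≤ n) {G : Matrix (Fin n) (Fin n) ℝ} (hG : G.PosDef) (hv : v ⬝ᵥ v = 1) :
    0 < (G * PP v).trace := by
  obtain ⟨l, hl, h⟩ := posdef_lower hG
  obtain ⟨B, hB⟩ := psd_factor h
  have e : G = l • 1 + Bᵀ * B := by rw [← hB]; abel
  have h1 := ((PP_psd hv).mul_mul_conjTranspose_same B).trace_nonneg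
  rw [conjTranspose_eq_transpose_of_trivial] at h1
  rw [e, add_mul, trace_add, Matrix.mul_assoc, trace_mul_comm Bᵀ, smul_mul, trace_smul,
    Matrix.one_mul, PP_tr hv]
  have : (3:ℝ) ≤ n := by exact_mod_cast hn
  have h2 : 0 < l • ((n:ℝ) - 1) := by rw [smul_eq_mul]; apply mul_pos hl; linarith
  linarith

lemma cc_PP_pos (hn : 3 ≤ n) {G : Matrix (Fin n) (Fin n) ℝ} (hG : G.PosDef) (hv : v ⬝ᵥ v = 1) :
    0 < cc G (PP v) (PP v) := by
  obtain ⟨l, hl, h⟩ := posdef_lower hG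
  set G1 := G - l • (1 : Matrix (Fin n) (Fin n) ℝ) with hG1
  have e : G = l • 1 + G1 := by rw [hG1]; abel
  set P := PP v with hP
  have hPP := PP_sq hv
  rw [← hP] at hPP
  have hQ : (P * G1 * P).PosSemidef := by
    have := h.mul_mul_conjTranspose_same P
    rwa [conjTranspose_eq_transpose_of_trivial, hP, PP_symm, ← hP] at this
  have e1 := psd_trace_mul_le hQ hQ
  have e2 := psd_trace_mul_le (PP_psd hv) hQ
  rw [← hP] at e2
  have t1 : (P * G1 * P).trace = (G1 * P).trace := by
    rw [trace_mul_comm, ← Matrix.mul_assoc, hPP, trace_mul_comm]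
  have t2 : (P * (P * G1 * P)).trace = (G1 * P).trace := by
    rw [← Matrix.mul_assoc, ← Matrix.mul_assoc, hPP, t1]
  have t3 : (P * G1 * P * (P * G1 * P)).trace = (G1 * P * (G1 * P)).trace := by
    have : P * G1 * P * (P * G1 * P) = P * (G1 * P * (G1 * P)) := by
      simp only [← Matrix.mul_assoc]; rw [Matrix.mul_assoc (P * G1) P P, hPP]
    rw [this, trace_mul_comm, Matrix.mul_assoc, Matrix.mul_assoc G1 P P, hPP]
  rw [t1, t3] at e1
  rw [t1, t2, hP, PP_tr hv, ← hP] at e2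
  have e3 : cc G P P = l ^ 2 * ((n - 1) * (n - 1) - (n - 1)) + 2 * l * ((n - 1) * (G1 * P).trace
      - (G1 * P).trace) + ((G1 * P).trace * (G1 * P).trace - (G1 * P * (G1 * P)).trace) := by
    unfold cc
    have a1 : (P * (G1 * P)).trace = (G1 * P).trace := by
      rw [← Matrix.mul_assoc, t1]
    have a2 : (G1 * P * P).trace = (G1 * P).trace := by rw [Matrix.mul_assoc, hPP]
    rw [e]
    simp only [add_mul, mul_add, trace_add, Matrix.smul_mul, Matrix.mul_smul, trace_smul, Matrix.one_mul, hPP,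
      a1, a2, smul_eq_mul]
    rw [hP, PP_tr hv]; ring
  have h3 : (3:ℝ) ≤ n := by exact_mod_cast hn
  rw [e3]
  have : 0 < l ^ 2 * (((n:ℝ) - 1) * (n - 1) - (n - 1)) := by
    apply mul_pos (by positivity); nlinarith
  nlinarith

lemma F3 (hn : 3 ≤ n) {G : Matrix (Fin n) (Fin n) ℝ} (hG : G.PosDef) (hv : v ⬝ᵥ v = 1)
    (X : Matrix (Fin n) (Fin n) ℝ) {Y : Matrix (Fin n) (Fin n) ℝ}
    (hY : Y = X - ((G * X).trace / (G * PP v).trace) • PP v) :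
    (G * Y * (G * Y)).trace ≤ cc G X (PP v) ^ 2 / cc G (PP v) (PP v) - cc G X X := by
  have h1 := cc_PP_pos hn hG hv
  have h2 := tr_GP_pos hn hG hv
  set a := (G * X).trace / (G * PP v).trace with ha
  have hX : X = Y + a • PP v := by rw [hY]; abel
  have hz : (G * Y).trace = 0 := by
    rw [hY, mul_sub, trace_sub, Matrix.mul_smul, trace_smul, smul_eq_mul, ha,
      div_mul_cancel₀ _ h2.ne', sub_self]
  have h3 : cc G Y Y = - (G * Y * (G * Y)).trace := by unfold cc; rw [hz]; ring
  have h4 : cc G X (PP v) = cc G Y (PP v) + a * cc G (PP v) (PP v) := by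
    rw [hX, cc_add_left, cc_smul_left]
  have h5 : cc G X X = cc G Y Y + 2 * a * cc G Y (PP v) + a ^ 2 * cc G (PP v) (PP v) := by
    rw [hX, cc_add_left, cc_smul_left, cc_comm G Y (Y + _), cc_comm G (PP v) (Y + _), cc_add_left,
      cc_add_left, cc_smul_left, cc_smul_left, cc_comm G (PP v) Y]; ring
  rw [h4, h5, h3, le_sub_iff_add_le, le_div_iff₀ h1]
  nlinarith [sq_nonneg (cc G Y (PP v))]

end psd

section calc1
variable {n : ℕ}

abbrev En (n : ℕ) := EuclideanSpace ℝ (Fin n)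
abbrev eb (i : Fin n) : En n := EuclideanSpace.single i 1

lemma En_sum (x : En n) : x = ∑ i, x i • eb i := by
  have := (EuclideanSpace.basisFun (Fin n) ℝ).sum_repr x
  simpa using this.symm

lemma fderiv_apply_sum (f : En n → ℝ) (x v : En n) :
    fderiv ℝ f x v = ∑ i, v i * pd f i x := by
  conv_lhs => rw [En_sum v]
  simp [pd]

lemma pd_line {f : En n → ℝ} {x : En n} (hf : DifferentiableAt ℝ f x) (j : Fin n) :
    HasDerivAt (fun s : ℝ => f (x + s • eb j)) (pd f j x) 0 := by
  have h := hf.hasFDerivAt.hasLineDerivAt (eb j)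
  exact h

lemma pd_eq_of_line {f : En n → ℝ} {x : En n} (hf : DifferentiableAt ℝ f x) {j : Fin n} {a : ℝ}
    (h : HasDerivAt (fun s : ℝ => f (x + s • eb j)) a 0) : pd f j x = a :=
  (pd_line hf j).unique h

lemma pd_contDiffAt {f : En n → ℝ} {x : En n} {k m : WithTop ℕ∞} (hf : ContDiffAt ℝ k f x)
    (hk : m + 1 ≤ k) (i : Fin n) : ContDiffAt ℝ m (pd f i) x :=
  (hf.fderiv_right hk).clm_apply contDiffAt_const

lemma pd_congr {f g : En n → ℝ} {x : En n} (h : f =ᶠ[𝓝 x] g) (i : Fin n) : pd f i x = pd g i x := by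
  unfold pd; rw [h.fderiv_eq]

lemma pd_eventually {f g : En n → ℝ} {x : En n} (h : f =ᶠ[𝓝 x] g) (i : Fin n) :
    pd f i =ᶠ[𝓝 x] pd g i := by
  filter_upwards [h.eventuallyEq_nhds] with y hy using pd_congr hy i

lemma pd_add {f g : En n → ℝ} {x : En n} (hf : DifferentiableAt ℝ f x)
    (hg : DifferentiableAt ℝ g x) (i : Fin n) :
    pd (fun y => f y + g y) i x = pd f i x + pd g i x := by
  unfold pd; rw [fderiv_fun_add hf hg]; rfl

lemma pd_const_mul (f : En n → ℝ) (x : En n) (c : ℝ) (i : Fin n) :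
    pd (fun y => c * f y) i x = c * pd f i x := by
  unfold pd
  have h2 : (fun y => c * f y) = c • f := rfl
  rw [h2, fderiv_const_smul_field]; rfl

lemma pd_mul {f g : En n → ℝ} {x : En n} (hf : DifferentiableAt ℝ f x)
    (hg : DifferentiableAt ℝ g x) (i : Fin n) :
    pd (fun y => f y * g y) i x = f x * pd g i x + g x * pd f i x := by
  unfold pd; rw [fderiv_fun_mul hf hg]; simp

lemma pd_comm {f : En n → ℝ} {x : En n} (hf : ContDiffAt ℝ 2 f x) (i j : Fin n) :
    pd (pd f i) j x = pd (pd f j) i x := by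
  have h1 : DifferentiableAt ℝ (fderiv ℝ f) x :=
    (hf.fderiv_right (m := 1) (by norm_num)).differentiableAt (by norm_num)
  have h2 : ∀ i j, pd (pd f i) j x = fderiv ℝ (fderiv ℝ f) x (eb j) (eb i) := by
    intro i j
    unfold pd
    rw [fderiv_clm_apply h1 (differentiableAt_const _)]
    simp
  rw [h2, h2]
  exact (hf.isSymmSndFDerivAt (by simp)).eq _ _

lemma pd_hom {f : En n → ℝ} {k : ℤ} (h : ∀ t : ℝ, 0 < t → ∀ x, f (t • x) = t ^ k * f x)
    (i : Fin n) (t : ℝ) (ht : 0 < t) (x : En n) : pd f i (t • x) = t ^ (k - 1) * pd f i x := by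
  have h1 : pd (fun y => f (t • y)) i x = t * pd f i (t • x) := by
    unfold pd; rw [fderiv_comp_smul]; simp
  have h2 : (fun y => f (t • y)) = fun y => t ^ k * f y := funext (h t ht)
  rw [h2, pd_const_mul] at h1
  rw [zpow_sub_one₀ ht.ne']; field_simp; linarith

lemma euler {f : En n → ℝ} {k : ℤ} (h : ∀ t : ℝ, 0 < t → ∀ x, f (t • x) = t ^ k * f x)
    {x : En n} (hf : DifferentiableAt ℝ f x) : ∑ i, x i * pd f i x = k * f x := by
  rw [← fderiv_apply_sum]
  have h1 : HasDerivAt (fun s : ℝ => f (s • x)) (fderiv ℝ f x x) 1 := by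
    have hc : HasDerivAt (fun s : ℝ => s • x) x 1 := by
      simpa using (hasDerivAt_id (1:ℝ)).smul_const x
    have hf' : HasFDerivAt f (fderiv ℝ f x) ((1:ℝ) • x) := by simpa using hf.hasFDerivAt
    exact hf'.comp_hasDerivAt 1 hc
  have h2 : HasDerivAt (fun s : ℝ => s ^ k * f x) ((k * 1 ^ (k - 1)) * f x) 1 :=
    (hasDerivAt_zpow k 1 (by simp)).mul_const _
  have h3 : (fun s : ℝ => f (s • x)) =ᶠ[𝓝 1] fun s => s ^ k * f x := by
    filter_upwards [lt_mem_nhds (zero_lt_one' ℝ)] with s hs using h s hs x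
  have := h1.unique (h2.congr_of_eventuallyEq h3)
  simpa using this

/-- 1-homogeneous functions, `C^3` off the origin -/
structure Hom1 (f : En n → ℝ) : Prop where
  smooth : ∀ x, x ≠ 0 → ContDiffAt ℝ 3 f x
  hom : ∀ t : ℝ, 0 < t → ∀ x, f (t • x) = t * f x

/-- Hessian matrix -/
def hs (f : En n → ℝ) (x : En n) : Matrix (Fin n) (Fin n) ℝ := Matrix.of fun i j => pd (pd f i) j x

lemma hs_apply (f : En n → ℝ) (x : En n) (i j) : hs f x i j = pd (pd f i) j x := rfl

namespace Hom1
variable {f g : En n → ℝ} {x : En n}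

lemma hom' (hf : Hom1 f) : ∀ t : ℝ, 0 < t → ∀ x, f (t • x) = t ^ (1:ℤ) * f x := by
  simpa using hf.hom
lemma diff (hf : Hom1 f) (hx : x ≠ 0) : DifferentiableAt ℝ f x :=
  (hf.smooth x hx).differentiableAt (by norm_num)
lemma pd_smooth (hf : Hom1 f) (hx : x ≠ 0) (i : Fin n) : ContDiffAt ℝ 2 (pd f i) x :=
  pd_contDiffAt (hf.smooth x hx) (by norm_num) i
lemma pd_diff (hf : Hom1 f) (hx : x ≠ 0) (i : Fin n) : DifferentiableAt ℝ (pd f i) x :=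
  (hf.pd_smooth hx i).differentiableAt (by norm_num)
lemma hs_smooth (hf : Hom1 f) (hx : x ≠ 0) (i j : Fin n) :
    ContDiffAt ℝ 1 (fun y => hs f y i j) x :=
  pd_contDiffAt (hf.pd_smooth hx i) (by norm_num) j
lemma hs_diff (hf : Hom1 f) (hx : x ≠ 0) (i j : Fin n) :
    DifferentiableAt ℝ (fun y => hs f y i j) x :=
  (hf.hs_smooth hx i j).differentiableAt (by norm_num)
lemma hs_comm (hf : Hom1 f) (hx : x ≠ 0) (i j : Fin n) : hs f x i j = hs f x j i :=
  pd_comm ((hf.smooth x hx).of_le (by norm_num)) i j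
lemma hs_symm (hf : Hom1 f) (hx : x ≠ 0) : (hs f x).transpose = hs f x := by
  ext i j; exact hf.hs_comm hx j i
lemma hs_hom (hf : Hom1 f) {t : ℝ} (ht : 0 < t) (x : En n) : hs f (t • x) = t⁻¹ • hs f x := by
  ext i j
  have := pd_hom (k := 0) (f := pd f i) (fun t ht x => by
    simpa using pd_hom hf.hom' i t ht x) j t ht x
  simpa [hs] using this
lemma euler1 (hf : Hom1 f) (hx : x ≠ 0) : ∑ i, x i * pd f i x = f x := by
  simpa using euler hf.hom' (hf.diff hx)
lemma hs_mulVec (hf : Hom1 f) (hx : x ≠ 0) : (hs f x).mulVec x = 0 := by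
  ext i
  have := euler (k := 0) (f := pd f i) (fun t ht x => by
    simpa using pd_hom hf.hom' i t ht x) (hf.pd_diff hx i)
  simpa [Matrix.mulVec, dotProduct, hs, mul_comm] using this
lemma third_symm (hf : Hom1 f) (hx : x ≠ 0) (i j k : Fin n) :
    pd (fun y => hs f y i j) k x = pd (fun y => hs f y i k) j x :=
  pd_comm (hf.pd_smooth hx i) j k
lemma third_symm' (hf : Hom1 f) (hx : x ≠ 0) (i j k : Fin n) :
    pd (fun y => hs f y i j) k x = pd (fun y => hs f y j i) k x := by
  refine pd_congr ?_ k
  filter_upwards [isOpen_ne.mem_nhds hx] with y hy using hf.hs_comm hy i j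

lemma add (hf : Hom1 f) (hg : Hom1 g) : Hom1 (fun x => f x + g x) :=
  ⟨fun x hx => (hf.smooth x hx).add (hg.smooth x hx), fun t ht x => by
    rw [hf.hom t ht, hg.hom t ht]; ring⟩
lemma const_mul (hf : Hom1 f) (c : ℝ) : Hom1 (fun x => c * f x) :=
  ⟨fun x hx => contDiffAt_const.mul (hf.smooth x hx), fun t ht x => by
    rw [hf.hom t ht]; ring⟩
lemma hs_add (hf : Hom1 f) (hg : Hom1 g) (hx : x ≠ 0) :
    hs (fun x => f x + g x) x = hs f x + hs g x := by
  ext i j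
  have : pd (fun y => f y + g y) i =ᶠ[𝓝 x] fun y => pd f i y + pd g i y := by
    filter_upwards [isOpen_ne.mem_nhds hx] with y hy using pd_add (hf.diff hy) (hg.diff hy) i
  simp only [hs_apply, Matrix.add_apply]
  rw [pd_congr this, pd_add (hf.pd_diff hx i) (hg.pd_diff hx i)]
lemma hs_const_mul (f : En n → ℝ) (x : En n) (c : ℝ) : hs (fun x => c * f x) x = c • hs f x := by
  ext i j
  have : pd (fun y => c * f y) i = fun y => c * pd f i y := by ext y; exact pd_const_mul f y c i
  simp only [hs_apply, Matrix.smul_apply, this, pd_const_mul, smul_eq_mul]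
lemma hs_cont (hf : Hom1 f) : Continuous fun θ : Metric.sphere (0 : En n) 1 => hs f θ := by
  refine continuous_matrix fun i j => continuous_iff_continuousAt.2 fun θ => ?_
  have hθ : (θ : En n) ≠ 0 := ne_zero_of_mem_unit_sphere θ
  exact ((hf.hs_smooth hθ i j).continuousAt).comp continuous_subtype_val.continuousAt
lemma cont (hf : Hom1 f) : Continuous fun θ : Metric.sphere (0 : En n) 1 => f θ := by
  refine continuous_iff_continuousAt.2 fun θ => ?_
  have hθ : (θ : En n) ≠ 0 := ne_zero_of_mem_unit_sphere θ
  exact ((hf.smooth _ hθ).continuousAt).comp continuous_subtype_val.continuousAt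
end Hom1

lemma hom1_norm : Hom1 (fun x : En n => ‖x‖) :=
  ⟨fun _ hx => contDiffAt_norm ℝ hx, fun t ht x => by rw [norm_smul, Real.norm_of_nonneg ht.le]⟩

lemma pd_norm {x : En n} (hx : x ≠ 0) (i : Fin n) : pd (fun x : En n => ‖x‖) i x = x i / ‖x‖ := by
  have h1 : HasFDerivAt (fun x : En n => ‖x‖ ^ 2) (2 • innerSL ℝ x) x := by
    simpa using (hasStrictFDerivAt_norm_sq x).hasFDerivAt
  have h2 := ((hom1_norm.diff hx).hasFDerivAt).pow 2
  have h3 := congrArg (fun L => L (eb i)) (h1.unique h2)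
  have hx' : ‖x‖ ≠ 0 := norm_ne_zero_iff.2 hx
  simp [EuclideanSpace.inner_single_right] at h3
  rw [eq_div_iff hx']; unfold pd; linarith

lemma pd_coord (x : En n) (i j : Fin n) : pd (fun x : En n => x i) j x = if i = j then 1 else 0 := by
  have : HasFDerivAt (fun x : En n => x i) (EuclideanSpace.proj i : En n →L[ℝ] ℝ) x :=
    (EuclideanSpace.proj i : En n →L[ℝ] ℝ).hasFDerivAt
  unfold pd; rw [this.fderiv]; simp

lemma diff_coord (x : En n) (i : Fin n) : DifferentiableAt ℝ (fun x : En n => x i) x :=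
  (EuclideanSpace.proj i : En n →L[ℝ] ℝ).differentiableAt

lemma dot_sphere (θ : Metric.sphere (0 : En n) 1) : (θ : En n).ofLp ⬝ᵥ (θ : En n).ofLp = 1 := by
  have := EuclideanSpace.norm_sq_eq (θ : En n)
  simp at this
  simp [dotProduct, ← sq, ← this]

lemma hs_norm (θ : Metric.sphere (0 : En n) 1) : hs (fun x : En n => ‖x‖) θ = PP (θ : En n).ofLp := by
  have hθ : (θ : En n) ≠ 0 := ne_zero_of_mem_unit_sphere θ
  have h1 : ‖(θ : En n)‖ = 1 := by simp
  ext i j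
  have : pd (fun x : En n => ‖x‖) i =ᶠ[𝓝 (θ : En n)] fun y => y i * ‖y‖⁻¹ := by
    filter_upwards [isOpen_ne.mem_nhds hθ] with y hy using by rw [pd_norm hy, div_eq_mul_inv]
  have hd : DifferentiableAt ℝ (fun y : En n => ‖y‖⁻¹) θ :=
    (hom1_norm.diff hθ).inv (norm_ne_zero_iff.2 hθ)
  have h2 : pd (fun y : En n => ‖y‖⁻¹) j θ = - (θ : En n) j := by
    have h3 := pd_mul (hom1_norm.diff hθ) hd j
    have h4 : (fun y : En n => ‖y‖ * ‖y‖⁻¹) =ᶠ[𝓝 (θ : En n)] fun _ => 1 := by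
      filter_upwards [isOpen_ne.mem_nhds hθ] with y hy
      exact mul_inv_cancel₀ (norm_ne_zero_iff.2 hy)
    rw [pd_congr h4, pd_norm hθ, h1] at h3
    simp [pd] at h3 ⊢; linarith
  rw [hs_apply, pd_congr this, pd_mul (diff_coord _ i) hd, h2, pd_coord, h1]
  simp [PP, NN, Matrix.one_apply, Matrix.vecMulVec_apply]; ring

end calc1

section divg
variable {n : ℕ}

lemma contDiffAt_det {F : Type*} [NormedAddCommGroup F] [NormedSpace ℝ F] {k : WithTop ℕ∞}
    {M : F → Matrix (Fin n) (Fin n) ℝ} {x : F}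
    (h : ∀ i j, ContDiffAt ℝ k (fun y => M y i j) x) : ContDiffAt ℝ k (fun y => (M y).det) x := by
  simp only [Matrix.det_apply]
  refine ContDiffAt.sum fun σ _ => ?_
  exact ContDiffAt.const_smul _ (contDiffAt_prod fun i _ => h _ _)

lemma contDiffAt_adj {F : Type*} [NormedAddCommGroup F] [NormedSpace ℝ F] {k : WithTop ℕ∞}
    {M : F → Matrix (Fin n) (Fin n) ℝ} {x : F}
    (h : ∀ i j, ContDiffAt ℝ k (fun y => M y i j) x) (a b : Fin n) :
    ContDiffAt ℝ k (fun y => (M y).adjugate a b) x := by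
  simp only [Matrix.adjugate_apply]
  refine contDiffAt_det fun i j => ?_
  by_cases hi : i = b
  · subst hi; simpa using contDiffAt_const
  · simpa [Matrix.updateRow_ne hi] using h i j

lemma divfree_alg (G A : Matrix (Fin n) (Fin n) ℝ) (S : Fin n → Matrix (Fin n) (Fin n) ℝ)
    (x y : Fin n → ℝ) (c c1 c2 : ℝ) (D : Fin n → Matrix (Fin n) (Fin n) ℝ)
    (hG : ∀ a b, G a b = G b a) (hS1 : ∀ j a b, S j a b = S j b a)
    (hS2 : ∀ j a b, S j a b = S a j b) (hyx : ∑ j, y j * x j = 0)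
    (hGx : ∀ i, ∑ j, G i j * x j = c * x i) (hAx : ∀ i, ∑ j, A i j * x j = 0)
    (hD : ∀ j a b, D j a b = c1 * x j * A a b + c2 * S j a b + (if a = j then 1 else 0) * x b
      + x a * (if b = j then 1 else 0)) :
    ∑ j, ((∑ a, ∑ b, G a b * D j b a) * y j - ∑ a, ∑ b, y a * D j a b * G b j) = 0 := by
  have hGx' : ∀ i, ∑ j, x j * G j i = c * x i := fun i => by
    rw [← hGx]; exact Finset.sum_congr rfl fun j _ => by rw [hG]; ring
  have p1 : ∑ j, ((∑ a, ∑ b, G a b * (c1 * x j * A b a)) * y j) = 0 := by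
    have : ∀ j, (∑ a, ∑ b, G a b * (c1 * x j * A b a)) * y j
        = (y j * x j) * (c1 * ∑ a, ∑ b, G a b * A b a) := fun j => by
      simp only [Finset.sum_mul, Finset.mul_sum]
      exact Finset.sum_congr rfl fun _ _ => Finset.sum_congr rfl fun _ _ => by ring
    simp only [this, ← Finset.sum_mul, hyx, zero_mul]
  have p2 : ∑ j, ∑ a, ∑ b, y a * (c1 * x j * A a b) * G b j = 0 := by
    rw [Finset.sum_comm]
    refine Finset.sum_eq_zero fun a _ => ?_
    rw [Finset.sum_comm]
    have : ∀ b, ∑ j, y a * (c1 * x j * A a b) * G b j = (c1 * y a * c) * (A a b * x b) := fun b => by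
      rw [mul_assoc, mul_left_comm c, ← hGx b]
      simp only [Finset.mul_sum]
      exact Finset.sum_congr rfl fun _ _ => by ring
    simp only [this, ← Finset.mul_sum, hAx, mul_zero]
  have p3 : ∑ j, ((∑ a, ∑ b, G a b * (c2 * S j b a)) * y j)
      = ∑ j, ∑ a, ∑ b, y a * (c2 * S j a b) * G b j := by
    rw [Finset.sum_comm]
    refine Finset.sum_congr rfl fun j _ => ?_
    simp only [Finset.sum_mul]
    refine Finset.sum_congr rfl fun a _ => Finset.sum_congr rfl fun b _ => ?_
    rw [hG a b, hS2 a j b, hS1 j b a]; ring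
  have p4 : ∑ j, ((∑ a, ∑ b, G a b * ((if b = j then 1 else 0) * x a)) * y j) = 0 := by
    have : ∀ j, (∑ a, ∑ b, G a b * ((if b = j then 1 else 0) * x a)) * y j = c * (y j * x j) := by
      intro j
      simp only [ite_mul, one_mul, zero_mul, mul_ite, mul_zero, Finset.sum_ite_eq',
        Finset.mem_univ, if_true]
      rw [Finset.sum_congr rfl (fun a _ => mul_comm (G a j) (x a)), hGx']; ring
    simp only [this, ← Finset.mul_sum, hyx, mul_zero]
  have p5 : ∑ j, ((∑ a, ∑ b, G a b * (x b * (if a = j then 1 else 0))) * y j) = 0 := by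
    have : ∀ j, (∑ a, ∑ b, G a b * (x b * (if a = j then 1 else 0))) * y j = c * (y j * x j) := by
      intro j
      rw [Finset.sum_comm]
      simp only [mul_ite, mul_one, mul_zero, Finset.sum_ite_eq', Finset.mem_univ, if_true, hGx]
      ring
    simp only [this, ← Finset.mul_sum, hyx, mul_zero]
  have p6 : ∑ j, ∑ a, ∑ b, y a * ((if a = j then 1 else 0) * x b) * G b j = 0 := by
    have : ∀ j, ∑ a, ∑ b, y a * ((if a = j then 1 else 0) * x b) * G b j = c * (y j * x j) := by
      intro j
      rw [Finset.sum_comm]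
      simp only [ite_mul, one_mul, zero_mul, mul_ite, mul_zero, Finset.sum_ite_eq',
        Finset.mem_univ, if_true]
      simp only [mul_assoc, ← Finset.mul_sum, hGx']; ring
    simp only [this, ← Finset.mul_sum, hyx, mul_zero]
  have p7 : ∑ j, ∑ a, ∑ b, y a * (x a * (if b = j then 1 else 0)) * G b j = 0 := by
    have : ∀ j, ∑ a, ∑ b, y a * (x a * (if b = j then 1 else 0)) * G b j = 0 := by
      intro j
      simp only [ite_mul, zero_mul, mul_ite, mul_zero, mul_one, Finset.sum_ite_eq',
        Finset.mem_univ, if_true]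
      rw [← Finset.sum_mul, hyx, zero_mul]
    simp only [this, Finset.sum_const_zero]
  simp only [hD, mul_add, add_mul, Finset.sum_add_distrib, Finset.sum_sub_distrib]
  rw [p1, p2, p3, p4, p5, p6, p7]; ring

variable (h : En n → ℝ)
/-- homogeneous extension -/
def Mp (x : En n) : Matrix (Fin n) (Fin n) ℝ := ‖x‖ ^ 3 • hs h x + NN x.ofLp

variable {h}
lemma Mp_hom (hh : Hom1 h) {t : ℝ} (ht : 0 < t) (x : En n) : Mp h (t • x) = t ^ 2 • Mp h x := by
  unfold Mp
  rw [hh.hs_hom ht, norm_smul, Real.norm_of_nonneg ht.le]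
  ext i j
  simp [NN, Matrix.vecMulVec_apply]
  field_simp

lemma Mp_sphere (θ : Metric.sphere (0 : En n) 1) : Mp h θ = hs h θ + NN (θ : En n).ofLp := by
  simp [Mp]

lemma Mp_symm (hh : Hom1 h) {x : En n} (hx : x ≠ 0) : (Mp h x).transpose = Mp h x := by
  simp [Mp, hh.hs_symm hx, NN_symm]

lemma norm_sq_sum (x : En n) : ∑ i, x i * x i = ‖x‖ ^ 2 := by
  rw [EuclideanSpace.norm_sq_eq]; simp [sq]

lemma Mp_mulVec (hh : Hom1 h) {x : En n} (hx : x ≠ 0) :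
    (Mp h x).mulVec x.ofLp = ‖x‖ ^ 2 • x.ofLp := by
  rw [Mp, Matrix.add_mulVec, Matrix.smul_mulVec, hh.hs_mulVec hx, smul_zero, zero_add, NN,
    Matrix.vecMulVec_mulVec, ← norm_sq_sum]
  ext i; simp [dotProduct, mul_comm]

lemma Mp_smooth (hh : Hom1 h) {x : En n} (hx : x ≠ 0) (i j : Fin n) :
    ContDiffAt ℝ 1 (fun y => Mp h y i j) x := by
  simp only [Mp, Matrix.add_apply, Matrix.smul_apply, smul_eq_mul, NN, Matrix.vecMulVec_apply]
  refine (((contDiffAt_norm ℝ hx).pow 3).mul (hh.hs_smooth hx i j)).add ?_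
  exact ((EuclideanSpace.proj i : En n →L[ℝ] ℝ).contDiff.contDiffAt).mul
    ((EuclideanSpace.proj j : En n →L[ℝ] ℝ).contDiff.contDiffAt)

lemma pd_Mp (hh : Hom1 h) {x : En n} (hx : x ≠ 0) (k i j : Fin n) :
    pd (fun y => Mp h y i j) k x = 3 * ‖x‖ * x k * hs h x i j
      + ‖x‖ ^ 3 * pd (fun y => hs h y i j) k x + (if i = k then 1 else 0) * x j
      + x i * (if j = k then 1 else 0) := by
  have hx' : ‖x‖ ≠ 0 := norm_ne_zero_iff.2 hx
  simp only [Mp, Matrix.add_apply, Matrix.smul_apply, smul_eq_mul, NN, Matrix.vecMulVec_apply]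
  have hd1 : DifferentiableAt ℝ (fun y : En n => ‖y‖ ^ 3) x := (hom1_norm.diff hx).pow 3
  have hp : pd (fun y : En n => ‖y‖ ^ 3) k x = 3 * ‖x‖ * x k := by
    have h1 : pd (fun y : En n => ‖y‖ ^ 3) k x = 3 * ‖x‖ ^ 2 * pd (fun y : En n => ‖y‖) k x := by
      unfold pd
      rw [((hom1_norm.diff hx).hasFDerivAt.pow 3).fderiv]; simp
    rw [h1, pd_norm hx]; field_simp
  rw [pd_add (hd1.fun_mul (hh.hs_diff hx i j)) ((diff_coord x i).fun_mul (diff_coord x j)),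
    pd_mul hd1 (hh.hs_diff hx i j), pd_mul (diff_coord x i) (diff_coord x j), pd_coord, pd_coord, hp]
  ring


lemma pd_sum {ι : Type*} (s : Finset ι) {F : ι → En n → ℝ} {x : En n}
    (hF : ∀ i ∈ s, DifferentiableAt ℝ (F i) x) (k : Fin n) :
    pd (fun y => ∑ i ∈ s, F i y) k x = ∑ i ∈ s, pd (F i) k x := by
  unfold pd; rw [fderiv_fun_sum hF]; simp

lemma pd_adj (hh : Hom1 h) {x : En n} (hx : x ≠ 0) (hdet : (Mp h x).det ≠ 0) (i j k : Fin n) :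
    pd (fun y => (Mp h y).adjugate i j) k x =
      (Mp h x).det * (((Mp h x)⁻¹ * Matrix.of fun a b => pd (fun y => Mp h y a b) k x).trace
        * (Mp h x)⁻¹ i j
       - ((Mp h x)⁻¹ * (Matrix.of fun a b => pd (fun y => Mp h y a b) k x) * (Mp h x)⁻¹) i j) := by
  refine pd_eq_of_line
    ((contDiffAt_adj (Mp_smooth hh hx) i j).differentiableAt (by norm_num)) ?_
  have := hasDerivAt_adj_inv (M := fun s => Mp h (x + s • eb k))
    (M' := Matrix.of fun a b => pd (fun y => Mp h y a b) k x) (t := 0)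
    (fun a b => pd_line ((Mp_smooth hh hx a b).differentiableAt (by norm_num)) k)
    (by simpa using hdet) i j
  simpa using this

lemma div_adj (hh : Hom1 h) {x : En n} (hx : x ≠ 0) (hdet : (Mp h x).det ≠ 0) (w : Fin n → ℝ)
    (hw : ∑ i, w i * x i = 0) :
    ∑ j, ∑ i, pd (fun y => (Mp h y).adjugate i j) j x * w i = 0 := by
  have hx' : ‖x‖ ≠ 0 := norm_ne_zero_iff.2 hx
  set G := (Mp h x)⁻¹ with hG
  have hu : IsUnit (Mp h x).det := isUnit_iff_ne_zero.2 hdet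
  have hGs : ∀ a b, G a b = G b a := by
    intro a b
    have : G.transpose = G := by rw [hG, Matrix.transpose_nonsing_inv, Mp_symm hh hx]
    conv_lhs => rw [← this]
    rfl
  have hGx : ∀ i, ∑ j, G i j * x j = (‖x‖ ^ 2)⁻¹ * x i := by
    intro i
    have h1 := congrArg (fun v => G.mulVec v) (Mp_mulVec hh hx)
    simp only [Matrix.mulVec_mulVec, hG, Matrix.nonsing_inv_mul _ hu, Matrix.one_mulVec,
      Matrix.mulVec_smul] at h1
    have h2 := congrFun h1 i
    simp only [Pi.smul_apply, smul_eq_mul, Matrix.mulVec, dotProduct] at h2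
    rw [h2, inv_mul_cancel_left₀ (by positivity)]
  set y : Fin n → ℝ := fun j => ∑ i, G i j * w i with hy
  have hyx : ∑ j, y j * x j = 0 := by
    simp only [hy, Finset.sum_mul]
    rw [Finset.sum_comm]
    have : ∀ i, ∑ j, G i j * w i * x j = (‖x‖ ^ 2)⁻¹ * (w i * x i) := fun i => by
      rw [mul_left_comm, ← hGx, Finset.mul_sum]
      exact Finset.sum_congr rfl fun j _ => by ring
    simp only [this, ← Finset.mul_sum, hw, mul_zero]
  have key := divfree_alg G (hs h x) (fun k => Matrix.of fun a b => pd (fun y => hs h y a b) k x)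
    x.ofLp y _ (3 * ‖x‖) (‖x‖ ^ 3) (fun k => Matrix.of fun a b => pd (fun y => Mp h y a b) k x)
    hGs (fun j a b => hh.third_symm' hx a b j)
    (fun j a b => by
      change pd (fun y => hs h y a b) j x = pd (fun y => hs h y j b) a x
      rw [hh.third_symm' hx a b j, hh.third_symm hx b a j, hh.third_symm' hx b j a]) hyx hGx
    (fun i => congrFun (hh.hs_mulVec hx) i) (fun j a b => pd_Mp hh hx j a b)
  have e : ∀ j, ∑ i, pd (fun y => (Mp h y).adjugate i j) j x * w i
      = (Mp h x).det * ((∑ a, ∑ b, G a b * pd (fun y => Mp h y b a) j x) * y j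
        - ∑ a, ∑ b, y a * pd (fun y => Mp h y a b) j x * G b j) := by
    intro j
    have e1 : ∑ a, ∑ b, y a * pd (fun y => Mp h y a b) j x * G b j =
        ∑ i, (G * (Matrix.of fun a b => pd (fun y => Mp h y a b) j x) * G) i j * w i := by
      simp only [Matrix.mul_apply, hy, Finset.sum_mul, Matrix.of_apply]
      rw [Finset.sum_comm]
      conv_rhs => rw [Finset.sum_comm]
      refine Finset.sum_congr rfl fun b _ => ?_
      rw [Finset.sum_comm]
      exact Finset.sum_congr rfl fun _ _ => Finset.sum_congr rfl fun _ _ => by ring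
    rw [e1, hy]
    simp only [pd_adj hh hx hdet, ← hG]
    have e2 : (G * Matrix.of fun a b => pd (fun y => Mp h y a b) j x).trace =
        ∑ a, ∑ b, G a b * pd (fun y => Mp h y b a) j x := by
      simp [Matrix.trace, Matrix.mul_apply]
    rw [e2, Finset.mul_sum, ← Finset.sum_sub_distrib, Finset.mul_sum]
    exact Finset.sum_congr rfl fun i _ => by ring
  simp only [e, ← Finset.mul_sum]
  rw [mul_eq_zero]; right; exact key

/-- the vector field -/
def Zf (ψ : ℝ → ℝ) (h f g : En n → ℝ) (j : Fin n) (y : En n) : ℝ :=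
  ψ ‖y‖ * ∑ i, (Mp h y).adjugate i j * (f y * pd g i y - g y * pd f i y)

variable {f g : En n → ℝ} {ψ : ℝ → ℝ}

lemma Zf_smooth (hψ : ContDiff ℝ 1 ψ) (hh : Hom1 h) (hf : Hom1 f) (hg : Hom1 g) {x : En n}
    (hx : x ≠ 0) (j : Fin n) : ContDiffAt ℝ 1 (Zf ψ h f g j) x := by
  unfold Zf
  refine (hψ.contDiffAt.comp x (contDiffAt_norm ℝ hx)).mul (ContDiffAt.sum fun i _ => ?_)
  refine (contDiffAt_adj (Mp_smooth hh hx) i j).mul (ContDiffAt.sub ?_ ?_)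
  · exact ((hf.smooth x hx).of_le (by norm_num)).mul ((hg.pd_smooth hx i).of_le (by norm_num))
  · exact ((hg.smooth x hx).of_le (by norm_num)).mul ((hf.pd_smooth hx i).of_le (by norm_num))

lemma div_Zf (hψ : ContDiff ℝ 1 ψ) (hh : Hom1 h) (hf : Hom1 f) (hg : Hom1 g) {x : En n}
    (hx : x ≠ 0) (hdet : (Mp h x).det ≠ 0) :
    ∑ j, pd (Zf ψ h f g j) j x = ψ ‖x‖ * (f x * ((Mp h x).adjugate * hs g x).trace
      - g x * ((Mp h x).adjugate * hs f x).trace) := by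
  have hx' : ‖x‖ ≠ 0 := norm_ne_zero_iff.2 hx
  set T := (Mp h x).adjugate with hT
  have hTs : ∀ a b, T a b = T b a := by
    intro a b
    have : T.transpose = T := by rw [hT, Matrix.adjugate_transpose, Mp_symm hh hx]
    conv_lhs => rw [← this]
    rfl
  have hTx : ∀ i, ∑ j, T i j * x j = (‖x‖ ^ 2)⁻¹ * (Mp h x).det * x i := by
    intro i
    have h1 := congrArg (fun v => T.mulVec v) (Mp_mulVec hh hx)
    simp only [Matrix.mulVec_mulVec, hT, Matrix.adjugate_mul, Matrix.smul_mulVec,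
      Matrix.one_mulVec, Matrix.mulVec_smul] at h1
    have h2 := congrFun h1 i
    simp only [Pi.smul_apply, smul_eq_mul, Matrix.mulVec, dotProduct] at h2
    rw [mul_assoc, h2, inv_mul_cancel_left₀ (by positivity)]
  set w : Fin n → En n → ℝ := fun i y => f y * pd g i y - g y * pd f i y with hw
  have hwd : ∀ i, DifferentiableAt ℝ (w i) x := fun i =>
    ((hf.diff hx).fun_mul (hg.pd_diff hx i)).fun_sub ((hg.diff hx).fun_mul (hf.pd_diff hx i))
  have hpw : ∀ i j, pd (w i) j x = f x * hs g x i j + pd g i x * pd f j x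
      - (g x * hs f x i j + pd f i x * pd g j x) := by
    intro i j
    have : w i = fun y => f y * pd g i y + (-1) * (g y * pd f i y) := by
      ext y; simp only [hw]; ring
    rw [this, pd_add ((hf.diff hx).fun_mul (hg.pd_diff hx i))
      (((hg.diff hx).fun_mul (hf.pd_diff hx i)).const_mul _), pd_const_mul,
      pd_mul (hf.diff hx) (hg.pd_diff hx i), pd_mul (hg.diff hx) (hf.pd_diff hx i)]
    simp only [hs_apply]; ring
  have hwx : ∑ i, w i x * x i = 0 := by
    have e1 := hf.euler1 hx
    have e2 := hg.euler1 hx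
    have : ∀ i, w i x * x i = f x * (x i * pd g i x) - g x * (x i * pd f i x) := fun i => by
      simp only [hw]; ring
    simp only [this, Finset.sum_sub_distrib, ← Finset.mul_sum, e1, e2]; ring
  have hTd : ∀ i j, DifferentiableAt ℝ (fun y => (Mp h y).adjugate i j) x := fun i j =>
    (contDiffAt_adj (Mp_smooth hh hx) i j).differentiableAt (by norm_num)
  have hψd : DifferentiableAt ℝ (fun y : En n => ψ ‖y‖) x :=
    ((hψ.differentiable (by norm_num)) _).comp x (hom1_norm.diff hx)
  have hpψ : ∀ j, pd (fun y : En n => ψ ‖y‖) j x = deriv ψ ‖x‖ * ‖x‖⁻¹ * x j := by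
    intro j
    have h1 := ((hψ.differentiable (by norm_num)) ‖x‖).hasDerivAt.comp_hasFDerivAt x
      (hom1_norm.diff hx).hasFDerivAt
    have h2 := pd_norm hx j
    unfold pd at h2 ⊢
    have h3 : (fun y : En n => ψ ‖y‖) = ψ ∘ fun y : En n => ‖y‖ := rfl
    rw [h3, h1.fderiv, ContinuousLinearMap.smul_apply, h2, smul_eq_mul]; ring
  have e : ∀ j, pd (Zf ψ h f g j) j x = ψ ‖x‖ * (∑ i, T i j * pd (w i) j x)
      + ψ ‖x‖ * (∑ i, pd (fun y => (Mp h y).adjugate i j) j x * w i x)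
      + deriv ψ ‖x‖ * ‖x‖⁻¹ * ∑ i, T i j * x j * w i x := by
    intro j
    unfold Zf
    rw [pd_mul hψd (DifferentiableAt.fun_sum fun i _ => (hTd i j).fun_mul (hwd i)), hpψ,
      pd_sum _ (fun i _ => (hTd i j).fun_mul (hwd i))]
    simp only [fun i => pd_mul (hTd i j) (hwd i) j, Finset.sum_add_distrib, mul_add]
    congr 1
    · congr 2
      exact Finset.sum_congr rfl fun i _ => by ring
    · rw [Finset.sum_mul, Finset.mul_sum]
      exact Finset.sum_congr rfl fun i _ => by ring
  simp only [e, Finset.sum_add_distrib, ← Finset.mul_sum]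
  rw [div_adj hh hx hdet (fun i => w i x) hwx]
  have z1 : ∑ j, ∑ i, T i j * x j * w i x = 0 := by
    rw [Finset.sum_comm]
    have : ∀ i, ∑ j, T i j * x j * w i x = (‖x‖ ^ 2)⁻¹ * (Mp h x).det * (w i x * x i) := fun i => by
      rw [← Finset.sum_mul, hTx]; ring
    simp only [this, ← Finset.mul_sum, hwx, mul_zero]
  have z2 : ∑ j, ∑ i, T i j * (pd g i x * pd f j x) = ∑ j, ∑ i, T i j * (pd f i x * pd g j x) := by
    rw [Finset.sum_comm]
    exact Finset.sum_congr rfl fun i _ => Finset.sum_congr rfl fun j _ => by rw [hTs]; ring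
  have z3 : ∀ u, Hom1 u → (T * hs u x).trace = ∑ j, ∑ i, T i j * hs u x i j := by
    intro u hu
    simp only [Matrix.trace, Matrix.diag, Matrix.mul_apply]
    exact Finset.sum_congr rfl fun i _ => Finset.sum_congr rfl fun j _ => by
      rw [hTs]
  rw [z1, z3 g hg, z3 f hf]
  simp only [hpw, mul_sub, mul_add, Finset.sum_sub_distrib, Finset.sum_add_distrib, z2]
  simp only [mul_left_comm (T _ _) (f x), mul_left_comm (T _ _) (g x), ← Finset.mul_sum]
  ring

end divg

section polar
variable {n : ℕ}

/-- unit sphere -/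
abbrev Sp (n : ℕ) : Type := Metric.sphere (0 : En n) 1
/-- surface measure -/
abbrev sg (n : ℕ) : Measure (Sp n) := (volume : Measure (En n)).toSphere

lemma polar_hom [NeZero n] {F : En n → ℝ} {k : ℕ} (hF : ∀ t : ℝ, 0 < t → ∀ x, F (t • x) = t ^ k * F x)
    (ψ : ℝ → ℝ) : ∫ x, ψ ‖x‖ * F x =
      (∫ θ : Sp n, F θ ∂(sg n)) *
        ∫ r : Set.Ioi (0:ℝ), ψ r * (r:ℝ) ^ k ∂(Measure.volumeIoiPow (Module.finrank ℝ (En n) - 1)) := by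
  rw [← integral_prod_mul]
  calc ∫ x, ψ ‖x‖ * F x = ∫ x : ({(0)}ᶜ : Set (En n)), ψ ‖x.1‖ * F x.1 ∂(volume.comap Subtype.val) := by
        rw [integral_subtype_comap (measurableSet_singleton _).compl fun x ↦ ψ ‖x‖ * F x,
          restrict_compl_singleton]
    _ = _ := by
        rw [← (volume : Measure (En n)).measurePreserving_homeomorphUnitSphereProd.integral_comp
          (Homeomorph.measurableEmbedding _)]
        congr 1; ext x
        have hx : 0 < ‖x.1‖ := norm_pos_iff.2 x.2
        have h1 : x.1 = ‖x.1‖ • (‖x.1‖⁻¹ • x.1) := by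
          rw [smul_smul, mul_inv_cancel₀ hx.ne', one_smul]
        simp only [homeomorphUnitSphereProd_apply_fst_coe, homeomorphUnitSphereProd_apply_snd_coe]
        conv_lhs => rw [h1, hF _ hx]
        rw [← h1]; ring

lemma integral_pd_zero {Z : En n → ℝ} (hZ : ContDiff ℝ 1 Z) (hc : HasCompactSupport Z) (j : Fin n) :
    ∫ x, pd Z j x = 0 := by
  have hi : Integrable (fun x => fderiv ℝ Z x (EuclideanSpace.single j 1)) := by
    refine Continuous.integrable_of_hasCompactSupport
      ((hZ.continuous_fderiv (by norm_num)).clm_apply continuous_const) ?_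
    exact (hc.fderiv (𝕜 := ℝ)).comp_left (g := fun L : En n →L[ℝ] ℝ => L (EuclideanSpace.single j 1))
      (by simp)
  have := integral_mul_fderiv_eq_neg_fderiv_mul_of_integrable (μ := (volume : Measure (En n)))
    (f := fun _ => (1:ℝ)) (g := Z) (v := EuclideanSpace.single j 1) (by simp) (by simpa using hi)
    (by simpa using hZ.continuous.integrable_of_hasCompactSupport hc)
    (fun x _ => differentiableAt_const _) (fun x _ => hZ.differentiable (by norm_num) x)
  simpa [pd] using this

lemma exists_psi : ∃ ψ : ℝ → ℝ, ContDiff ℝ 1 ψ ∧ (∀ r, r ≤ 1 → ψ r = 0) ∧ (∀ r, 3 ≤ r → ψ r = 0) ∧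
    (∀ r, 0 ≤ ψ r) ∧ ψ 2 = 1 := by
  let b : ContDiffBump (2:ℝ) := ⟨1/2, 1, by norm_num, by norm_num⟩
  refine ⟨b, b.contDiff, fun r hr => b.zero_of_le_dist ?_, fun r hr => b.zero_of_le_dist ?_,
    fun r => b.nonneg, b.one_of_mem_closedBall (by simp [b])⟩
  · rw [Real.dist_eq, abs_of_nonpos (by linarith)]; change (1:ℝ) ≤ _; linarith
  · rw [Real.dist_eq, abs_of_nonneg (by linarith)]; change (1:ℝ) ≤ _; linarith

lemma psi_radial_pos [NeZero n] {ψ : ℝ → ℝ} (h1 : ContDiff ℝ 1 ψ) (h2 : ∀ r, r ≤ 1 → ψ r = 0)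
    (h3 : ∀ r, 3 ≤ r → ψ r = 0) (h4 : ∀ r, 0 ≤ ψ r) (h5 : ψ 2 = 1) (k : ℕ) :
    ∫ r : Set.Ioi (0:ℝ), ψ r * (r:ℝ) ^ k
      ∂(Measure.volumeIoiPow (Module.finrank ℝ (En n) - 1)) ≠ 0 := by
  have := polar_hom (n := n) (F := fun x => ‖x‖ ^ k) (k := k) (fun t ht x => by
    rw [norm_smul, Real.norm_of_nonneg ht.le, mul_pow]) ψ
  have hpos : 0 < ∫ x : En n, ψ ‖x‖ * ‖x‖ ^ k := by
    refine Continuous.integral_pos_of_hasCompactSupport_nonneg_nonzero (x := (2:ℝ) • eb 0)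
      ?_ ?_ ?_ ?_
    · have := h1.continuous; fun_prop
    · refine HasCompactSupport.intro (isCompact_closedBall (0: En n) 3) fun x hx => ?_
      rw [h3 _ (by simp at hx; linarith), zero_mul]
    · intro x; exact mul_nonneg (h4 _) (by positivity)
    · simp [norm_smul, eb, h5]
  intro h0
  rw [this, h0, mul_zero] at hpos
  exact lt_irrefl _ hpos

lemma Zf_contDiff {ψ : ℝ → ℝ} {h f g : En n → ℝ} (hψ : ContDiff ℝ 1 ψ) (h2 : ∀ r, r ≤ 1 → ψ r = 0)
    (hh : Hom1 h) (hf : Hom1 f) (hg : Hom1 g) (j : Fin n) : ContDiff ℝ 1 (Zf ψ h f g j) := by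
  rw [contDiff_iff_contDiffAt]; intro x
  by_cases hx : x = 0
  · subst hx
    refine (contDiffAt_const (c := (0:ℝ))).congr_of_eventuallyEq ?_
    filter_upwards [Metric.ball_mem_nhds (0 : En n) one_pos] with y hy
    simp only [Zf]; rw [h2 _ (by simpa using (mem_ball_zero_iff.1 hy).le), zero_mul]
  · exact Zf_smooth hψ hh hf hg hx j

lemma adj_smul_pow (c : ℝ) (M : Matrix (Fin n) (Fin n) ℝ) : (c • M).adjugate = c ^ (n - 1) • M.adjugate := by
  rw [Matrix.adjugate_smul]; simp

theorem A1 (hn : 3 ≤ n) {h f g : En n → ℝ} (hh : Hom1 h) (hf : Hom1 f) (hg : Hom1 g)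
    (hdet : ∀ θ : Sp n, (hs h θ + NN (θ : En n).ofLp).det ≠ 0) :
    ∫ θ : Sp n, f θ * ((hs h θ + NN (θ : En n).ofLp).adjugate * hs g θ).trace ∂(sg n) =
    ∫ θ : Sp n, g θ * ((hs h θ + NN (θ : En n).ofLp).adjugate * hs f θ).trace ∂(sg n) := by
  have : NeZero n := ⟨by omega⟩
  obtain ⟨ψ, h1, h2, h3, h4, h5⟩ := exists_psi
  have hdet' : ∀ x : En n, x ≠ 0 → (Mp h x).det ≠ 0 := by
    intro x hx
    have hx' : 0 < ‖x‖ := norm_pos_iff.2 hx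
    have e : x = ‖x‖ • (‖x‖⁻¹ • x) := by rw [smul_smul, mul_inv_cancel₀ hx'.ne', one_smul]
    have hm : ‖x‖⁻¹ • x ∈ Metric.sphere (0 : En n) 1 := by
      simp [norm_smul, hx'.ne']
    rw [e, Mp_hom hh hx', Matrix.det_smul]
    have := hdet ⟨_, hm⟩
    rw [← Mp_sphere] at this
    exact mul_ne_zero (by positivity) this
  set F : En n → ℝ := fun x => f x * ((Mp h x).adjugate * hs g x).trace
      - g x * ((Mp h x).adjugate * hs f x).trace with hF
  have hFh : ∀ t : ℝ, 0 < t → ∀ x, F (t • x) = t ^ (2 * (n - 1)) * F x := by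
    intro t ht x
    simp only [hF, Mp_hom hh ht, hf.hs_hom ht, hg.hs_hom ht, hf.hom t ht, hg.hom t ht, adj_smul_pow,
      Matrix.smul_mul, Matrix.mul_smul, Matrix.trace_smul, smul_eq_mul, pow_mul]
    field_simp
  have hint : ∫ x, ψ ‖x‖ * F x = 0 := by
    have e : ∀ x, ψ ‖x‖ * F x = ∑ j, pd (Zf ψ h f g j) j x := by
      intro x
      by_cases hx : x = 0
      · subst hx
        rw [norm_zero, h2 0 (by norm_num), zero_mul]
        symm
        refine Finset.sum_eq_zero fun j _ => ?_
        have : Zf ψ h f g j =ᶠ[𝓝 0] fun _ => 0 := by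
          filter_upwards [Metric.ball_mem_nhds (0 : En n) one_pos] with y hy
          simp only [Zf]; rw [h2 _ (by simpa using (mem_ball_zero_iff.1 hy).le), zero_mul]
        rw [pd_congr this]; simp [pd]
      · exact (div_Zf h1 hh hf hg hx (hdet' x hx)).symm
    have hcs : ∀ j, HasCompactSupport (Zf ψ h f g j) := fun j => by
      refine HasCompactSupport.intro (isCompact_closedBall (0: En n) 3) fun x hx => ?_
      simp only [Zf]; rw [h3 _ (by simp at hx; linarith), zero_mul]
    simp only [e]
    rw [integral_finsetSum]
    · exact Finset.sum_eq_zero fun j _ => integral_pd_zero (Zf_contDiff h1 h2 hh hf hg j) (hcs j) j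
    · intro j _
      refine Continuous.integrable_of_hasCompactSupport
        (((Zf_contDiff h1 h2 hh hf hg j).continuous_fderiv (by norm_num)).clm_apply continuous_const) ?_
      exact ((hcs j).fderiv (𝕜 := ℝ)).comp_left
        (g := fun L : En n →L[ℝ] ℝ => L (EuclideanSpace.single j 1)) (by simp)
  rw [polar_hom hFh, mul_eq_zero, or_iff_left (psi_radial_pos h1 h2 h3 h4 h5 _)] at hint
  have hc : ∀ u v : En n → ℝ, Hom1 u → Hom1 v → Integrable (fun θ : Sp n => u θ * ((hs h θ + NN (θ : En n).ofLp).adjugate * hs v θ).trace) (sg n) := by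
    intro u v hu hv
    refine Continuous.integrable_of_hasCompactSupport ?_ (HasCompactSupport.of_compactSpace _)
    refine hu.cont.mul (Continuous.matrix_trace ((Continuous.matrix_adjugate ?_).matrix_mul hv.hs_cont))
    refine hh.hs_cont.add ?_
    unfold NN
    exact Continuous.matrix_vecMulVec (by fun_prop) (by fun_prop)
  simp only [hF, Mp_sphere] at hint
  rw [integral_sub (hc f g hf hg) (hc g f hg hf)] at hint
  linarith
end polar

section polar
variable {n : ℕ}

lemma int_sg {u : Sp n → ℝ} (hu : Continuous u) : Integrable u (sg n) :=
  hu.integrable_of_hasCompactSupport (HasCompactSupport.of_compactSpace _)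

lemma hasDerivAt_integral_sg {F F' : ℝ → Sp n → ℝ} (hF : ∀ s, Continuous (F s))
    (hF' : Continuous (Function.uncurry F')) (hd : ∀ s θ, HasDerivAt (fun s => F s θ) (F' s θ) s) (s0 : ℝ) :
    HasDerivAt (fun s => ∫ θ, F s θ ∂(sg n)) (∫ θ, F' s0 θ ∂(sg n)) s0 := by
  obtain ⟨C, hC⟩ := ((isCompact_Icc (a := s0 - 1) (b := s0 + 1)).prod
    (isCompact_univ (X := Sp n))).exists_bound_of_continuousOn hF'.continuousOn
  refine (hasDerivAt_integral_of_dominated_loc_of_deriv_le (μ := sg n) (bound := fun _ => C)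
    (s := Set.Icc (s0 - 1) (s0 + 1)) (Icc_mem_nhds (by linarith) (by linarith))
    (Eventually.of_forall fun s => (hF s).aestronglyMeasurable) (int_sg (hF s0))
    ?_ ?_ (integrable_const _) ?_).2
  · exact (hF'.comp (by fun_prop : Continuous fun θ : Sp n => (s0, θ))).aestronglyMeasurable
  · exact Eventually.of_forall fun θ s hs => hC (s, θ) ⟨hs, Set.mem_univ _⟩
  · exact Eventually.of_forall fun θ s _ => hd s θ

/-- the matrix of h -/
def MM (h : En n → ℝ) (θ : Sp n) : Matrix (Fin n) (Fin n) ℝ := hs h θ + NN (θ : En n).ofLp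

lemma sp_ne (θ : Sp n) : (θ : En n) ≠ 0 := ne_of_apply_ne norm (by simp)

lemma NN_cont : Continuous fun θ : Sp n => NN (θ : En n).ofLp := by
  unfold NN; exact Continuous.matrix_vecMulVec (by fun_prop) (by fun_prop)

lemma PP_cont : Continuous fun θ : Sp n => PP (θ : En n).ofLp := by
  unfold PP; exact continuous_const.sub NN_cont

lemma MM_cont {h : En n → ℝ} (hh : Hom1 h) : Continuous (MM h) := hh.hs_cont.add NN_cont

lemma CC_symm {M : Matrix (Fin n) (Fin n) ℝ} (hM : M.det ≠ 0) (X Y) : CC M X Y = CC M Y X := by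
  rw [CC_eq hM, CC_eq hM, cc_comm]

theorem TT_symm (hn : 3 ≤ n) {h f g k : En n → ℝ} (hh : Hom1 h) (hf : Hom1 f) (hg : Hom1 g)
    (hk : Hom1 k) (hdet : ∀ θ : Sp n, (MM h θ).det ≠ 0) :
    ∫ θ : Sp n, f θ * CC (MM h θ) (hs g θ) (hs k θ) ∂(sg n) =
    ∫ θ : Sp n, g θ * CC (MM h θ) (hs f θ) (hs k θ) ∂(sg n) := by
  have hM : ∀ s (θ : Sp n), MM (fun x => h x + s * k x) θ = MM h θ + s • hs k θ := by
    intro s θ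
    rw [MM, hh.hs_add (hk.const_mul s) (sp_ne θ), Hom1.hs_const_mul, MM]; abel
  have hcont : Continuous fun p : ℝ × Sp n => MM h p.2 + p.1 • hs k p.2 :=
    ((MM_cont hh).comp continuous_snd).add (continuous_fst.smul (hk.hs_cont.comp continuous_snd))
  have hev : ∀ᶠ s in 𝓝 (0:ℝ), ∀ θ : Sp n, (MM h θ + s • hs k θ).det ≠ 0 := by
    have := isCompact_univ.eventually_forall_of_forall_eventually (x₀ := (0:ℝ)) (K := (Set.univ : Set (Sp n)))
      (P := fun s θ => (MM h θ + s • hs k θ).det ≠ 0) (fun θ _ =>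
        (hcont.matrix_det.continuousAt (x := ((0:ℝ), θ))).eventually_ne (by simpa using hdet θ))
    simpa using this
  have hD : ∀ u v : En n → ℝ, Hom1 u → Hom1 v →
      HasDerivAt (fun s : ℝ => ∫ θ : Sp n, u θ * ((MM h θ + s • hs k θ).adjugate * hs v θ).trace ∂(sg n))
        (∫ θ : Sp n, u θ * CC (MM h θ) (hs v θ) (hs k θ) ∂(sg n)) 0 := by
    intro u v hu hv
    have := hasDerivAt_integral_sg (n := n)
      (F := fun s θ => u θ * ((MM h θ + s • hs k θ).adjugate * hs v θ).trace)
      (F' := fun s θ => u θ * CC (MM h θ + s • hs k θ) (hs v θ) (hs k θ)) ?_ ?_ ?_ 0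
    · simpa using this
    · intro s
      have := hcont.comp (by fun_prop : Continuous fun θ : Sp n => (s, θ))
      exact hu.cont.mul (this.matrix_adjugate.matrix_mul hv.hs_cont).matrix_trace
    · exact (hu.cont.comp continuous_snd).mul (continuous_CC hcont (hv.hs_cont.comp continuous_snd)
        (hk.hs_cont.comp continuous_snd))
    · intro s θ
      refine HasDerivAt.const_mul _ (hasDerivAt_tr_adj (fun i j => ?_))
      simpa using ((hasDerivAt_id s).mul_const (hs k θ i j)).const_add (MM h θ i j)
  refine (hD f g hf hg).unique ((hD g f hg hf).congr_of_eventuallyEq ?_)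
  filter_upwards [hev] with s hs'
  have := A1 hn (hh.add (hk.const_mul s)) hf hg (fun θ => by
    have := hs' θ; rw [← hM] at this; exact this)
  simp only [← hM]; exact this
end polar

section bochner
variable {n : ℕ}

/-- projection off θ -/
abbrev Pe (θ : Sp n) : Matrix (Fin n) (Fin n) ℝ := PP (θ : En n).ofLp

/-- weight -/
def be (h : En n → ℝ) (θ : Sp n) : ℝ := CC (MM h θ) (Pe θ) (Pe θ)

/-- operator -/
def Lo (h u : En n → ℝ) (θ : Sp n) : ℝ := CC (MM h θ) (hs u θ) (Pe θ) / be h θ - u θ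

/-- residual -/
def Yo (h u : En n → ℝ) (θ : Sp n) : Matrix (Fin n) (Fin n) ℝ :=
  hs u θ - (((MM h θ)⁻¹ * hs u θ).trace / ((MM h θ)⁻¹ * Pe θ).trace) • Pe θ

/-- strictly convex support function -/
structure Good (h : En n → ℝ) : Prop where
  hom : Hom1 h
  pos : ∀ θ : Sp n, (MM h θ).PosDef

lemma CC_add {M : Matrix (Fin n) (Fin n) ℝ} (hM : M.det ≠ 0) (X X' Y) :
    CC M (X + X') Y = CC M X Y + CC M X' Y := by
  rw [CC_eq hM, CC_eq hM, CC_eq hM, cc_add_left]; ring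

lemma CC_smul {M : Matrix (Fin n) (Fin n) ℝ} (hM : M.det ≠ 0) (a : ℝ) (X Y) :
    CC M (a • X) Y = a * CC M X Y := by
  rw [CC_eq hM, CC_eq hM, cc_smul_left]; ring

lemma CC_nonneg {M X Y : Matrix (Fin n) (Fin n) ℝ} (hM : M.PosDef) (hX : X.PosSemidef)
    (hY : Y.PosSemidef) : 0 ≤ CC M X Y := by
  rw [CC_eq hM.det_pos.ne']
  exact mul_nonneg hM.det_pos.le (cc_nonneg hM.inv.posSemidef hX hY)

lemma pd2_mul {f g : En n → ℝ} {x : En n} (hf : ContDiffAt ℝ 2 f x) (hg : ContDiffAt ℝ 2 g x)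
    (i j : Fin n) : pd (pd (fun y => f y * g y) i) j x =
      f x * pd (pd g i) j x + g x * pd (pd f i) j x + pd f j x * pd g i x + pd f i x * pd g j x := by
  have e : pd (fun y => f y * g y) i =ᶠ[𝓝 x] fun y => f y * pd g i y + g y * pd f i y := by
    filter_upwards [hf.eventually (by simp), hg.eventually (by simp)] with y h1 h2
    exact pd_mul (h1.differentiableAt (by norm_num)) (h2.differentiableAt (by norm_num)) i
  have d1 := hf.differentiableAt (by norm_num)
  have d2 := hg.differentiableAt (by norm_num)
  have p1 := (pd_contDiffAt (m := 1) hf (by norm_num) i).differentiableAt (by norm_num)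
  have p2 := (pd_contDiffAt (m := 1) hg (by norm_num) i).differentiableAt (by norm_num)
  rw [pd_congr e, pd_add (d1.fun_mul p2) (d2.fun_mul p1), pd_mul d1 p2, pd_mul d2 p1]
  ring

lemma hom1_sq_div {u : En n → ℝ} (hu : Hom1 u) : Hom1 (fun x => u x * u x * ‖x‖⁻¹) where
  smooth x hx := ((hu.smooth x hx).mul (hu.smooth x hx)).mul
    ((contDiffAt_norm ℝ hx).inv (norm_ne_zero_iff.2 hx))
  hom t ht x := by
    rw [hu.hom t ht, norm_smul, Real.norm_of_nonneg ht.le, mul_inv]; field_simp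

lemma hs_sq_div {u : En n → ℝ} (hu : Hom1 u) (θ : Sp n) :
    hs (fun x => u x * u x * ‖x‖⁻¹) θ = (2 * u θ) • hs u θ + (-(u θ) ^ 2) • Pe θ +
      (2:ℝ) • NN (fun i => pd u i θ - u θ * (θ : En n) i) := by
  have hθ := sp_ne θ
  have hg := hom1_sq_div hu
  set g := fun x : En n => u x * u x * ‖x‖⁻¹ with hgd
  have hg1 : ∀ x : En n, x ≠ 0 → g x * ‖x‖ = u x * u x := fun x hx => by
    simp only [hgd]; rw [inv_mul_cancel_right₀ (norm_ne_zero_iff.2 hx)]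
  have e : (fun x => g x * ‖x‖) =ᶠ[𝓝 (θ : En n)] fun x => u x * u x := by
    filter_upwards [isOpen_ne.mem_nhds hθ] with y hy using hg1 y hy
  have h1 : ‖(θ : En n)‖ = 1 := by simp
  have hgθ : g θ = u θ * u θ := by simp [hgd]
  have c2 : ∀ {f : En n → ℝ}, Hom1 f → ContDiffAt ℝ 2 f θ := fun hf =>
    (hf.smooth _ hθ).of_le (by norm_num)
  have f1 : ∀ i, pd g i θ = 2 * u θ * pd u i θ - u θ * u θ * (θ : En n) i := by
    intro i
    have := pd_congr e i
    rw [pd_mul (hg.diff hθ) (hom1_norm.diff hθ), pd_mul (hu.diff hθ) (hu.diff hθ), pd_norm hθ, h1,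
      hgθ] at this
    linarith
  ext i j
  have := pd_congr (pd_eventually e i) j
  rw [pd2_mul (c2 hg) (c2 hom1_norm), pd2_mul (c2 hu) (c2 hu), ← hs_apply (fun x : En n => ‖x‖), hs_norm, h1,
    pd_norm hθ, pd_norm hθ, h1, f1, f1, hgθ] at this
  simp only [Matrix.add_apply, Matrix.smul_apply, smul_eq_mul, hs_apply, NN, Matrix.vecMulVec_apply]
  linear_combination this

variable {h u f : En n → ℝ}

namespace Good
lemma det_ne (H : Good h) (θ) : (MM h θ).det ≠ 0 := (H.pos θ).det_pos.ne'
lemma be_pos (hn : 3 ≤ n) (H : Good h) (θ) : 0 < be h θ := by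
  rw [be, CC_eq (H.det_ne θ)]
  exact mul_pos (H.pos θ).det_pos (cc_PP_pos hn (H.pos θ).inv (dot_sphere θ))
lemma CC_cont (H : Good h) {X Y : Sp n → Matrix (Fin n) (Fin n) ℝ} (hX : Continuous X) (hY : Continuous Y) :
    Continuous fun θ => CC (MM h θ) (X θ) (Y θ) := continuous_CC (MM_cont H.hom) hX hY
lemma be_cont (H : Good h) : Continuous (be h) := H.CC_cont PP_cont PP_cont
lemma Lo_cont (hn : 3 ≤ n) (H : Good h) (hu : Hom1 u) : Continuous (Lo h u) :=
  ((H.CC_cont hu.hs_cont PP_cont).div H.be_cont fun θ => (H.be_pos hn θ).ne').sub hu.cont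
lemma Lo_be (hn : 3 ≤ n) (H : Good h) (θ) :
    Lo h u θ * be h θ = CC (MM h θ) (hs u θ) (Pe θ) - u θ * be h θ := by
  rw [Lo, sub_mul, div_mul_cancel₀ _ (H.be_pos hn θ).ne']
lemma Lo_symm (hn : 3 ≤ n) (H : Good h) (hf : Hom1 f) (hu : Hom1 u) :
    ∫ θ : Sp n, f θ * Lo h u θ * be h θ ∂(sg n) = ∫ θ : Sp n, u θ * Lo h f θ * be h θ ∂(sg n) := by
  have e : ∀ v w : En n → ℝ, Hom1 v → Hom1 w → ∫ θ : Sp n, v θ * Lo h w θ * be h θ ∂(sg n) =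
      ∫ θ : Sp n, v θ * CC (MM h θ) (hs w θ) (Pe θ) ∂(sg n) - ∫ θ : Sp n, v θ * w θ * be h θ ∂(sg n) := by
    intro v w hv hw
    rw [← integral_sub (int_sg (hv.cont.fun_mul (H.CC_cont hw.hs_cont PP_cont)))
      (int_sg ((hv.cont.fun_mul hw.cont).fun_mul H.be_cont))]
    congr 1; ext θ; rw [mul_assoc, H.Lo_be hn]; ring
  rw [e f u hf hu, e u f hu hf]
  have := TT_symm hn H.hom hf hu hom1_norm H.det_ne
  simp only [hs_norm] at this
  simp only [Pe] at *
  rw [this]; simp only [mul_comm]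
lemma Lo_norm (hn : 3 ≤ n) (H : Good h) (θ) : Lo h (fun x => ‖x‖) θ = 0 := by
  have := H.be_pos hn θ
  rw [Lo, hs_norm]; change be h θ / be h θ - _ = 0
  rw [div_self this.ne']; simp
lemma Lo_mean (hn : 3 ≤ n) (H : Good h) (hu : Hom1 u) : ∫ θ : Sp n, Lo h u θ * be h θ ∂(sg n) = 0 := by
  have := H.Lo_symm hn hom1_norm hu
  simpa [H.Lo_norm hn] using this
lemma F2 (hn : 3 ≤ n) (H : Good h) (hu : Hom1 u) :
    ∫ θ : Sp n, u θ * Lo h u θ * be h θ ∂(sg n) ≤ 0 := by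
  have hg := hom1_sq_div hu
  have t := TT_symm hn H.hom hom1_norm hg hom1_norm H.det_ne
  simp only [hs_norm] at t
  have c1 := hom1_norm.cont.fun_mul (H.CC_cont hg.hs_cont PP_cont)
  have c2 := hg.cont.fun_mul (H.CC_cont PP_cont PP_cont)
  have c3 := (hu.cont.fun_mul (Lo_cont hn H hu)).fun_mul H.be_cont
  have : ∫ θ : Sp n, 2 * (u θ * Lo h u θ * be h θ) ∂(sg n) ≤ ∫ θ : Sp n,
      (‖(θ : En n)‖ * CC (MM h θ) (hs (fun x => u x * u x * ‖x‖⁻¹) θ) (Pe θ) -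
       (u θ * u θ * ‖(θ : En n)‖⁻¹) * CC (MM h θ) (Pe θ) (Pe θ)) ∂(sg n) := by
    refine integral_mono (int_sg (continuous_const.mul c3)) (int_sg (c1.fun_sub c2)) fun θ => ?_
    simp only
    rw [hs_sq_div hu, CC_add (H.det_ne θ), CC_add (H.det_ne θ), CC_smul (H.det_ne θ),
      CC_smul (H.det_ne θ), CC_smul (H.det_ne θ), mul_assoc (u θ), H.Lo_be hn]
    have := CC_nonneg (H.pos θ) (X := NN (fun i => pd u i θ - u θ * (θ : En n) i)) (Y := Pe θ)
      (by unfold NN; exact Matrix.posSemidef_vecMulVec_self_star _) (PP_psd (dot_sphere θ))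
    simp only [norm_eq_of_mem_sphere, be]
    nlinarith
  rw [integral_sub (int_sg c1) (int_sg c2), integral_const_mul] at this
  simp only [Pe] at *
  linarith
lemma bochner (hn : 3 ≤ n) (H : Good h) (hu : Hom1 u) :
    ∫ θ : Sp n, (MM h θ).det * ((MM h θ)⁻¹ * Yo h u θ * ((MM h θ)⁻¹ * Yo h u θ)).trace ∂(sg n) ≤
    ∫ θ : Sp n, (Lo h u θ) ^ 2 * be h θ ∂(sg n) + ∫ θ : Sp n, u θ * Lo h u θ * be h θ ∂(sg n) := by
  have t := TT_symm hn H.hom hu hom1_norm hu H.det_ne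
  simp only [hs_norm, norm_eq_of_mem_sphere, one_mul] at t
  have c1 := H.CC_cont hu.hs_cont PP_cont
  have c2 := H.CC_cont hu.hs_cont hu.hs_cont
  have c0 := H.be_cont
  have cL := Lo_cont hn H hu
  have c4 := H.CC_cont PP_cont hu.hs_cont
  have c5 : Continuous fun θ => CC (MM h θ) (hs u θ) (Pe θ) ^ 2 / be h θ :=
    (c1.fun_pow 2).div c0 fun θ => (H.be_pos hn θ).ne'
  have : ∫ θ : Sp n, (Lo h u θ) ^ 2 * be h θ ∂(sg n) + ∫ θ : Sp n, u θ * Lo h u θ * be h θ ∂(sg n)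
      = ∫ θ : Sp n, (CC (MM h θ) (hs u θ) (Pe θ) ^ 2 / be h θ - CC (MM h θ) (hs u θ) (hs u θ)) ∂(sg n) := by
    rw [integral_sub (int_sg c5) (int_sg c2), ← t,
      ← integral_sub (int_sg c5) (int_sg (hu.cont.fun_mul c4)),
      ← integral_add (int_sg ((cL.fun_pow 2).fun_mul c0)) (int_sg ((hu.cont.fun_mul cL).fun_mul c0))]
    congr 1; ext θ
    have hb := (H.be_pos hn θ).ne'
    rw [CC_symm (H.det_ne θ) (PP _), Lo]; field_simp; ring
  rw [this]
  refine integral_mono_of_nonneg (Eventually.of_forall fun θ => ?_)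
    (int_sg (c5.sub c2)) (Eventually.of_forall fun θ => ?_)
  · refine mul_nonneg (H.pos θ).det_pos.le ?_
    by_cases h0 : Yo h u θ = 0
    · simp [h0]
    · refine (tr_GYGY_pos (H.pos θ).inv ?_ h0).le
      simp [Yo, hu.hs_symm (sp_ne θ), PP_symm]
  · have hd := (H.pos θ).det_pos
    have hc := cc_PP_pos hn (H.pos θ).inv (dot_sphere θ)
    have := mul_le_mul_of_nonneg_left (F3 hn (H.pos θ).inv (dot_sphere θ) (hs u θ) (Y := Yo h u θ) rfl) hd.le
    refine this.trans (le_of_eq ?_)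
    simp only [be, CC_eq (H.det_ne θ)]
    field_simp
end Good
end bochner

section pert
variable {n : ℕ}

/-- interpolation -/
def ht (h : En n → ℝ) (τ : ℝ) (x : En n) : ℝ := (1 - τ) * ‖x‖ + τ * h x

lemma ht_hom {h : En n → ℝ} (hh : Hom1 h) (τ : ℝ) : Hom1 (ht h τ) :=
  (hom1_norm.const_mul _).add (hh.const_mul _)

lemma ht_MM {h : En n → ℝ} (hh : Hom1 h) (τ : ℝ) (θ : Sp n) : MM (ht h τ) θ = (1 - τ) • 1 + τ • MM h θ := by
  have : hs (ht h τ) θ = (1 - τ) • Pe θ + τ • hs h θ := by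
    unfold ht
    rw [(hom1_norm.const_mul _).hs_add (hh.const_mul _) (sp_ne θ), Hom1.hs_const_mul,
      Hom1.hs_const_mul, hs_norm]
  rw [MM, this, MM]; simp only [Pe, PP]; module

lemma ht_good {h : En n → ℝ} (H : Good h) {τ : ℝ} (hτ : τ ∈ Set.Icc (0:ℝ) 1) : Good (ht h τ) := by
  refine ⟨ht_hom H.hom τ, fun θ => ?_⟩
  rw [ht_MM H.hom]
  rcases eq_or_lt_of_le hτ.1 with h0 | h0
  · subst h0; simpa using Matrix.PosDef.one
  · have h1 : (0:ℝ) ≤ 1 - τ := by linarith [hτ.2]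
    exact Matrix.PosDef.posSemidef_add (Matrix.PosSemidef.one.smul h1) ((H.pos θ).smul h0)

/-- quadratic form -/
def QQ (M Y : Matrix (Fin n) (Fin n) ℝ) : ℝ := (M.adjugate * Y * (M.adjugate * Y)).trace / M.det

lemma QQ_eq {M : Matrix (Fin n) (Fin n) ℝ} (hM : M.det ≠ 0) (Y) :
    QQ M Y = M.det * (M⁻¹ * Y * (M⁻¹ * Y)).trace := by
  rw [QQ, Matrix.inv_def, Ring.inverse_eq_inv']
  simp only [Matrix.smul_mul, Matrix.mul_smul, Matrix.trace_smul, smul_eq_mul]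
  field_simp

lemma CC_sub_smul {M : Matrix (Fin n) (Fin n) ℝ} (hM : M.det ≠ 0) (X P Y) (a : ℝ) :
    CC M (X - a • P) Y = CC M X Y - a * CC M P Y := by
  rw [sub_eq_add_neg, ← neg_smul, CC_add hM, CC_smul hM]; ring

lemma pert (hn : 3 ≤ n) {h : En n → ℝ} (H : Good h) {τ : ℝ} (hτ : τ ∈ Set.Icc (0:ℝ) 1) :
    ∀ᶠ p in 𝓝 ((τ, τ) : ℝ × ℝ), ∀ θ : Sp n, ∀ Y : Matrix (Fin n) (Fin n) ℝ, Y.transpose = Y →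
      (MM (ht h p.1) θ).det ≠ 0 → (MM (ht h p.2) θ).det ≠ 0 →
      16 * ((CC (MM (ht h p.1) θ) Y (Pe θ) / be (ht h p.1) θ
        - CC (MM (ht h p.2) θ) Y (Pe θ) / be (ht h p.2) θ) ^ 2 * be (ht h p.2) θ)
      ≤ QQ (MM (ht h p.2) θ) Y := by
  have hG := ht_good H hτ
  let K : Set (Sp n × (Fin n → Fin n → ℝ)) := Set.univ ×ˢ
    (Metric.sphere 0 1 ∩ {Y | (Matrix.of Y).transpose = Matrix.of Y})
  have hcl : IsClosed {Y : Fin n → Fin n → ℝ | (Matrix.of Y).transpose = Matrix.of Y} := by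
    have e : {Y : Fin n → Fin n → ℝ | (Matrix.of Y).transpose = Matrix.of Y} =
        ⋂ i, ⋂ j, {Y | Y j i = Y i j} := by
      ext Y; simp [← Matrix.ext_iff]
    rw [e]
    exact isClosed_iInter fun i => isClosed_iInter fun j => isClosed_eq (by fun_prop) (by fun_prop)
  have hK : IsCompact K := isCompact_univ.prod ((isCompact_sphere _ _).inter_right hcl)
  let Q := (ℝ × ℝ) × (Sp n × (Fin n → Fin n → ℝ))
  have cM : ∀ a : Q → ℝ, Continuous a → Continuous fun q : Q => MM (ht h (a q)) q.2.1 := by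
    intro a ha
    simp only [ht_MM H.hom]
    exact ((continuous_const.sub ha).smul continuous_const).add
      (ha.smul ((MM_cont H.hom).comp (continuous_fst.comp continuous_snd)))
  have cY : Continuous fun q : Q => (Matrix.of q.2.2 : Matrix (Fin n) (Fin n) ℝ) :=
    continuous_snd.comp continuous_snd
  have cP : Continuous fun q : Q => Pe q.2.1 := PP_cont.comp (continuous_fst.comp continuous_snd)
  have cM1 := cM (fun q => q.1.1) (by fun_prop)
  have cM2 := cM (fun q => q.1.2) (by fun_prop)
  have key := hK.eventually_forall_of_forall_eventually (x₀ := (τ, τ))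
    (P := fun (p : ℝ × ℝ) (z : Sp n × (Fin n → Fin n → ℝ)) =>
      16 * ((CC (MM (ht h p.1) z.1) (Matrix.of z.2) (Pe z.1) / be (ht h p.1) z.1
        - CC (MM (ht h p.2) z.1) (Matrix.of z.2) (Pe z.1) / be (ht h p.2) z.1) ^ 2 * be (ht h p.2) z.1)
      < QQ (MM (ht h p.2) z.1) (Matrix.of z.2)) ?_
  · filter_upwards [key] with p hp θ Y hY d1 d2
    by_cases h0 : Y = 0
    · subst h0
      have z : ∀ M : Matrix (Fin n) (Fin n) ℝ, M.det ≠ 0 → CC M 0 (Pe θ) = 0 := fun M hM => by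
        have := CC_smul hM 0 0 (Pe θ); simpa using this
      rw [z _ d1, z _ d2]; simp [QQ]
    · have hN : 0 < ‖(fun i j => Y i j : Fin n → Fin n → ℝ)‖ :=
        norm_pos_iff.2 fun h => h0 (by ext i j; exact congrFun (congrFun h i) j)
      set N := ‖(fun i j => Y i j : Fin n → Fin n → ℝ)‖
      have := hp (θ, N⁻¹ • (fun i j => Y i j : Fin n → Fin n → ℝ)) ⟨trivial, by
        simp [norm_smul, abs_of_pos hN, N, hN.ne'], by
        ext i j
        have := congrFun (congrFun hY i) j
        simp only [Matrix.transpose_apply] at this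
        simp [this]⟩
      have eY : (Matrix.of (N⁻¹ • (fun i j => Y i j : Fin n → Fin n → ℝ))) = N⁻¹ • Y := by
        ext i j; simp
      simp only [eY] at this
      rw [CC_smul d1, CC_smul d2] at this
      have eQ : QQ (MM (ht h p.2) θ) (N⁻¹ • Y) = N⁻¹ ^ 2 * QQ (MM (ht h p.2) θ) Y := by
        simp only [QQ, Matrix.smul_mul, Matrix.mul_smul, Matrix.trace_smul, smul_eq_mul]; ring
      rw [eQ] at this
      refine le_of_mul_le_mul_left (this.le.trans' (le_of_eq ?_)) (by positivity : 0 < N⁻¹ ^ 2)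
      ring
  · rintro ⟨θ, Y⟩ ⟨-, hY1, hY2⟩
    have hb := hG.be_pos hn θ
    have hd := hG.det_ne θ
    have c1 : ContinuousAt (fun q : Q => CC (MM (ht h q.1.1) q.2.1) (Matrix.of q.2.2) (Pe q.2.1) /
        be (ht h q.1.1) q.2.1) ((τ, τ), (θ, Y)) :=
      (continuous_CC cM1 cY cP).continuousAt.div (continuous_CC cM1 cP cP).continuousAt hb.ne'
    have c2 : ContinuousAt (fun q : Q => CC (MM (ht h q.1.2) q.2.1) (Matrix.of q.2.2) (Pe q.2.1) /
        be (ht h q.1.2) q.2.1) ((τ, τ), (θ, Y)) :=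
      (continuous_CC cM2 cY cP).continuousAt.div (continuous_CC cM2 cP cP).continuousAt hb.ne'
    have c3 : ContinuousAt (fun q : Q => be (ht h q.1.2) q.2.1) ((τ, τ), (θ, Y)) :=
      (continuous_CC cM2 cP cP).continuousAt
    have cA := cM2.matrix_adjugate.matrix_mul cY
    have c4 : ContinuousAt (fun q : Q => QQ (MM (ht h q.1.2) q.2.1) (Matrix.of q.2.2)) ((τ, τ), (θ, Y)) :=
      (cA.matrix_mul cA).matrix_trace.continuousAt.div cM2.matrix_det.continuousAt hd
    refine (continuousAt_const.mul (((c1.sub c2).pow 2).mul c3)).eventually_lt c4 ?_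
    simp only [Pi.sub_apply, Pi.mul_apply, Pi.pow_apply, sub_self]
    rw [QQ_eq hd]
    have := tr_GYGY_pos (hG.pos θ).inv (Y := Matrix.of Y) hY2 (fun h => by
      have : Y = 0 := by ext i j; exact congrFun (congrFun h i) j
      simp [this] at hY1)
    have := mul_pos (hG.pos θ).det_pos this
    simpa using this
end pert

section dens
variable {n : ℕ}

/-- density of the range -/
def Dens (h : En n → ℝ) : Prop := ∀ f : Sp n → ℝ, Continuous f → ∀ ε > 0, ∃ (u : En n → ℝ) (c : ℝ),
  Hom1 u ∧ ∫ θ : Sp n, (f θ - Lo h u θ - c) ^ 2 ∂(sg n) < ε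

variable {h h0 h1 u v : En n → ℝ}

lemma Lo_add (H : Good h) (hu : Hom1 u) (hv : Hom1 v) (θ) :
    Lo h (fun x => u x + v x) θ = Lo h u θ + Lo h v θ := by
  rw [Lo, hu.hs_add hv (sp_ne θ), CC_add (H.det_ne θ), Lo, Lo]; ring

lemma Lo_smul (H : Good h) (c : ℝ) (θ) : Lo h (fun x => c * u x) θ = c * Lo h u θ := by
  rw [Lo, Hom1.hs_const_mul, CC_smul (H.det_ne θ), Lo]; ring

lemma minv_cont (H : Good h) : Continuous fun θ : Sp n => (MM h θ)⁻¹ := by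
  simp only [Matrix.inv_def, Ring.inverse_eq_inv']
  exact ((MM_cont H.hom).matrix_det.inv₀ H.det_ne).smul (MM_cont H.hom).matrix_adjugate

lemma Yo_cont (hn : 3 ≤ n) (H : Good h) (hu : Hom1 u) : Continuous (Yo h u) := by
  refine hu.hs_cont.sub (Continuous.fun_smul (Continuous.div (f := fun θ => ((MM h θ)⁻¹ * hs u θ).trace)
    (g := fun θ => ((MM h θ)⁻¹ * Pe θ).trace) ?_ ?_ ?_) PP_cont)
  · exact ((minv_cont H).matrix_mul hu.hs_cont).matrix_trace
  · exact ((minv_cont H).matrix_mul PP_cont).matrix_trace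
  · exact fun θ => (tr_GP_pos hn (H.pos θ).inv (dot_sphere θ)).ne'

lemma pert_int (hn : 3 ≤ n) (H0 : Good h0) (H1 : Good h1) (hu : Hom1 u)
    (hb : ∀ θ : Sp n, ∀ Y : Matrix (Fin n) (Fin n) ℝ, Y.transpose = Y →
      16 * ((CC (MM h1 θ) Y (Pe θ) / be h1 θ - CC (MM h0 θ) Y (Pe θ) / be h0 θ) ^ 2 * be h0 θ)
      ≤ QQ (MM h0 θ) Y) :
    16 * ∫ θ : Sp n, (Lo h1 u θ - Lo h0 u θ) ^ 2 * be h0 θ ∂(sg n) ≤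
      ∫ θ : Sp n, (Lo h0 u θ) ^ 2 * be h0 θ ∂(sg n) := by
  have b := H0.bochner hn hu
  have f2 := H0.F2 hn hu
  have cY := (minv_cont H0).matrix_mul (Yo_cont hn H0 hu)
  have : ∫ θ : Sp n, 16 * ((Lo h1 u θ - Lo h0 u θ) ^ 2 * be h0 θ) ∂(sg n) ≤
      ∫ θ : Sp n, (MM h0 θ).det * ((MM h0 θ)⁻¹ * Yo h0 u θ * ((MM h0 θ)⁻¹ * Yo h0 u θ)).trace ∂(sg n) := by
    refine integral_mono (int_sg (continuous_const.mul
      (Continuous.mul (((H1.Lo_cont hn hu).sub (H0.Lo_cont hn hu)).pow 2) H0.be_cont))) (int_sg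
      (Continuous.mul (MM_cont H0.hom).matrix_det (cY.matrix_mul cY).matrix_trace)) fun θ => ?_
    simp only
    have := hb θ (Yo h0 u θ) (by simp [Yo, hu.hs_symm (sp_ne θ), PP_symm])
    rw [QQ_eq (H0.det_ne θ)] at this
    refine this.trans' (le_of_eq ?_)
    rw [Yo, CC_sub_smul (H1.det_ne θ), CC_sub_smul (H0.det_ne θ)]
    have e1 := (H1.be_pos hn θ).ne'
    have e0 := (H0.be_pos hn θ).ne'
    have k1 : CC (MM h1 θ) (Pe θ) (Pe θ) = be h1 θ := rfl
    have k0 : CC (MM h0 θ) (Pe θ) (Pe θ) = be h0 θ := rfl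
    simp only [sub_div, k1, k0, mul_div_assoc, div_self e1, div_self e0, Lo]
    ring
  rw [integral_const_mul] at this
  linarith

lemma mean_ineq (hn : 3 ≤ n) (H : Good h) (hu : Hom1 u) (c : ℝ) :
    ∫ θ : Sp n, (Lo h u θ) ^ 2 * be h θ ∂(sg n) ≤ ∫ θ : Sp n, (Lo h u θ + c) ^ 2 * be h θ ∂(sg n) := by
  have cL := H.Lo_cont hn hu
  have cb := H.be_cont
  have m := H.Lo_mean hn hu
  have : ∫ θ : Sp n, (Lo h u θ + c) ^ 2 * be h θ ∂(sg n) = ∫ θ : Sp n, (Lo h u θ) ^ 2 * be h θ ∂(sg n)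
     + ∫ θ : Sp n, 2 * c * (Lo h u θ * be h θ) ∂(sg n) + ∫ θ : Sp n, c ^ 2 * be h θ ∂(sg n) := by
    rw [← integral_add (int_sg (by fun_prop)) (int_sg (by fun_prop)),
      ← integral_add (int_sg (by fun_prop)) (int_sg (by fun_prop))]
    congr 1; ext θ; ring
  rw [this, integral_const_mul, m]
  have : 0 ≤ ∫ θ : Sp n, c ^ 2 * be h θ ∂(sg n) := integral_nonneg fun θ =>
    mul_nonneg (sq_nonneg _) (H.be_pos hn θ).le
  linarith

lemma N_sub {a b w : Sp n → ℝ} (ha : Continuous a) (hb : Continuous b) (hw : Continuous w) (hw0 : ∀ θ, 0 ≤ w θ) :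
    ∫ θ, (a θ - b θ) ^ 2 * w θ ∂(sg n) ≤ 2 * ∫ θ, (a θ) ^ 2 * w θ ∂(sg n) + 2 * ∫ θ, (b θ) ^ 2 * w θ ∂(sg n) := by
  rw [← integral_const_mul, ← integral_const_mul, ← integral_add (int_sg (by fun_prop)) (int_sg (by fun_prop))]
  refine integral_mono (int_sg (by fun_prop)) (int_sg (by fun_prop)) fun θ => ?_
  simp only
  nlinarith [mul_nonneg (sq_nonneg (a θ + b θ)) (hw0 θ)]

lemma w_upper (hn : 3 ≤ n) {w : Sp n → ℝ} (hw : Continuous w) : ∃ B : ℝ, 0 < B ∧ ∀ θ, w θ ≤ B := by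
  obtain ⟨C, hC⟩ := isCompact_univ.exists_bound_of_continuousOn (s := (Set.univ : Set (Sp n))) hw.continuousOn
  refine ⟨|C| + 1, by positivity, fun θ => ?_⟩
  have := hC θ trivial
  have := le_abs_self (w θ)
  have := le_abs_self C
  rw [Real.norm_eq_abs] at *
  linarith

lemma w_lower (hn : 3 ≤ n) {w : Sp n → ℝ} (hw : Continuous w) (h0 : ∀ θ, 0 < w θ) :
    ∃ b : ℝ, 0 < b ∧ ∀ θ, b ≤ w θ := by
  obtain ⟨B, hB, h⟩ := w_upper hn (hw.inv₀ fun θ => (h0 θ).ne')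
  exact ⟨B⁻¹, by positivity, fun θ => by
    have := h θ
    rw [inv_le_comm₀ hB (h0 θ)]; exact this⟩

lemma dens_transfer (hn : 3 ≤ n) (H0 : Good h0) (H1 : Good h1)
    (hb : ∀ θ : Sp n, ∀ Y : Matrix (Fin n) (Fin n) ℝ, Y.transpose = Y →
      16 * ((CC (MM h1 θ) Y (Pe θ) / be h1 θ - CC (MM h0 θ) Y (Pe θ) / be h0 θ) ^ 2 * be h0 θ)
      ≤ QQ (MM h0 θ) Y) (hD : Dens h0) : Dens h1 := by
  intro f hf ε hε
  have cb := H0.be_cont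
  have b0 : ∀ θ, 0 ≤ be h0 θ := fun θ => (H0.be_pos hn θ).le
  obtain ⟨B, hB, hBu⟩ := w_upper hn cb
  obtain ⟨b, hb0, hbl⟩ := w_lower hn cb (H0.be_pos hn)
  let A : Set ℝ := {a | ∃ (u : En n → ℝ) (c : ℝ), Hom1 u ∧
    a = ∫ θ : Sp n, (f θ - Lo h1 u θ - c) ^ 2 * be h0 θ ∂(sg n)}
  have hA : A.Nonempty := ⟨_, _, 0, hom1_norm, rfl⟩
  have hA0 : BddBelow A := ⟨0, by
    rintro _ ⟨u, c, _, rfl⟩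
    exact integral_nonneg fun θ => mul_nonneg (sq_nonneg _) (b0 θ)⟩
  have key : ∀ η > 0, sInf A ≤ (sInf A + η) / 4 + 3 * η := by
    intro η hη
    obtain ⟨_, ⟨u0, c0, hu0, rfl⟩, hr⟩ := exists_lt_of_csInf_lt hA (lt_add_of_pos_right (sInf A) hη)
    have cL0 := H1.Lo_cont hn hu0
    set r : Sp n → ℝ := fun θ => f θ - Lo h1 u0 θ - c0 with hrd
    have cr : Continuous r := by fun_prop
    obtain ⟨u1, c1, hu1, hlt⟩ := hD r cr (η / B) (by positivity)
    have cL1 := H1.Lo_cont hn hu1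
    have cL2 := H0.Lo_cont hn hu1
    have s1 : ∫ θ : Sp n, (r θ - Lo h0 u1 θ - c1) ^ 2 * be h0 θ ∂(sg n) ≤ η := by
      calc _ ≤ ∫ θ : Sp n, (r θ - Lo h0 u1 θ - c1) ^ 2 * B ∂(sg n) := by
            refine integral_mono (int_sg (by fun_prop)) (int_sg (by fun_prop)) fun θ => ?_
            exact mul_le_mul_of_nonneg_left (hBu θ) (sq_nonneg _)
        _ = (∫ θ : Sp n, (r θ - Lo h0 u1 θ - c1) ^ 2 ∂(sg n)) * B := integral_mul_const _ _
        _ ≤ η / B * B := mul_le_mul_of_nonneg_right hlt.le hB.le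
        _ = η := by field_simp
    have s2 := pert_int hn H0 H1 hu1 hb
    have s3 := mean_ineq hn H0 hu1 c1
    have s4 := N_sub (a := r) (b := fun θ => r θ - Lo h0 u1 θ - c1) cr
      ((cr.sub cL2).sub continuous_const) cb b0
    have s5 := N_sub (a := fun θ => r θ - Lo h0 u1 θ - c1) (b := fun θ => Lo h1 u1 θ - Lo h0 u1 θ)
      ((cr.sub cL2).sub continuous_const) (cL1.sub cL2) cb b0
    have s6 : sInf A ≤ ∫ θ, ((r θ - Lo h0 u1 θ - c1) - (Lo h1 u1 θ - Lo h0 u1 θ)) ^ 2 * be h0 θ ∂(sg n) := by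
      have hm : ∫ θ, (f θ - Lo h1 (fun x => u0 x + u1 x) θ - (c0 + c1)) ^ 2 * be h0 θ ∂(sg n) ∈ A :=
        ⟨_, _, hu0.add hu1, rfl⟩
      refine (csInf_le hA0 hm).trans (le_of_eq (integral_congr_ae (Eventually.of_forall fun θ => ?_)))
      simp only [Lo_add H1 hu0 hu1, hrd]; ring
    have e : ∀ θ, r θ - (r θ - Lo h0 u1 θ - c1) = Lo h0 u1 θ + c1 := fun θ => by ring
    simp only [e] at s4
    linarith
  have hI : sInf A ≤ 0 := by
    by_contra hcon
    have := key (sInf A / 13) (by linarith)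
    linarith
  obtain ⟨_, ⟨u, c, hu, rfl⟩, hr⟩ := exists_lt_of_csInf_lt hA (hI.trans_lt (mul_pos hε hb0))
  refine ⟨u, c, hu, ?_⟩
  have cL := H1.Lo_cont hn hu
  refine lt_of_mul_lt_mul_right (lt_of_le_of_lt ?_ hr) hb0.le
  rw [← integral_mul_const]
  refine integral_mono (int_sg (by fun_prop)) (int_sg (by fun_prop)) fun θ => ?_
  exact mul_le_mul_of_nonneg_left (hbl θ) (sq_nonneg _)

lemma dens_all (hn : 3 ≤ n) (H : Good h) (h0 : Dens (ht h 0)) : Dens (ht h 1) := by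
  have := isPreconnected_Icc (a := (0:ℝ)) (b := 1)
  refine this.induction₂' (fun a b => Dens (ht h a) → Dens (ht h b)) ?_ ?_
    (x := 0) (y := 1) (by simp) (by simp) h0
  · intro τ hτ
    have hp := pert hn H hτ
    rw [nhds_prod_eq] at hp
    have hq : ∀ᶠ a in 𝓝 τ, ∀ s t : ℝ, (s = a ∧ t = τ) ∨ (s = τ ∧ t = a) → ∀ θ : Sp n, ∀ Y : Matrix (Fin n) (Fin n) ℝ, Y.transpose = Y →
      (MM (ht h s) θ).det ≠ 0 → (MM (ht h t) θ).det ≠ 0 →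
      16 * ((CC (MM (ht h s) θ) Y (Pe θ) / be (ht h s) θ
        - CC (MM (ht h t) θ) Y (Pe θ) / be (ht h t) θ) ^ 2 * be (ht h t) θ)
      ≤ QQ (MM (ht h t) θ) Y := by
      have i1 : Tendsto (fun a : ℝ => (a, τ)) (𝓝 τ) (𝓝 τ ×ˢ 𝓝 τ) := by
        rw [← nhds_prod_eq]; exact (Continuous.prodMk_left τ).tendsto τ
      have i2 : Tendsto (fun a : ℝ => (τ, a)) (𝓝 τ) (𝓝 τ ×ˢ 𝓝 τ) := by
        rw [← nhds_prod_eq]; exact (Continuous.prodMk_right τ).tendsto τ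
      filter_upwards [i1.eventually hp, i2.eventually hp] with a h1 h2 s t hst
      rcases hst with ⟨rfl, rfl⟩ | ⟨rfl, rfl⟩
      · exact h1
      · exact h2
    filter_upwards [nhdsWithin_le_nhds hq, self_mem_nhdsWithin] with a ha haI
    have G1 := ht_good H hτ
    have G2 := ht_good H haI
    exact ⟨dens_transfer hn G1 G2 (fun θ Y hY => ha _ _ (Or.inl ⟨rfl, rfl⟩) θ Y hY (G2.det_ne θ) (G1.det_ne θ)),
      dens_transfer hn G2 G1 (fun θ Y hY => ha _ _ (Or.inr ⟨rfl, rfl⟩) θ Y hY (G1.det_ne θ) (G2.det_ne θ))⟩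
  · intro a b c _ _ _ hab hbc; exact fun x => hbc (hab x)
end dens

section dens0
variable {n : ℕ}

lemma pd_comp {F : ℝ → ℝ} {F' : ℝ} {g : En n → ℝ} {x : En n} (hg : DifferentiableAt ℝ g x)
    (hF : HasDerivAt F F' (g x)) (i : Fin n) : pd (fun y => F (g y)) i x = F' * pd g i x := by
  have := hF.comp_hasFDerivAt x hg.hasFDerivAt
  unfold pd
  have e : (fun y => F (g y)) = F ∘ g := rfl
  rw [e, this.fderiv]; simp

lemma pd2_comp {F F' : ℝ → ℝ} {F'' : ℝ} {g : En n → ℝ} {x : En n} (hg : ContDiffAt ℝ 2 g x)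
    (hF : ∀ᶠ t in 𝓝 (g x), HasDerivAt F (F' t) t) (hF' : HasDerivAt F' F'' (g x)) (i j : Fin n) :
    pd (pd (fun y => F (g y)) i) j x = F'' * pd g j x * pd g i x + F' (g x) * pd (pd g i) j x := by
  have e : pd (fun y => F (g y)) i =ᶠ[𝓝 x] fun y => F' (g y) * pd g i y := by
    filter_upwards [hg.eventually (by simp), hg.continuousAt.eventually hF] with y h1 h2
    exact pd_comp (h1.differentiableAt (by norm_num)) h2 i
  have d1 := hg.differentiableAt (by norm_num)
  have p1 := (pd_contDiffAt (m := 1) hg (by norm_num) i).differentiableAt (by norm_num)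
  rw [pd_congr e, pd_mul (f := fun y => F' (g y)) (hF'.differentiableAt.comp x d1) p1, pd_comp d1 hF']
  ring

/-- linear form -/
def lin (e x : En n) : ℝ := ∑ i, e i * x i

lemma lin_contDiff (e : En n) : ContDiff ℝ 3 (lin e) := by
  unfold lin
  exact ContDiff.sum fun i _ => contDiff_const.mul (EuclideanSpace.proj i : En n →L[ℝ] ℝ).contDiff

lemma pd_lin (e x : En n) (i : Fin n) : pd (lin e) i x = e i := by
  unfold lin
  rw [pd_sum _ (fun j _ => (diff_coord x j).const_mul _)]
  simp [pd_const_mul, pd_coord]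

lemma pd2_lin (e x : En n) (i j : Fin n) : pd (pd (lin e) i) j x = 0 := by
  have : pd (lin e) i = fun _ => e i := by ext y; exact pd_lin e y i
  rw [this]; simp [pd]

/-- test functions -/
def uk (e : En n) (j : ℕ) (x : En n) : ℝ := lin e x ^ (j + 1) * ‖x‖ ^ (-(j:ℤ))

lemma uk_hom (e : En n) (j : ℕ) : Hom1 (uk e j) where
  smooth x hx := by
    unfold uk
    refine ((lin_contDiff e).contDiffAt.pow _).mul ?_
    simp only [zpow_neg, zpow_natCast]
    exact ((contDiffAt_norm ℝ hx).pow _).inv (pow_ne_zero _ (norm_ne_zero_iff.2 hx))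
  hom t ht x := by
    have : lin e (t • x) = t * lin e x := by
      simp only [lin, Finset.mul_sum]; exact Finset.sum_congr rfl fun i _ => by simp; ring
    simp only [uk, this, norm_smul, Real.norm_of_nonneg ht.le, mul_zpow, mul_pow, zpow_neg,
      zpow_natCast, pow_succ]
    field_simp

lemma tr_hs_uk (e : En n) (j : ℕ) (θ : Sp n) : (hs (uk e j) θ).trace =
    (-(j:ℝ)) * (n + j) * lin e θ ^ (j + 1) + (j + 1) * j * (∑ i, e i ^ 2) * lin e θ ^ (j - 1) := by
  have hθ := sp_ne θ
  have h1 : ‖(θ : En n)‖ = 1 := by simp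
  have c1 : ContDiffAt ℝ 2 (fun x => lin e x ^ (j + 1)) (θ : En n) :=
    ((lin_contDiff e).contDiffAt.pow _).of_le (by norm_num)
  have c2 : ContDiffAt ℝ 2 (fun x : En n => ‖x‖ ^ (-(j:ℤ))) (θ : En n) := by
    simp only [zpow_neg, zpow_natCast]
    exact ((contDiffAt_norm ℝ hθ).pow _).inv (pow_ne_zero _ (norm_ne_zero_iff.2 hθ))
  have cl : ContDiffAt ℝ 2 (lin e) (θ : En n) := (lin_contDiff e).contDiffAt.of_le (by norm_num)
  have cn : ContDiffAt ℝ 2 (fun x : En n => ‖x‖) (θ : En n) := contDiffAt_norm ℝ hθ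
  have dp : ∀ t : ℝ, HasDerivAt (fun t : ℝ => t ^ (j + 1)) ((j + 1) * t ^ j) t := fun t => by
    simpa using hasDerivAt_pow (j + 1) t
  have dp' : ∀ t : ℝ, HasDerivAt (fun t : ℝ => (j + 1) * t ^ j) ((j + 1) * (j * t ^ (j - 1))) t :=
    fun t => (hasDerivAt_pow j t).const_mul _
  have dz : ∀ k : ℤ, ∀ t : ℝ, t ≠ 0 → HasDerivAt (fun t : ℝ => t ^ k) (k * t ^ (k - 1)) t :=
    fun k t ht => hasDerivAt_zpow k t (Or.inl ht)
  have hev : ∀ᶠ t in 𝓝 ‖(θ : En n)‖, HasDerivAt (fun t : ℝ => t ^ (-(j:ℤ)))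
      (((-(j:ℤ) : ℤ) : ℝ) * t ^ (-(j:ℤ) - 1)) t := by
    filter_upwards [isOpen_ne.mem_nhds (norm_ne_zero_iff.2 hθ)] with t ht using dz _ t ht
  have dz' := (dz (-(j:ℤ) - 1) ‖(θ : En n)‖ (norm_ne_zero_iff.2 hθ)).const_mul (((-(j:ℤ) : ℤ) : ℝ))
  have main : ∀ i, hs (uk e j) θ i i = lin e θ ^ (j + 1) * ((j:ℝ) * (j + 1) * (θ : En n) i ^ 2
      - j * Pe θ i i) + (j + 1) * j * lin e θ ^ (j - 1) * e i ^ 2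
      - 2 * j * (j + 1) * lin e θ ^ j * (e i * (θ : En n) i) := by
    intro i
    rw [hs_apply]; unfold uk
    rw [pd2_mul c1 c2, pd2_comp cl (Eventually.of_forall dp) (dp' _), pd2_comp cn hev dz',
      pd_comp (cl.differentiableAt (by norm_num)) (dp _), pd_comp (cn.differentiableAt (by norm_num))
      (dz _ _ (norm_ne_zero_iff.2 hθ)), pd2_lin, pd_lin, ← hs_apply (fun x : En n => ‖x‖), hs_norm, pd_norm hθ, h1]
    simp
    ring
  simp only [Matrix.trace, Matrix.diag, main, Finset.sum_add_distrib, Finset.sum_sub_distrib,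
    ← Finset.mul_sum]
  have e1 : ∑ i, (θ : En n) i ^ 2 = 1 := by
    have := norm_sq_sum (θ : En n); simpa [sq, h1] using this
  have e2 : ∑ i, Pe θ i i = n - 1 := by
    simp only [Pe, PP, NN, Matrix.sub_apply, Matrix.one_apply_eq, Matrix.vecMulVec_apply,
      Finset.sum_sub_distrib, ← sq, e1]; simp
  have e3 : ∑ i, e i * (θ : En n) i = lin e θ := rfl
  rw [e1, e2, e3]; ring

lemma Lo_one (hn : 3 ≤ n) {h u : En n → ℝ} (hu : Hom1 u) {θ : Sp n} (hM : MM h θ = 1) :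
    Lo h u θ = (hs u θ).trace / (n - 1) - u θ := by
  have hv := dot_sphere θ
  have hPX : hs u θ * Pe θ = hs u θ := by
    rw [Pe, PP, mul_sub, mul_one, NN, Matrix.mul_vecMulVec, hu.hs_mulVec (sp_ne θ)]; simp
  have h1 : (1 : Matrix (Fin n) (Fin n) ℝ).det ≠ 0 := by simp
  have hn' : (3:ℝ) ≤ n := by exact_mod_cast hn
  rw [Lo, be, hM, CC_eq h1, CC_eq h1]
  simp only [cc, inv_one, one_mul, Matrix.det_one]
  rw [hPX, PP_sq hv, PP_tr hv]
  have : (n:ℝ) - 1 ≠ 0 := by linarith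
  have : (n:ℝ) - 1 - 1 ≠ 0 := by linarith
  congr 1
  rw [show (hs u θ).trace * ((n:ℝ) - 1) - (hs u θ).trace = (hs u θ).trace * ((n:ℝ) - 1 - 1) by ring,
    show ((n:ℝ) - 1) * ((n:ℝ) - 1) - (n - 1) = (n - 1) * ((n:ℝ) - 1 - 1) by ring]
  field_simp

/-- range plus constants -/
def Rg (h : En n → ℝ) (H : Good h) : Submodule ℝ C(Sp n, ℝ) where
  carrier := {f | ∃ (u : En n → ℝ) (c : ℝ), Hom1 u ∧ ∀ θ, f θ = Lo h u θ + c}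
  zero_mem' := ⟨fun x => 0 * ‖x‖, 0, hom1_norm.const_mul 0, fun θ => by rw [Lo_smul H]; simp⟩
  add_mem' := by
    rintro f g ⟨u, c, hu, h1⟩ ⟨v, d, hv, h2⟩
    exact ⟨_, c + d, hu.add hv, fun θ => by rw [Lo_add H hu hv]; simp [h1, h2]; ring⟩
  smul_mem' := by
    rintro a f ⟨u, c, hu, h1⟩
    exact ⟨_, a * c, hu.const_mul a, fun θ => by rw [Lo_smul H]; simp [h1]; ring⟩

/-- restriction of a linear form to the sphere -/
def lc (e : En n) : C(Sp n, ℝ) := ⟨fun θ => lin e θ, (lin_contDiff e).continuous.comp continuous_subtype_val⟩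

variable {h : En n → ℝ}

lemma lc_pow_mem (hn : 3 ≤ n) (H : Good h) (hM : ∀ θ, MM h θ = 1) (e : En n) (k : ℕ) : lc e ^ k ∈ Rg h H := by
  induction k using Nat.strong_induction_on with
  | _ k ih =>
    rcases k with _ | j
    · exact ⟨fun x => 0 * ‖x‖, 1, hom1_norm.const_mul 0, fun θ => by rw [Lo_smul H]; simp⟩
    · have hn' : (3:ℝ) ≤ n := by exact_mod_cast hn
      have hm : (n:ℝ) - 1 ≠ 0 := by linarith
      have hm2 : (n:ℝ) - 1 + j ≠ 0 := by have := Nat.cast_nonneg (α := ℝ) j; linarith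
      have h1 : (⟨Lo h (uk e j), H.Lo_cont hn (uk_hom e j)⟩ : C(Sp n, ℝ)) ∈ Rg h H :=
        ⟨_, 0, uk_hom e j, fun θ => by simp⟩
      have h2 := (Rg h H).smul_mem ((j + 1) * j * (∑ i, e i ^ 2) / (n - 1)) (ih (j - 1) (by omega))
      have := (Rg h H).smul_mem (-((n - 1) / ((j + 1) * (n - 1 + j)))) ((Rg h H).sub_mem h1 h2)
      convert this using 1
      ext θ
      simp only [ContinuousMap.smul_apply, ContinuousMap.sub_apply, ContinuousMap.pow_apply,
        ContinuousMap.coe_mk, smul_eq_mul, Lo_one hn (uk_hom e j) (hM θ), tr_hs_uk]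
      simp only [lc, ContinuousMap.coe_mk, uk, norm_eq_of_mem_sphere, one_zpow, mul_one]
      field_simp
      ring

lemma exp_mem (hn : 3 ≤ n) (H : Good h) (hM : ∀ θ, MM h θ = 1) (e : En n) :
    NormedSpace.exp (lc e) ∈ (Rg h H).topologicalClosure := by
  have hs := NormedSpace.exp_series_hasSum_exp' (𝕂 := ℝ) (lc e)
  refine (Rg h H).isClosed_topologicalClosure.mem_of_tendsto hs (Eventually.of_forall fun s => ?_)
  exact Submodule.sum_mem _ fun k _ => Submodule.smul_mem _ _
    ((Rg h H).le_topologicalClosure (lc_pow_mem hn H hM e k))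

lemma Rg_dense (hn : 3 ≤ n) (H : Good h) (hM : ∀ θ, MM h θ = 1) : (Rg h H).topologicalClosure = ⊤ := by
  let S : Submonoid C(Sp n, ℝ) :=
    { carrier := Set.range fun e : En n => NormedSpace.exp (lc e)
      one_mem' := ⟨0, by
        have : lc (0 : En n) = 0 := by ext θ; simp [lc, lin]
        simp [this]⟩
      mul_mem' := by
        rintro _ _ ⟨a, rfl⟩ ⟨b, rfl⟩
        refine ⟨a + b, ?_⟩
        have : lc (a + b) = lc a + lc b := by
          ext θ; simp [lc, lin, add_mul, Finset.sum_add_distrib]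
        simp only [this]
        exact NormedSpace.exp_add_of_commute (Commute.all _ _) }
  have hsw := ContinuousMap.subalgebra_topologicalClosure_eq_top_of_separatesPoints
    (Algebra.adjoin ℝ (S : Set C(Sp n, ℝ))) ?_
  · have h1 : Subalgebra.toSubmodule (Algebra.adjoin ℝ (S : Set C(Sp n, ℝ))) ≤ (Rg h H).topologicalClosure := by
      rw [Algebra.adjoin_eq_span, Submonoid.closure_eq, Submodule.span_le]
      rintro _ ⟨e, rfl⟩
      exact exp_mem hn H hM e
    rw [eq_top_iff]
    intro f _
    have hf : f ∈ (Algebra.adjoin ℝ (S : Set C(Sp n, ℝ))).topologicalClosure := by rw [hsw]; trivial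
    have : f ∈ closure ((Rg h H).topologicalClosure : Set C(Sp n, ℝ)) := closure_mono h1 hf
    rwa [(Rg h H).isClosed_topologicalClosure.closure_eq] at this
  · intro θ θ' hne
    have : ∃ i, (θ : En n) i ≠ (θ' : En n) i := by
      by_contra hc; push Not at hc
      exact hne (Subtype.ext (by ext i; exact hc i))
    obtain ⟨i, hi⟩ := this
    refine ⟨_, ⟨NormedSpace.exp (lc (eb i)), Algebra.subset_adjoin ⟨eb i, rfl⟩, rfl⟩, ?_⟩
    have ev : ∀ θ : Sp n, NormedSpace.exp (lc (eb i)) θ = Real.exp ((θ : En n) i) := by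
      intro θ
      have := NormedSpace.map_exp (ContinuousMap.evalAlgHom ℝ ℝ θ : C(Sp n, ℝ) →ₐ[ℝ] ℝ) (continuous_eval_const θ) (lc (eb i))
      simp only [ContinuousMap.evalAlgHom_apply] at this
      rw [this, Real.exp_eq_exp_ℝ]; simp [lc, lin, eb]
    simp only [ev]
    exact fun h => hi (Real.exp_injective h)

lemma dens_zero (hn : 3 ≤ n) (H : Good h) (hM : ∀ θ, MM h θ = 1) : Dens h := by
  intro f hf ε hε
  set s := (sg n).real Set.univ
  have hs : 0 ≤ s := measureReal_nonneg
  have hm : (⟨f, hf⟩ : C(Sp n, ℝ)) ∈ closure (Rg h H : Set C(Sp n, ℝ)) := by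
    have : (⟨f, hf⟩ : C(Sp n, ℝ)) ∈ (Rg h H).topologicalClosure := by rw [Rg_dense hn H hM]; trivial
    exact this
  obtain ⟨g, ⟨u, c, hu, hg⟩, hd⟩ := Metric.mem_closure_iff.1 hm (√(ε / (s + 1))) (by positivity)
  refine ⟨u, c, hu, ?_⟩
  have cL := H.Lo_cont hn hu
  calc _ ≤ ∫ θ : Sp n, ε / (s + 1) ∂(sg n) := by
        refine integral_mono (int_sg (by fun_prop)) (int_sg (by fun_prop)) fun θ => ?_
        have h1 := ((ContinuousMap.dist_apply_le_dist (f := ⟨f, hf⟩) (g := g) θ).trans hd.le)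
        rw [Real.dist_eq, hg] at h1
        have h2 := pow_le_pow_left₀ (abs_nonneg _) h1 2
        rw [Real.sq_sqrt (by positivity), sq_abs] at h2
        simpa [sub_sub] using h2
    _ = ε * (s / (s + 1)) := by rw [integral_const, smul_eq_mul]; ring
    _ < ε := by
        refine mul_lt_of_lt_one_right hε ?_
        rw [div_lt_one (by positivity)]; linarith

theorem dens_good (hn : 3 ≤ n) (H : Good h) : Dens h := by
  have : ht h 1 = h := by ext x; simp [ht]
  rw [← this]
  refine dens_all hn H (dens_zero hn (ht_good H (by simp)) fun θ => ?_)
  rw [ht_MM H.hom]; simp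
end dens0

section poinc
variable {n : ℕ} {h f : En n → ℝ}

lemma poincare (hn : 3 ≤ n) (H : Good h) (hf : Hom1 f) (h0 : ∫ θ : Sp n, f θ * be h θ ∂(sg n) = 0) :
    ∫ θ : Sp n, (f θ) ^ 2 * be h θ ∂(sg n) ≤ - ∫ θ : Sp n, f θ * Lo h f θ * be h θ ∂(sg n) := by
  obtain ⟨B, hB, hBb⟩ := w_upper hn H.be_cont
  have cb := H.be_cont
  have cf := hf.cont
  refine le_of_forall_pos_le_add fun ε hε => ?_
  obtain ⟨u, c, hu, hd⟩ := dens_good hn H (fun θ => f θ) cf (ε / B) (by positivity)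
  have cL := H.Lo_cont hn hu
  have cLf := H.Lo_cont hn hf
  have cu := hu.cont
  have e1 : ∫ θ : Sp n, (f θ - Lo h u θ - c) ^ 2 * be h θ ∂(sg n) ≤ ε := by
    calc _ ≤ ∫ θ : Sp n, (f θ - Lo h u θ - c) ^ 2 * B ∂(sg n) :=
          integral_mono (int_sg ((((cf.sub cL).sub continuous_const).pow 2).mul cb))
            (int_sg ((((cf.sub cL).sub continuous_const).pow 2).mul continuous_const))
            fun θ => mul_le_mul_of_nonneg_left (hBb θ) (sq_nonneg _)
      _ ≤ ε := by
          rw [integral_mul_const]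
          exact (le_div_iff₀ hB).1 hd.le
  have i1 := int_sg ((cf.fun_pow 2).fun_mul cb)
  have i2 := int_sg ((cf.fun_mul cL).fun_mul cb)
  have i3 := int_sg (cf.fun_mul cb)
  have i4 := int_sg (((cL.fun_add (continuous_const (y := c))).fun_pow 2).fun_mul cb)
  have i5 := int_sg ((cf.fun_mul cLf).fun_mul cb)
  have i6 := int_sg ((cu.fun_mul cL).fun_mul cb)
  have i7 := int_sg ((cu.fun_mul cLf).fun_mul cb)
  have e2 : ∫ θ : Sp n, (f θ - Lo h u θ - c) ^ 2 * be h θ ∂(sg n) =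
      ∫ θ : Sp n, (f θ) ^ 2 * be h θ ∂(sg n) - 2 * ∫ θ : Sp n, f θ * Lo h u θ * be h θ ∂(sg n)
      - 2 * c * ∫ θ : Sp n, f θ * be h θ ∂(sg n) + ∫ θ : Sp n, (Lo h u θ + c) ^ 2 * be h θ ∂(sg n) := by
    rw [← integral_const_mul, ← integral_const_mul, ← integral_sub i1 (i2.const_mul _),
      ← integral_sub (i1.sub' (i2.const_mul _)) (i3.const_mul _),
      ← integral_add ((i1.sub' (i2.const_mul _)).sub' (i3.const_mul _)) i4]
    congr 1; ext θ; ring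
  have e3 := H.F2 hn (hf.add hu)
  have e4 : ∫ θ : Sp n, (f θ + u θ) * Lo h (fun x => f x + u x) θ * be h θ ∂(sg n) =
      ∫ θ : Sp n, f θ * Lo h f θ * be h θ ∂(sg n) + ∫ θ : Sp n, f θ * Lo h u θ * be h θ ∂(sg n)
      + ∫ θ : Sp n, u θ * Lo h f θ * be h θ ∂(sg n) + ∫ θ : Sp n, u θ * Lo h u θ * be h θ ∂(sg n) := by
    rw [← integral_add i5 i2, ← integral_add (i5.fun_add i2) i7, ← integral_add ((i5.fun_add i2).fun_add i7) i6]
    congr 1; ext θ; rw [Lo_add H hf hu]; ring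
  rw [e4, H.Lo_symm hn hu hf] at e3
  have e5 := mean_ineq hn H hu c
  have e6 := H.bochner hn hu
  have e7 : 0 ≤ ∫ θ : Sp n, (MM h θ).det * ((MM h θ)⁻¹ * Yo h u θ * ((MM h θ)⁻¹ * Yo h u θ)).trace ∂(sg n) := by
    refine integral_nonneg fun θ => mul_nonneg (H.pos θ).det_pos.le ?_
    by_cases hy : Yo h u θ = 0
    · simp [hy]
    · refine (tr_GYGY_pos (H.pos θ).inv ?_ hy).le
      simp [Yo, hu.hs_symm (sp_ne θ), PP_symm]
  rw [h0] at e2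
  linarith

/-- zeroth, first, second quantities -/
def Q0 (h : En n → ℝ) : ℝ := ∫ θ : Sp n, (MM h θ).det ∂(sg n)
def Q1 (h : En n → ℝ) : ℝ := ∫ θ : Sp n, ((MM h θ).adjugate * Pe θ).trace ∂(sg n)
def Q2 (h : En n → ℝ) : ℝ := ∫ θ : Sp n, be h θ ∂(sg n)

lemma hs_NN (hh : Hom1 h) (θ : Sp n) : hs h θ * NN (θ : En n).ofLp = 0 := by
  have := hh.hs_mulVec (sp_ne θ)
  rw [NN, Matrix.mul_vecMulVec, this]; ext i j; simp [Matrix.vecMulVec_apply]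

lemma inv_NN (H : Good h) (θ : Sp n) : (MM h θ)⁻¹ * NN (θ : En n).ofLp = NN (θ : En n).ofLp := by
  have h1 : MM h θ * NN (θ : En n).ofLp = NN (θ : En n).ofLp := by
    rw [MM, Matrix.add_mul, hs_NN H.hom, zero_add, NN_sq (dot_sphere θ)]
  conv_lhs => rw [← h1]
  rw [← Matrix.mul_assoc, Matrix.nonsing_inv_mul _ (Ne.isUnit (H.det_ne θ)), Matrix.one_mul]

lemma inv_hs (H : Good h) (θ : Sp n) : (MM h θ)⁻¹ * hs h θ = Pe θ := by
  have : hs h θ = MM h θ - NN (θ : En n).ofLp := by simp [MM]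
  rw [this, Matrix.mul_sub, inv_NN H, Matrix.nonsing_inv_mul _ (Ne.isUnit (H.det_ne θ))]; rfl

lemma adj_eq_inv (H : Good h) (θ : Sp n) : (MM h θ).adjugate = (MM h θ).det • (MM h θ)⁻¹ := by
  have := H.det_ne θ
  rw [Matrix.inv_def, Ring.inverse_eq_inv', smul_smul, mul_inv_cancel₀ this, one_smul]

lemma tr_adj_hs (H : Good h) (θ : Sp n) :
    ((MM h θ).adjugate * hs h θ).trace = (n - 1) * (MM h θ).det := by
  rw [adj_eq_inv H, Matrix.smul_mul, inv_hs H, Matrix.trace_smul, PP_tr (dot_sphere θ), smul_eq_mul]; ring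

lemma CC_hs (H : Good h) (θ : Sp n) :
    CC (MM h θ) (hs h θ) (Pe θ) = (n - 2) * ((MM h θ).adjugate * Pe θ).trace := by
  have h1 : Pe θ * ((MM h θ)⁻¹ * Pe θ) = (MM h θ)⁻¹ * Pe θ - NN (θ : En n).ofLp * Pe θ := by
    have h2 : NN (θ : En n).ofLp * (MM h θ)⁻¹ = NN (θ : En n).ofLp := by
      have := congrArg Matrix.transpose (inv_NN H θ)
      have hs : (MM h θ).transpose = MM h θ := by simp [MM, H.hom.hs_symm (sp_ne θ), NN_symm]
      rwa [Matrix.transpose_mul, NN_symm, Matrix.transpose_nonsing_inv, hs] at this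
    conv_lhs => rw [Pe, PP, Matrix.sub_mul, Matrix.one_mul, ← Matrix.mul_assoc, h2]
    rfl
  have h3 : NN (θ : En n).ofLp * Pe θ = 0 := by
    rw [Pe, PP, Matrix.mul_sub, NN_sq (dot_sphere θ), Matrix.mul_one, sub_self]
  rw [CC_eq (H.det_ne θ), cc, inv_hs H, h1, h3, sub_zero, PP_tr (dot_sphere θ), adj_eq_inv H,
    Matrix.smul_mul, Matrix.trace_smul, smul_eq_mul]; ring

lemma A4 (hn : 3 ≤ n) (H : Good h) : (n - 1) * Q0 h * Q2 h ≤ (n - 2) * (Q1 h) ^ 2 := by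
  have hn' : (3:ℝ) ≤ n := by exact_mod_cast hn
  have cb := H.be_cont
  have ch := H.hom.cont
  have cL := H.Lo_cont hn H.hom
  have cC : Continuous fun θ : Sp n => CC (MM h θ) (hs h θ) (Pe θ) := H.CC_cont H.hom.hs_cont PP_cont
  -- T(h;1,1)
  have t1 : ∫ θ : Sp n, h θ * be h θ ∂(sg n) = (n - 2) * Q1 h := by
    have := TT_symm hn H.hom H.hom hom1_norm hom1_norm H.det_ne
    simp only [hs_norm, norm_eq_of_mem_sphere, one_mul] at this
    rw [Q1, ← integral_const_mul]
    simp only [be]; rw [this]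
    congr 1; ext θ; exact CC_hs H θ
  have t2 : ∫ θ : Sp n, h θ * CC (MM h θ) (hs h θ) (Pe θ) ∂(sg n) = (n - 2) * ((n - 1) * Q0 h) := by
    have := A1 hn H.hom H.hom hom1_norm (fun θ => H.det_ne θ)
    simp only [hs_norm, norm_eq_of_mem_sphere, one_mul] at this
    rw [Q0, ← integral_const_mul (n - 1 : ℝ)]
    simp only [← tr_adj_hs H]
    simp only [MM]; rw [← this, ← integral_const_mul]
    congr 1; ext θ
    have := CC_hs H θ
    simp only [MM] at this; rw [this]; ring
  have hb : 0 < Q2 h := by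
    obtain ⟨b, hb0, hb⟩ := w_lower hn cb (H.be_pos hn)
    have : (sg n).real Set.univ * b ≤ Q2 h := by
      have := integral_mono (μ := sg n) (int_sg continuous_const) (int_sg cb) hb
      simpa [Q2] using this
    have : NeZero n := ⟨by omega⟩
    have hs : 0 < (sg n).real Set.univ := by
      rw [Measure.toSphere_real_apply_univ]
      have : 0 < (volume : Measure (En n)).real (Metric.ball 0 1) := by
        simpa [Measure.real, ENNReal.toReal_pos_iff] using ⟨Metric.measure_ball_pos volume (0 : En n) one_pos, measure_ball_lt_top⟩
      have h2 : 0 < Module.finrank ℝ (En n) := by simp; omega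
      positivity
    nlinarith
  set c := (∫ θ : Sp n, h θ * be h θ ∂(sg n)) / Q2 h
  have hc : ∫ θ : Sp n, h θ * be h θ ∂(sg n) = c * Q2 h := (div_mul_cancel₀ _ hb.ne').symm
  have hf := H.hom.add (hom1_norm.const_mul (n := n) (-c))
  have i1 := int_sg ((ch.fun_pow 2).fun_mul cb)
  have i2 := int_sg (ch.fun_mul cb)
  have i3 := int_sg cb
  have i4 := int_sg ((ch.fun_mul cL).fun_mul cb)
  have i5 := int_sg (cL.fun_mul cb)
  have i6 := int_sg (ch.fun_mul cC)
  have m0 : ∫ θ : Sp n, (h θ + -c * ‖(θ : En n)‖) * be h θ ∂(sg n) = 0 := by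
    have : ∀ θ : Sp n, (h θ + -c * ‖(θ : En n)‖) * be h θ = h θ * be h θ - c * be h θ := by
      intro θ; simp; ring
    simp only [this]
    rw [integral_sub i2 (i3.const_mul _), integral_const_mul, hc, Q2]; ring
  have key := poincare hn H hf m0
  have e1 : ∫ θ : Sp n, (h θ + -c * ‖(θ : En n)‖) ^ 2 * be h θ ∂(sg n) =
      ∫ θ : Sp n, (h θ) ^ 2 * be h θ ∂(sg n) - c ^ 2 * Q2 h := by
    have : ∀ θ : Sp n, (h θ + -c * ‖(θ : En n)‖) ^ 2 * be h θ =
        h θ ^ 2 * be h θ - 2 * c * (h θ * be h θ) + c ^ 2 * be h θ := by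
      intro θ; simp; ring
    simp only [this]
    have j := integral_add (i1.sub' (i2.const_mul (2 * c))) (i3.const_mul (c ^ 2))
    have j2 := integral_sub i1 (i2.const_mul (2 * c))
    rw [j, j2, integral_const_mul, integral_const_mul, hc, Q2]; ring
  have e2 : ∫ θ : Sp n, (h θ + -c * ‖(θ : En n)‖) * Lo h (fun x => h x + -c * ‖x‖) θ * be h θ ∂(sg n) =
      ∫ θ : Sp n, h θ * CC (MM h θ) (hs h θ) (Pe θ) ∂(sg n) - ∫ θ : Sp n, (h θ) ^ 2 * be h θ ∂(sg n) := by
    have : ∀ θ : Sp n, (h θ + -c * ‖(θ : En n)‖) * Lo h (fun x => h x + -c * ‖x‖) θ * be h θ =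
        (h θ * CC (MM h θ) (hs h θ) (Pe θ) - h θ ^ 2 * be h θ) - c * (Lo h h θ * be h θ) := by
      intro θ
      rw [Lo_add H H.hom (hom1_norm.const_mul _), Lo_smul H, H.Lo_norm hn]
      have := H.Lo_be (u := h) hn θ
      simp only [norm_eq_of_mem_sphere]
      linear_combination (h θ) * this
    simp only [this]
    have j := integral_sub (i6.sub' i1) (i5.const_mul c)
    have j2 := integral_sub i6 i1
    rw [j, j2, integral_const_mul, H.Lo_mean hn H.hom]; ring
  rw [e1, e2, t2] at key
  have h1 : (n - 2) * ((n - 1) * Q0 h) * Q2 h ≤ (c * Q2 h) ^ 2 := by nlinarith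
  rw [← hc, t1] at h1
  have h2 : (0:ℝ) < n - 2 := by linarith
  have h3 : ((n:ℝ) - 2) * ((n - 1) * Q0 h * Q2 h) ≤ (n - 2) * ((n - 2) * Q1 h ^ 2) := by nlinarith
  exact le_of_mul_le_mul_left h3 h2

/-- `h + t|x|` -/
def hp (h : En n → ℝ) (t : ℝ) (x : En n) : ℝ := h x + t * ‖x‖

lemma hp_hom (hh : Hom1 h) (t : ℝ) : Hom1 (hp h t) := hh.add (hom1_norm.const_mul t)

lemma hp_MM (hh : Hom1 h) (t : ℝ) (θ : Sp n) : MM (hp h t) θ = MM h θ + t • Pe θ := by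
  unfold MM hp
  rw [hh.hs_add (hom1_norm.const_mul t) (sp_ne θ), Hom1.hs_const_mul, hs_norm]; abel

lemma hp_good (H : Good h) {t : ℝ} (ht : 0 ≤ t) : Good (hp h t) where
  hom := hp_hom H.hom t
  pos θ := by
    rw [hp_MM H.hom]
    exact (H.pos θ).add_posSemidef ((PP_psd (dot_sphere θ)).smul ht)

lemma hp_entry (hh : Hom1 h) (t : ℝ) (θ : Sp n) (i j : Fin n) :
    HasDerivAt (fun s => MM (hp h s) θ i j) (Pe θ i j) t := by
  simp only [hp_MM hh, Matrix.add_apply, Matrix.smul_apply, smul_eq_mul]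
  simpa using ((hasDerivAt_id t).mul_const (Pe θ i j)).const_add (MM h θ i j)

lemma hp_cont (hh : Hom1 h) : Continuous fun p : ℝ × Sp n => MM (hp h p.1) p.2 := by
  simp only [hp_MM hh]
  exact ((MM_cont hh).comp continuous_snd).add (continuous_fst.smul (PP_cont.comp continuous_snd))

lemma Q0_deriv (H : Good h) (t : ℝ) : HasDerivAt (fun t => Q0 (hp h t)) (Q1 (hp h t)) t := by
  refine hasDerivAt_integral_sg (F := fun s θ => (MM (hp h s) θ).det)
    (F' := fun s θ => ((MM (hp h s) θ).adjugate * Pe θ).trace) (fun s => ?_) ?_ ?_ t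
  · exact (MM_cont (hp_hom H.hom s)).matrix_det
  · exact (((hp_cont H.hom).matrix_adjugate).matrix_mul (PP_cont.comp continuous_snd)).matrix_trace
  · intro s θ
    exact hasDerivAt_mdet (fun i j => hp_entry H.hom s θ i j)

lemma Q1_deriv (H : Good h) (t : ℝ) : HasDerivAt (fun t => Q1 (hp h t)) (Q2 (hp h t)) t := by
  refine hasDerivAt_integral_sg (F := fun s θ => ((MM (hp h s) θ).adjugate * Pe θ).trace)
    (F' := fun s θ => be (hp h s) θ) (fun s => ?_) ?_ ?_ t
  · exact ((MM_cont (hp_hom H.hom s)).matrix_adjugate.matrix_mul PP_cont).matrix_trace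
  · exact continuous_CC (hp_cont H.hom) (PP_cont.comp continuous_snd) (PP_cont.comp continuous_snd)
  · intro s θ
    exact hasDerivAt_tr_adj (fun i j => hp_entry H.hom s θ i j)
end poinc

section growth

lemma q_growth {q q' q'' : ℝ → ℝ} {m : ℕ} (hm : 1 ≤ m) {ω : ℝ}
    (h1 : ∀ t, HasDerivAt q (q' t) t) (h2 : ∀ t, HasDerivAt q' (q'' t) t)
    (hp : ∀ t, 0 ≤ t → 0 < q t) (hq : ∀ t, 0 ≤ t → (m:ℝ) * q t * q'' t ≤ (m - 1) * q' t ^ 2)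
    (hl : Tendsto (fun t => q t / t ^ m) atTop (𝓝 ω)) {t s : ℝ} (ht : 0 ≤ t) (hs : 0 ≤ s) :
    q t ^ (1 / (m:ℝ)) + ω ^ (1 / (m:ℝ)) * s ≤ q (t + s) ^ (1 / (m:ℝ)) := by
  have hm' : (1:ℝ) ≤ m := by exact_mod_cast hm
  set a : ℝ := 1 / m with ha
  have ha0 : 0 < a := by positivity
  have ham : a * m = 1 := by rw [ha]; field_simp
  have hcont : Continuous q := continuous_iff_continuousAt.2 fun t => (h1 t).continuousAt
  have conc : ConcaveOn ℝ (Set.Ici 0) fun t => q t ^ a := by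
    refine concaveOn_of_hasDerivWithinAt2_nonpos (convex_Ici 0)
      (f' := fun t => q' t * a * q t ^ (a - 1))
      (f'' := fun t => q'' t * a * q t ^ (a - 1) + q' t * a * (q' t * (a - 1) * q t ^ (a - 1 - 1)))
      ?_ ?_ ?_ ?_
    · exact hcont.continuousOn.rpow_const fun x hx => Or.inr ha0.le
    · intro x hx
      rw [interior_Ici] at hx
      exact ((h1 x).rpow_const (Or.inl (hp x (le_of_lt hx)).ne')).hasDerivWithinAt
    · intro x hx
      rw [interior_Ici] at hx
      exact (((h2 x).mul_const a).fun_mul ((h1 x).rpow_const (Or.inl (hp x (le_of_lt hx)).ne'))).hasDerivWithinAt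
    · intro x hx
      rw [interior_Ici] at hx
      have hx0 := hp x (le_of_lt hx)
      have e : q x ^ (a - 1) = q x * q x ^ (a - 1 - 1) := by
        nth_rewrite 2 [← Real.rpow_one (q x)]
        rw [← Real.rpow_add hx0]; ring_nf
      have h3 := hq x (le_of_lt hx)
      have h4 := Real.rpow_pos_of_pos hx0 (a - 1 - 1)
      simp only [e]
      have h5 : q'' x * a * (q x * q x ^ (a - 1 - 1)) + q' x * a * (q' x * (a - 1) * q x ^ (a - 1 - 1))
        = (a * q x ^ (a - 1 - 1)) * (a * (m * q x * q'' x - (m - 1) * q' x ^ 2)) := by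
        linear_combination (-(a * q x ^ (a - 1 - 1)) * (q x * q'' x - q' x ^ 2)) * ham
      rw [h5]
      have : a * (m * q x * q'' x - (m - 1) * q' x ^ 2) ≤ 0 :=
        mul_nonpos_of_nonneg_of_nonpos ha0.le (by linarith)
      exact mul_nonpos_of_nonneg_of_nonpos (by positivity) this
  rcases hs.eq_or_lt with rfl | hs
  · simp
  have lim : Tendsto (fun T : ℝ => (q T ^ a - q (t + s) ^ a) / (T - (t + s))) atTop (𝓝 (ω ^ a)) := by
    have l1 : Tendsto (fun T : ℝ => (q T / T ^ m) ^ a) atTop (𝓝 (ω ^ a)) := hl.rpow_const (Or.inr ha0.le)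
    have l2 : Tendsto (fun T : ℝ => T⁻¹) atTop (𝓝 0) := tendsto_inv_atTop_zero
    have l3 : Tendsto (fun T : ℝ => ((q T / T ^ m) ^ a - q (t + s) ^ a * T⁻¹) / (1 - (t + s) * T⁻¹)) atTop
        (𝓝 ((ω ^ a - q (t + s) ^ a * 0) / (1 - (t + s) * 0))) :=
      (l1.sub (l2.const_mul _)).div (tendsto_const_nhds.sub (l2.const_mul _)) (by simp)
    simp only [mul_zero, sub_zero, div_one] at l3
    refine l3.congr' ?_
    filter_upwards [eventually_gt_atTop (t + s)] with T hT
    have hT0 : 0 < T := by linarith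
    rw [Real.div_rpow (hp T hT0.le).le (by positivity), ← Real.rpow_natCast, ← Real.rpow_mul hT0.le,
      mul_comm (m:ℝ), ham, Real.rpow_one]
    have : T - (t + s) ≠ 0 := by linarith
    field_simp
  have key : ω ^ a ≤ (q (t + s) ^ a - q t ^ a) / (t + s - t) := by
    refine le_of_tendsto lim ?_
    filter_upwards [eventually_gt_atTop (t + s)] with T hT
    exact conc.slope_anti_adjacent (x := t) (y := t + s) (z := T) ht (by simp; linarith) (by linarith) hT
  rw [add_sub_cancel_left, le_div_iff₀ hs] at key
  linarith
end growth

section steiner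
variable {n : ℕ} {h : En n → ℝ}

lemma det_NP (θ : Sp n) (r : ℝ) (hr : 0 < r) :
    (NN (θ : En n).ofLp + r • Pe θ).det = r ^ (n - 1) := by
  have hn : n - 1 + 1 = n := by
    rcases n with _ | n
    · exact absurd (Subsingleton.elim _ _) (sp_ne θ)
    · rfl
  have e : NN (θ : En n).ofLp + r • Pe θ = r • (1 + Matrix.replicateCol Unit ((r⁻¹ - 1) • (θ : En n).ofLp) *
      Matrix.replicateRow Unit (θ : En n).ofLp) := by
    rw [← Matrix.vecMulVec_eq, Matrix.smul_vecMulVec]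
    ext i j
    simp [Pe, PP, NN, Matrix.vecMulVec_apply]
    field_simp; ring
  rw [e, Matrix.det_smul, Matrix.det_one_add_replicateCol_mul_replicateRow, dotProduct_smul, dot_sphere,
    Fintype.card_fin]
  nth_rewrite 1 [← hn]
  rw [pow_succ, smul_eq_mul, mul_one]; field_simp; ring

lemma det_polar (hh : Hom1 h) (θ : Sp n) {r : ℝ} (hr : 0 < r) :
    r ^ (n - 1) * (1 + hs h (r • (θ : En n))).det = (MM (hp h r) θ).det := by
  rw [← det_NP θ r hr, ← Matrix.det_mul, hh.hs_hom hr, hp_MM hh]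
  congr 1
  have h1 : NN (θ : En n).ofLp * hs h θ = 0 := by
    have := congrArg Matrix.transpose (hs_NN hh θ)
    rwa [Matrix.transpose_mul, NN_symm, hh.hs_symm (sp_ne θ), Matrix.transpose_zero] at this
  have h2 : Pe θ * hs h θ = hs h θ := by rw [Pe, PP, Matrix.sub_mul, h1]; simp
  rw [Matrix.mul_add, Matrix.mul_one, Matrix.add_mul, Matrix.smul_mul, Matrix.mul_smul, Matrix.mul_smul,
    h1, h2, smul_smul, mul_inv_cancel₀ hr.ne', MM]
  simp; abel

lemma Q0_lim (hn : 3 ≤ n) (hh : Hom1 h) :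
    Tendsto (fun t => Q0 (hp h t) / t ^ (n - 1)) atTop (𝓝 ((sg n).real Set.univ)) := by
  have c : Continuous fun s : ℝ => ∫ θ : Sp n, (1 + s • hs h θ).det ∂(sg n) := by
    have := continuous_parametric_integral_of_continuous (μ := sg n) (s := Set.univ)
      (f := fun (s : ℝ) (θ : Sp n) => (1 + s • hs h θ).det) ?_ isCompact_univ
    · simpa using this
    exact (continuous_const.add (continuous_fst.smul (hh.hs_cont.comp continuous_snd))).matrix_det
  have l := (c.tendsto 0).comp tendsto_inv_atTop_zero
  simp only [zero_smul, add_zero, Matrix.det_one, integral_const, smul_eq_mul, mul_one] at l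
  refine l.congr' ?_
  filter_upwards [eventually_gt_atTop 0] with t ht
  rw [eq_div_iff (by positivity), Q0, Function.comp_apply, ← integral_mul_const]
  congr 1; ext θ
  rw [← det_polar hh θ ht, hh.hs_hom ht]; ring

end steiner

section geom
variable {n : ℕ} {C : Set (En n)}

lemma mem_cth (hC : C.Nonempty) {t : ℝ} (ht : 0 ≤ t) (y : En n) :
    y ∈ Metric.cthickening t C ↔ Metric.infDist y C ≤ t := by
  rw [Metric.mem_cthickening_iff, Metric.infDist, ENNReal.le_ofReal_iff_toReal_le (Metric.infEDist_ne_top hC) ht]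

lemma infDist_normal {p x : En n} (hp : p ∈ C) (h : ∀ q ∈ C, inner ℝ (q - p) x ≤ 0) :
    Metric.infDist (p + x) C = ‖x‖ := by
  refine le_antisymm ?_ ?_
  · simpa using Metric.infDist_le_dist_of_mem (x := p + x) hp
  · refine (Metric.le_infDist ⟨p, hp⟩).2 fun q hq => ?_
    rw [dist_eq_norm]
    have h1 := h q hq
    have h2 : ‖p + x - q‖ ^ 2 = ‖q - p‖ ^ 2 - 2 * inner ℝ (q - p) x + ‖x‖ ^ 2 := by
      rw [show p + x - q = x - (q - p) by abel, norm_sub_sq_real, real_inner_comm]; ring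
    exact le_of_sq_le_sq (by nlinarith [sq_nonneg ‖q - p‖]) (norm_nonneg _)

lemma exists_proj (hne : C.Nonempty) (hcl : IsClosed C) (hcv : Convex ℝ C) (y : En n) :
    ∃ p ∈ C, ∀ q ∈ C, inner ℝ (q - p) (y - p) ≤ 0 := by
  obtain ⟨p, hp, h⟩ := exists_norm_eq_iInf_of_complete_convex hne hcl.isComplete hcv y
  refine ⟨p, hp, fun q hq => ?_⟩
  rw [real_inner_comm]
  exact (norm_eq_iInf_iff_real_inner_le_zero hcv hp).1 h q hq

lemma det_fderiv {F : En n → En n} {x : En n} (hF : DifferentiableAt ℝ F x) :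
    (fderiv ℝ F x).det = (Matrix.of fun i j => pd (fun y => F y i) j x).det := by
  set b := (EuclideanSpace.basisFun (Fin n) ℝ).toBasis
  rw [ContinuousLinearMap.det, ← LinearMap.det_toMatrix b]
  congr 1
  ext i j
  have h1 : HasFDerivAt (fun y => F y i) ((EuclideanSpace.proj i : En n →L[ℝ] ℝ).comp (fderiv ℝ F x)) x :=
    (EuclideanSpace.proj i : En n →L[ℝ] ℝ).hasFDerivAt.comp x hF.hasFDerivAt
  rw [LinearMap.toMatrix_apply]
  simp only [Matrix.of_apply, pd, h1.fderiv, b]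
  simp

/-- gradient -/
def gr (h : En n → ℝ) (x : En n) : En n := WithLp.toLp 2 fun i => pd h i x

lemma inner_gr (h : En n → ℝ) (x v : En n) : inner ℝ (gr h x) v = fderiv ℝ h x v := by
  rw [fderiv_apply_sum, PiLp.inner_apply]
  simp [gr, mul_comm]

lemma convex_first {h : En n → ℝ} (hc : ConvexOn ℝ Set.univ h) {x : En n} (hd : DifferentiableAt ℝ h x) (z : En n) :
    h x + fderiv ℝ h x (z - x) ≤ h z := by
  have h1 : HasDerivAt (fun t : ℝ => h (x + t • (z - x))) (fderiv ℝ h x (z - x)) 0 := by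
    have h2 : HasDerivAt (fun t : ℝ => x + t • (z - x)) (z - x) 0 := by
      simpa using ((hasDerivAt_id (0:ℝ)).smul_const (z - x)).const_add x
    have h3 : HasFDerivAt h (fderiv ℝ h x) (x + (0:ℝ) • (z - x)) := by simpa using hd.hasFDerivAt
    exact h3.comp_hasDerivAt 0 h2
  have h4 : ConvexOn ℝ Set.univ (fun t : ℝ => h (x + t • (z - x))) := by
    have := hc.comp_affineMap (AffineMap.lineMap x z : ℝ →ᵃ[ℝ] En n)
    refine (show ConvexOn ℝ Set.univ (h ∘ (AffineMap.lineMap x z : ℝ →ᵃ[ℝ] En n)) from this).congr fun t _ => ?_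
    simp [AffineMap.lineMap_apply, add_comm]
  have := h4.le_slope_of_hasDerivAt (x := 0) (y := 1) trivial trivial one_pos h1
  simp [slope_def_field] at this
  rw [map_sub]; linarith

/-- body with support function `h` -/
def Kh (h : En n → ℝ) : Set (En n) := {y | ∀ x, inner ℝ y x ≤ h x}

lemma Kh_closed (h : En n → ℝ) : IsClosed (Kh h) := by
  have : Kh h = ⋂ x, {y | inner ℝ y x ≤ h x} := by ext; simp [Kh]
  rw [this]
  exact isClosed_iInter fun x => isClosed_le (by fun_prop) continuous_const

lemma Kh_convex (h : En n → ℝ) : Convex ℝ (Kh h) := by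
  intro y hy z hz a b ha hb hab x
  rw [inner_add_left, inner_smul_left, inner_smul_left]
  have := hy x; have := hz x
  simp only [conj_trivial]
  calc _ ≤ a * h x + b * h x := by gcongr
    _ = h x := by rw [← add_mul, hab, one_mul]

variable {h : En n → ℝ}

lemma gr_inner_self (hh : Hom1 h) {x : En n} (hx : x ≠ 0) : inner ℝ (gr h x) x = h x := by
  rw [inner_gr, fderiv_apply_sum, hh.euler1 hx]

lemma gr_mem (hh : Hom1 h) (hc : ConvexOn ℝ Set.univ h) {x : En n} (hx : x ≠ 0) : gr h x ∈ Kh h := by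
  intro z
  have := convex_first hc (hh.diff hx) z
  rw [← inner_gr, inner_sub_right, gr_inner_self hh hx] at this
  linarith

lemma gr_normal (hh : Hom1 h) {x : En n} (hx : x ≠ 0) :
    ∀ q ∈ Kh h, inner ℝ (q - gr h x) x ≤ 0 := by
  intro q hq
  rw [inner_sub_left, gr_inner_self hh hx]
  linarith [hq x]

lemma psi_image (hn : 3 ≤ n) (hh : Hom1 h) (hc : ConvexOn ℝ Set.univ h) {a b : ℝ} (ha : 0 ≤ a) (hab : a ≤ b) :
    (fun x => gr h x + x) '' {x | a < ‖x‖ ∧ ‖x‖ ≤ b} = Metric.cthickening b (Kh h) \ Metric.cthickening a (Kh h) := by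
  have hne : (Kh h).Nonempty := ⟨_, gr_mem hh hc (x := eb ⟨0, by omega⟩) (by simp)⟩
  ext y
  rw [Set.mem_sdiff, mem_cth hne ha, mem_cth hne (ha.trans hab), not_le]
  constructor
  · rintro ⟨x, ⟨h1, h2⟩, rfl⟩
    have hx : x ≠ 0 := by rintro rfl; simp at h1; linarith
    simp only [infDist_normal (gr_mem hh hc hx) (gr_normal hh hx)]
    exact ⟨h2, h1⟩
  · rintro ⟨h1, h2⟩
    obtain ⟨p, hp, hN⟩ := exists_proj hne (Kh_closed h) (Kh_convex h) y
    have e := infDist_normal hp hN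
    rw [add_sub_cancel] at e
    rw [e] at h1 h2
    have hx : y - p ≠ 0 := by intro h0; rw [h0] at h2; simp at h2; linarith
    refine ⟨y - p, ⟨h2, h1⟩, ?_⟩
    suffices gr h (y - p) = p by simp [this]
    set x := y - p
    have e1 : inner ℝ p x = h x := by
      refine le_antisymm (hp x) ?_
      have := hN _ (gr_mem hh hc hx)
      rw [inner_sub_left, gr_inner_self hh hx] at this
      linarith
    have hmin : IsLocalMin (fun z => h z - inner ℝ p z) x :=
      Filter.Eventually.of_forall fun z => by simp only [e1]; linarith [hp z]
    have h3 : HasFDerivAt (fun z => h z - inner ℝ p z) (fderiv ℝ h x - innerSL ℝ p) x :=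
      (hh.diff hx).hasFDerivAt.sub (innerSL ℝ p).hasFDerivAt
    have h4 := hmin.hasFDerivAt_eq_zero h3
    refine ext_inner_right ℝ fun v => ?_
    rw [inner_gr]
    have := DFunLike.congr_fun h4 v
    simpa [sub_eq_zero] using this

lemma psi_inj (hh : Hom1 h) (hc : ConvexOn ℝ Set.univ h) {a b : ℝ} (ha : 0 ≤ a) :
    Set.InjOn (fun x => gr h x + x) {x | a < ‖x‖ ∧ ‖x‖ ≤ b} := by
  intro x ⟨h1, _⟩ y ⟨h2, _⟩ hxy
  have hx : x ≠ 0 := by rintro rfl; simp at h1; linarith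
  have hy : y ≠ 0 := by rintro rfl; simp at h2; linarith
  have e1 := gr_normal hh hx _ (gr_mem hh hc hy)
  have e2 := gr_normal hh hy _ (gr_mem hh hc hx)
  have e3 : gr h x - gr h y = y - x := by
    have : gr h x + x = gr h y + y := hxy
    rw [sub_eq_sub_iff_add_eq_add, this]; abel
  rw [e3] at e2
  rw [← neg_sub, e3, inner_neg_left] at e1
  have : inner ℝ (y - x) (y - x) ≤ 0 := by rw [inner_sub_right]; linarith
  have h0 : y - x = 0 := inner_self_eq_zero.1 (le_antisymm this real_inner_self_nonneg)
  exact (sub_eq_zero.1 h0).symm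

lemma gr_diff (hh : Hom1 h) {x : En n} (hx : x ≠ 0) : DifferentiableAt ℝ (fun x => gr h x + x) x := by
  refine DifferentiableAt.add ?_ differentiableAt_id
  refine (differentiableAt_euclidean).2 fun i => ?_
  exact hh.pd_diff hx i

lemma psi_det (hh : Hom1 h) {x : En n} (hx : x ≠ 0) :
    (fderiv ℝ (fun x => gr h x + x) x).det = (1 + hs h x).det := by
  rw [det_fderiv (gr_diff hh hx)]
  congr 1
  ext i j
  simp only [Matrix.of_apply, Matrix.add_apply, hs_apply, PiLp.add_apply, gr]
  rw [pd_add (hh.pd_diff hx i) (diff_coord x i), pd_coord, Matrix.one_apply, add_comm]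

lemma polar_l [NeZero n] (F : En n → ENNReal) : ∫⁻ x, F x =
    ∫⁻ p : Sp n × Set.Ioi (0:ℝ), F ((p.2 : ℝ) • (p.1 : En n)) ∂((sg n).prod (Measure.volumeIoiPow (n - 1))) := by
  calc ∫⁻ x, F x = ∫⁻ x : ({(0)}ᶜ : Set (En n)), F x.1 ∂(volume.comap Subtype.val) := by
        rw [lintegral_subtype_comap (measurableSet_singleton _).compl,
          restrict_compl_singleton]
    _ = _ := by
        have := (volume : Measure (En n)).measurePreserving_homeomorphUnitSphereProd
        rw [show Module.finrank ℝ (En n) = n by simp] at this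
        rw [← this.lintegral_comp_emb (Homeomorph.measurableEmbedding _)]
        congr 1; ext x
        have hx : 0 < ‖x.1‖ := norm_pos_iff.2 x.2
        simp only [homeomorphUnitSphereProd_apply_fst_coe, homeomorphUnitSphereProd_apply_snd_coe]
        rw [smul_smul, mul_inv_cancel₀ hx.ne', one_smul]

lemma vol_shell (hn : 3 ≤ n) (H : Good h) (hc : ConvexOn ℝ Set.univ h) {a b : ℝ} (ha : 0 ≤ a) (hab : a ≤ b) :
    volume (Metric.cthickening b (Kh h) \ Metric.cthickening a (Kh h)) =
      ∫⁻ r in Set.Ioc a b, ENNReal.ofReal (Q0 (hp h r)) := by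
  have hh := H.hom
  have : NeZero n := ⟨by omega⟩
  have hA : MeasurableSet {x : En n | a < ‖x‖ ∧ ‖x‖ ≤ b} :=
    (measurableSet_lt measurable_const measurable_norm).inter (measurableSet_le measurable_norm measurable_const)
  have h0 : ∀ x ∈ {x : En n | a < ‖x‖ ∧ ‖x‖ ≤ b}, x ≠ 0 := by
    rintro x ⟨h1, _⟩ rfl; simp at h1; linarith
  rw [← psi_image hn hh hc ha hab, ← lintegral_abs_det_fderiv_eq_addHaar_image volume hA
    (fun x hx => (gr_diff hh (h0 x hx)).hasFDerivAt.hasFDerivWithinAt) (psi_inj hh hc ha),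
    ← lintegral_indicator hA, polar_l]
  set D : Sp n × Set.Ioi (0:ℝ) → ENNReal := fun p => (Set.Ioc a b).indicator
    (fun r => ENNReal.ofReal ((MM (hp h r) p.1).det / r ^ (n - 1))) p.2
  have hD : Measurable D := by
    have e : D = {p : Sp n × Set.Ioi (0:ℝ) | (p.2:ℝ) ∈ Set.Ioc a b}.indicator
      (fun p => ENNReal.ofReal ((MM (hp h p.2) p.1).det / (p.2:ℝ) ^ (n - 1))) := by
      ext p; simp [D, Set.indicator]
    rw [e]
    refine Measurable.indicator ?_ (measurableSet_Ioc.preimage (measurable_subtype_coe.comp measurable_snd))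
    refine ENNReal.measurable_ofReal.comp (Continuous.measurable ?_)
    refine Continuous.div₀ ?_ (by fun_prop) fun p => (pow_pos p.2.2 _).ne'
    exact ((hp_cont hh).comp (f := fun p : Sp n × Set.Ioi (0:ℝ) => ((p.2:ℝ), p.1)) (by fun_prop)).matrix_det
  have e1 : ∀ p : Sp n × Set.Ioi (0:ℝ), Set.indicator {x : En n | a < ‖x‖ ∧ ‖x‖ ≤ b}
      (fun x => ENNReal.ofReal |(fderiv ℝ (fun x => gr h x + x) x).det|) ((p.2 : ℝ) • (p.1 : En n)) = D p := by
    rintro ⟨θ, r, hr⟩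
    have hr : 0 < r := hr
    have hne : r • (θ : En n) ≠ 0 := smul_ne_zero hr.ne' (sp_ne θ)
    have hnn : ‖r • (θ : En n)‖ = r := by simp [norm_smul, abs_of_pos hr]
    simp only [D, Set.indicator, Set.mem_ofPred_eq, hnn, Set.mem_Ioc]
    rw [psi_det hh hne, ← det_polar hh θ hr, mul_div_cancel_left₀ _ (pow_pos hr _).ne', abs_of_pos]
    have := ((hp_good H hr.le).pos θ).det_pos
    rw [← det_polar hh θ hr] at this
    exact pos_of_mul_pos_right this (pow_pos hr _).le
  simp only [e1]
  rw [lintegral_prod_symm _ hD.aemeasurable, Measure.volumeIoiPow,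
    lintegral_withDensity_eq_lintegral_mul _ (by fun_prop) hD.lintegral_prod_left']
  have e2 : ∀ r : Set.Ioi (0:ℝ), ((fun r : Set.Ioi (0:ℝ) => ENNReal.ofReal ((r:ℝ) ^ (n - 1))) * fun y => ∫⁻ x, D (x, y) ∂(sg n)) r
      = (Set.Ioc a b).indicator (fun r => ENNReal.ofReal (Q0 (hp h r))) r := by
    rintro ⟨r, hr⟩
    have hr : 0 < r := hr
    simp only [Pi.mul_apply, D, Set.indicator]
    split_ifs with hi
    · rw [← ofReal_integral_eq_lintegral_ofReal, ← ENNReal.ofReal_mul (by positivity), ← integral_const_mul, Q0]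
      · congr 2; ext θ; field_simp
      · exact int_sg ((MM_cont (hp_hom hh r)).matrix_det.div_const _)
      · exact Eventually.of_forall fun θ => div_nonneg ((hp_good H hr.le).pos θ).det_pos.le (by positivity)
    · simp
  simp only [e2]
  have e3 := lintegral_subtype_comap (μ := volume) measurableSet_Ioi (s := Set.Ioi (0:ℝ)) ((Set.Ioc a b).indicator (fun r => ENNReal.ofReal (Q0 (hp h r))))
  rw [e3, lintegral_indicator measurableSet_Ioc, Measure.restrict_restrict measurableSet_Ioc]
  congr 2
  exact Set.inter_eq_left.2 fun r hr => lt_of_le_of_lt ha hr.1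
end geom

section dd
variable {n : ℕ} {h : En n → ℝ}

/-- volume of parallel body -/
def PV (C : Set (En n)) (t : ℝ) : ℝ := volume.real (Metric.cthickening t C)

lemma cth_fin {C : Set (En n)} (hb : Bornology.IsBounded C) (t : ℝ) : volume (Metric.cthickening t C) ≠ ⊤ :=
  (hb.cthickening).measure_lt_top.ne

lemma PV_sub {C : Set (En n)} (hb : Bornology.IsBounded C) {a b : ℝ} (hab : a ≤ b) :
    PV C b - PV C a = (volume (Metric.cthickening b C \ Metric.cthickening a C)).toReal := by
  rw [PV, PV, Measure.real, Measure.real, measure_sdiff (Metric.cthickening_mono hab C)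
    Metric.isClosed_cthickening.measurableSet.nullMeasurableSet (cth_fin hb a),
    ENNReal.toReal_sub_of_le (measure_mono (Metric.cthickening_mono hab C)) (cth_fin hb b)]

lemma Q1_nonneg (H : Good h) : 0 ≤ Q1 h := by
  refine integral_nonneg fun θ => ?_
  simp only [Pi.zero_apply]
  rw [adj_eq_inv H, Matrix.smul_mul, Matrix.trace_smul, smul_eq_mul]
  have h1 := (H.pos θ).inv.posSemidef
  obtain ⟨B, hB⟩ := psd_factor (PP_psd (dot_sphere θ))
  refine mul_nonneg (H.pos θ).det_pos.le ?_
  rw [show Pe θ = B.transpose * B from hB, ← Matrix.mul_assoc, Matrix.trace_mul_comm, ← Matrix.mul_assoc]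
  have := (h1.mul_mul_conjTranspose_same B).trace_nonneg
  simpa using this

lemma Q0_mono (H : Good h) {a b : ℝ} (ha : 0 ≤ a) (hab : a ≤ b) : Q0 (hp h a) ≤ Q0 (hp h b) := by
  have : MonotoneOn (fun t => Q0 (hp h t)) (Set.Ici 0) := by
    refine monotoneOn_of_deriv_nonneg (convex_Ici 0)
      (fun x _ => (Q0_deriv H x).continuousAt.continuousWithinAt)
      (fun x _ => (Q0_deriv H x).differentiableAt.differentiableWithinAt) fun x hx => ?_
    rw [interior_Ici] at hx
    rw [(Q0_deriv H x).deriv]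
    exact Q1_nonneg (hp_good H (le_of_lt hx))
  exact this ha (ha.trans hab) hab

lemma sg_pos (hn : 3 ≤ n) : 0 < (sg n).real Set.univ := by
  have : NeZero n := ⟨by omega⟩
  rw [Measure.toSphere_real_apply_univ]
  have : 0 < (volume : Measure (En n)).real (Metric.ball 0 1) := by
    simpa [Measure.real, ENNReal.toReal_pos_iff] using ⟨Metric.measure_ball_pos volume (0 : En n) one_pos, measure_ball_lt_top⟩
  have h2 : 0 < Module.finrank ℝ (En n) := by simp; omega
  positivity

lemma Q0_pos (hn : 3 ≤ n) (H : Good h) : 0 < Q0 h := by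
  have c := (MM_cont H.hom).matrix_det
  obtain ⟨b, hb0, hb⟩ := w_lower hn c fun θ => (H.pos θ).det_pos
  have h1 : (sg n).real Set.univ * b ≤ Q0 h := by
    have := integral_mono (μ := sg n) (int_sg continuous_const) (int_sg c) hb
    simpa [Q0] using this
  have := sg_pos hn
  nlinarith

lemma shell_bounds (hn : 3 ≤ n) (H : Good h) (hc : ConvexOn ℝ Set.univ h) (hb : Bornology.IsBounded (Kh h))
    {a b : ℝ} (ha : 0 ≤ a) (hab : a ≤ b) :
    (b - a) * Q0 (hp h a) ≤ PV (Kh h) b - PV (Kh h) a ∧ PV (Kh h) b - PV (Kh h) a ≤ (b - a) * Q0 (hp h b) := by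
  have hfin : volume (Metric.cthickening b (Kh h) \ Metric.cthickening a (Kh h)) ≠ ⊤ :=
    measure_ne_top_of_subset Set.sdiff_subset (cth_fin hb b)
  have hv : ∀ t, 0 ≤ t → 0 ≤ Q0 (hp h t) := fun t ht => (Q0_pos hn (hp_good H ht)).le
  have hc0 : ∀ c : ℝ, ∫⁻ _ in Set.Ioc a b, ENNReal.ofReal (Q0 (hp h c)) = ENNReal.ofReal ((b - a) * Q0 (hp h c)) := by
    intro c
    rw [setLIntegral_const, Real.volume_Ioc, mul_comm, ← ENNReal.ofReal_mul (by linarith)]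
  rw [PV_sub hb hab]
  have h1 := vol_shell hn H hc ha hab
  constructor
  · refine (ENNReal.ofReal_le_iff_le_toReal hfin).1 ?_
    rw [h1, ← hc0]
    exact setLIntegral_mono' measurableSet_Ioc fun r hr => ENNReal.ofReal_le_ofReal (Q0_mono H ha hr.1.le)
  · refine ENNReal.toReal_le_of_le_ofReal (mul_nonneg (by linarith) (hv b (ha.trans hab))) ?_
    rw [h1, ← hc0]
    exact setLIntegral_mono' measurableSet_Ioc fun r hr => ENNReal.ofReal_le_ofReal (Q0_mono H (ha.trans hr.1.le) hr.2)

/-- the key discrete inequality -/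
def DDI (C : Set (En n)) : Prop := ∀ s δ : ℝ, 0 ≤ s → 0 < δ →
  δ * (((PV C δ - PV C 0) / δ) ^ (1 / ((n - 1 : ℕ) : ℝ)) +
    ((sg n).real Set.univ) ^ (1 / ((n - 1 : ℕ) : ℝ)) * s) ^ (n - 1) ≤ PV C (s + 2 * δ) - PV C (s + δ)

lemma ddi_Kh (hn : 3 ≤ n) (H : Good h) (hc : ConvexOn ℝ Set.univ h) (hb : Bornology.IsBounded (Kh h)) :
    DDI (Kh h) := by
  intro s δ hs hδ
  have hcast : ((n - 1 : ℕ) : ℝ) = n - 1 := by rw [Nat.cast_sub (by omega)]; simp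
  have b1 := (shell_bounds hn H hc hb le_rfl hδ.le).2
  have b2 := (shell_bounds hn H hc hb (a := s + δ) (b := s + 2 * δ) (by linarith) (by linarith)).1
  have b0 := (shell_bounds hn H hc hb le_rfl hδ.le).1
  have q0 := Q0_pos hn (hp_good H le_rfl)
  have qd := Q0_pos hn (hp_good H hδ.le)
  have qs := Q0_pos hn (hp_good H (show 0 ≤ δ + s by linarith))
  have g := q_growth (m := n - 1) (by omega) (Q0_deriv H) (Q1_deriv H) (fun t ht => Q0_pos hn (hp_good H ht))
    (fun t ht => by have := A4 hn (hp_good H ht); rw [hcast]; convert this using 2; ring) (Q0_lim hn H.hom) hδ.le hs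
  have hω := (sg_pos hn).le
  rw [sub_zero] at b0 b1
  have hd0 : 0 ≤ (PV (Kh h) δ - PV (Kh h) 0) / δ := by
    refine div_nonneg (le_trans ?_ b0) hδ.le; positivity
  have h1 : (PV (Kh h) δ - PV (Kh h) 0) / δ ≤ Q0 (hp h δ) := by
    rw [div_le_iff₀ hδ]; linarith
  have h2 : ((PV (Kh h) δ - PV (Kh h) 0) / δ) ^ (1 / ((n - 1 : ℕ) : ℝ)) +
    ((sg n).real Set.univ) ^ (1 / ((n - 1 : ℕ) : ℝ)) * s ≤ Q0 (hp h (δ + s)) ^ (1 / ((n - 1 : ℕ) : ℝ)) :=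
    le_trans (by gcongr) g
  have h3 := pow_le_pow_left₀ (by positivity) h2 (n - 1)
  rw [← Real.rpow_natCast (Q0 (hp h (δ + s)) ^ _), ← Real.rpow_mul qs.le, one_div,
    inv_mul_cancel₀ (by rw [hcast]; have : (3:ℝ) ≤ n := (by exact_mod_cast hn); linarith), Real.rpow_one] at h3
  calc _ ≤ δ * Q0 (hp h (δ + s)) := by rw [one_div]; gcongr
    _ ≤ _ := by rw [add_comm δ s]; linarith
end dd

section partC
variable {n : ℕ} {h : En n → ℝ}

lemma hs_psd (hh : Hom1 h) (hc : ConvexOn ℝ Set.univ h) {x : En n} (hx : x ≠ 0) : (hs h x).PosSemidef := by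
  refine Matrix.PosSemidef.of_dotProduct_mulVec_nonneg ?_ fun w => ?_
  · exact (hh.hs_symm hx)
  set v : En n := WithLp.toLp 2 w
  have hl : HasDerivAt (fun t : ℝ => x + t • v) v 0 := by
    simpa using ((hasDerivAt_id (0:ℝ)).smul_const v).const_add x
  have hd : HasDerivAt (fun t : ℝ => ∑ i, v i * pd h i (x + t • v)) (∑ i, v i * fderiv ℝ (pd h i) x v) 0 := by
    refine HasDerivAt.fun_sum fun i _ => HasDerivAt.const_mul _ ?_
    have := (hh.pd_diff hx i).hasFDerivAt
    rw [← show x + (0:ℝ) • v = x by simp] at this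
    have := this.comp_hasDerivAt (0:ℝ) hl
    rw [zero_smul, add_zero] at this
    exact this
  have e : ∑ i, v i * fderiv ℝ (pd h i) x v = star w ⬝ᵥ (hs h x).mulVec w := by
    simp [dotProduct, Matrix.mulVec, hs, fderiv_apply_sum, v, mul_comm]
  rw [← e]
  refine ge_of_tendsto hd.tendsto_slope_zero_right ?_
  have hne : ∀ᶠ t : ℝ in 𝓝[>] 0, x + t • v ≠ 0 := by
    apply nhdsWithin_le_nhds
    exact hl.continuousAt.eventually_ne (by simpa using hx)
  filter_upwards [hne, self_mem_nhdsWithin] with t ht h0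
  have h0 : 0 < t := h0
  have h1 := convex_first hc (hh.diff hx) (x + t • v)
  have h2 := convex_first hc (hh.diff ht) x
  rw [show x + t • v - x = t • v by abel, map_smul, fderiv_apply_sum, smul_eq_mul] at h1
  rw [show x - (x + t • v) = (-t) • v by rw [neg_smul]; abel, map_smul, fderiv_apply_sum, smul_eq_mul] at h2
  simp only [zero_add, zero_smul, add_zero, smul_eq_mul]
  have : 0 ≤ (t * t)⁻¹ * (t * (∑ i, v i * pd h i (x + t • v) - ∑ i, v i * pd h i x)) := by
    apply mul_nonneg (by positivity); linarith
  rwa [mul_inv, mul_assoc, inv_mul_cancel_left₀ h0.ne'] at this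

lemma good_hp (hh : Hom1 h) (hc : ConvexOn ℝ Set.univ h) {η : ℝ} (h0 : 0 < η) (h1 : η < 1) : Good (hp h η) where
  hom := hp_hom hh η
  pos θ := by
    rw [hp_MM hh, MM, Pe, PP, show hs h ↑θ + NN (θ : En n).ofLp + η • (1 - NN (θ : En n).ofLp) =
      η • (1 : Matrix (Fin n) (Fin n) ℝ) + (hs h ↑θ + (1 - η) • NN (θ : En n).ofLp) by
        rw [smul_sub, sub_smul, one_smul]; abel]
    refine (Matrix.PosDef.one.smul h0).add_posSemidef ((hs_psd hh hc (sp_ne θ)).add (Matrix.PosSemidef.smul ?_ (by linarith)))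
    simpa [NN] using Matrix.posSemidef_vecMulVec_self_star (θ : En n).ofLp

def ls (Y : Finset (En n)) (δ : ℝ) (x : En n) : ℝ :=
  δ * ‖x‖ * Real.log (∑ y ∈ Y, Real.exp (inner ℝ y x / (δ * ‖x‖)))

variable {Y : Finset (En n)} {δ : ℝ}

lemma ls_gibbs (hδ : 0 < δ) (hY : Y.Nonempty) {p : En n → ℝ} (hp0 : ∀ y ∈ Y, 0 < p y) (hp1 : ∑ y ∈ Y, p y = 1) (x : En n) :
    ∑ y ∈ Y, p y * inner ℝ y x + δ * ‖x‖ * ∑ y ∈ Y, p y * (-Real.log (p y)) ≤ ls Y δ x := by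
  rcases eq_or_ne x 0 with rfl | hx
  · simp [ls]
  have hr : 0 < δ * ‖x‖ := mul_pos hδ (norm_pos_iff.2 hx)
  unfold ls
  set r := δ * ‖x‖
  set Z := ∑ y ∈ Y, Real.exp (inner ℝ y x / r) with hZ
  have hZ0 : 0 < Z := Finset.sum_pos (fun y _ => Real.exp_pos _) hY
  have key : ∑ y ∈ Y, p y * (inner ℝ y x / r - Real.log (p y) - Real.log Z) ≤ 0 := by
    calc _ ≤ ∑ y ∈ Y, (Real.exp (inner ℝ y x / r) / Z - p y) := by
          refine Finset.sum_le_sum fun y hy => ?_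
          have h0 := hp0 y hy
          have := Real.log_le_sub_one_of_pos (x := Real.exp (inner ℝ y x / r) / (p y * Z)) (by positivity)
          rw [Real.log_div (by positivity) (by positivity), Real.log_exp, Real.log_mul h0.ne' hZ0.ne'] at this
          calc _ = p y * (inner ℝ y x / r - (Real.log (p y) + Real.log Z)) := by ring
            _ ≤ p y * (Real.exp (inner ℝ y x / r) / (p y * Z) - 1) := by gcongr
            _ = _ := by field_simp
      _ = 0 := by rw [Finset.sum_sub_distrib, ← Finset.sum_div, ← hZ, hp1, div_self hZ0.ne']; simp
  have e : ∑ y ∈ Y, p y * (inner ℝ y x / r - Real.log (p y) - Real.log Z) =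
      (∑ y ∈ Y, p y * inner ℝ y x) / r + ∑ y ∈ Y, p y * (-Real.log (p y)) - Real.log Z := by
    simp only [mul_sub, Finset.sum_sub_distrib, ← Finset.sum_mul, hp1, mul_neg, Finset.sum_neg_distrib,
      Finset.sum_div, mul_div_assoc]; ring
  rw [e] at key
  have := mul_le_mul_of_nonneg_left key hr.le
  rw [mul_sub, mul_add, mul_div_cancel₀ _ hr.ne'] at this
  linarith

lemma ls_eq (hδ : 0 < δ) (hY : Y.Nonempty) (x : En n) : ∃ p : En n → ℝ, (∀ y ∈ Y, 0 < p y) ∧ (∀ y ∈ Y, p y ≤ 1) ∧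
    ∑ y ∈ Y, p y = 1 ∧
    ls Y δ x = ∑ y ∈ Y, p y * inner ℝ y x + δ * ‖x‖ * ∑ y ∈ Y, p y * (-Real.log (p y)) := by
  unfold ls
  set r := δ * ‖x‖ with hr
  set Z := ∑ y ∈ Y, Real.exp (inner ℝ y x / r) with hZ
  have hZ0 : 0 < Z := Finset.sum_pos (fun y _ => Real.exp_pos _) hY
  have hs1 : ∑ y ∈ Y, Real.exp (inner ℝ y x / r) / Z = 1 := by rw [← Finset.sum_div, ← hZ, div_self hZ0.ne']
  refine ⟨fun y => Real.exp (inner ℝ y x / r) / Z, fun y _ => by positivity, fun y hy => ?_, hs1, ?_⟩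
  · rw [div_le_one hZ0]; exact Finset.single_le_sum (f := fun y => Real.exp (inner ℝ y x / r)) (fun y _ => (Real.exp_pos _).le) hy
  have hri : ∀ y : En n, r * (inner ℝ y x / r) = inner ℝ y x := fun y => by
    rcases eq_or_ne x 0 with rfl | hx
    · simp
    · exact mul_div_cancel₀ _ (mul_pos hδ (norm_pos_iff.2 hx)).ne'
  rw [Finset.mul_sum, ← Finset.sum_add_distrib]
  calc r * Real.log Z = (∑ y ∈ Y, Real.exp (inner ℝ y x / r) / Z) * (r * Real.log Z) := by rw [hs1, one_mul]
    _ = _ := by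
      rw [Finset.sum_mul]
      refine Finset.sum_congr rfl fun y _ => ?_
      simp only []
      rw [Real.log_div (by positivity) hZ0.ne', Real.log_exp]
      have := hri y
      linear_combination (Real.exp (inner ℝ y x / r) / Z) * this

lemma ls_add (hδ : 0 < δ) (hY : Y.Nonempty) (x z : En n) : ls Y δ (x + z) ≤ ls Y δ x + ls Y δ z := by
  obtain ⟨p, hp0, hp1, hps, he⟩ := ls_eq hδ hY (x + z)
  have h1 := ls_gibbs hδ hY hp0 hps x
  have h2 := ls_gibbs hδ hY hp0 hps z
  have hE : 0 ≤ ∑ y ∈ Y, p y * (-Real.log (p y)) := Finset.sum_nonneg fun y hy =>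
    mul_nonneg (hp0 y hy).le (neg_nonneg.2 (Real.log_nonpos (hp0 y hy).le (hp1 y hy)))
  have h3 := mul_le_mul_of_nonneg_right (mul_le_mul_of_nonneg_left (norm_add_le x z) hδ.le) hE
  rw [he]; simp only [inner_add_right, mul_add, Finset.sum_add_distrib, add_mul] at *; linarith

lemma ls_hom1 (hδ : 0 < δ) (hY : Y.Nonempty) : Hom1 (ls Y δ) where
  smooth x hx := by
    have hr : δ * ‖x‖ ≠ 0 := (mul_pos hδ (norm_pos_iff.2 hx)).ne'
    have hN : ContDiffAt ℝ 3 (fun x : En n => δ * ‖x‖) x := contDiffAt_const.mul (contDiffAt_norm ℝ hx)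
    refine hN.mul (ContDiffAt.log (ContDiffAt.sum fun y _ => ?_) ?_)
    · exact (ContDiffAt.div (contDiffAt_const.inner ℝ contDiffAt_id) hN hr).exp
    · exact (Finset.sum_pos (fun y _ => Real.exp_pos _) hY).ne'
  hom t ht x := by
    have e : ∀ y : En n, inner ℝ y (t • x) / (δ * ‖t • x‖) = inner ℝ y x / (δ * ‖x‖) := fun y => by
      rw [inner_smul_right, norm_smul, Real.norm_of_nonneg ht.le, mul_left_comm, mul_div_mul_left _ _ ht.ne']
    unfold ls; simp only [e]; rw [norm_smul, Real.norm_of_nonneg ht.le]; ring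

lemma ls_zero : ls Y δ 0 = 0 := by simp [ls]

lemma ls_convex (hδ : 0 < δ) (hY : Y.Nonempty) : ConvexOn ℝ Set.univ (ls Y δ) := by
  have hm : ∀ (a : ℝ) (x : En n), 0 ≤ a → ls Y δ (a • x) = a * ls Y δ x := fun a x ha => by
    rcases ha.eq_or_lt with rfl | ha
    · simp [ls_zero]
    · exact (ls_hom1 hδ hY).hom a ha x
  refine ⟨convex_univ, fun x _ z _ a b ha hb _ => (ls_add hδ hY _ _).trans ?_⟩
  rw [hm a x ha, hm b z hb]; simp

lemma ls_ge (hδ : 0 < δ) {y : En n} (hy : y ∈ Y) (x : En n) : inner ℝ y x ≤ ls Y δ x := by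
  rcases eq_or_ne x 0 with rfl | hx
  · simp [ls]
  have hr : 0 < δ * ‖x‖ := mul_pos hδ (norm_pos_iff.2 hx)
  have h1 : Real.exp (inner ℝ y x / (δ * ‖x‖)) ≤ ∑ y ∈ Y, Real.exp (inner ℝ y x / (δ * ‖x‖)) :=
    Finset.single_le_sum (f := fun y => Real.exp (inner ℝ y x / (δ * ‖x‖))) (fun y _ => (Real.exp_pos _).le) hy
  have := Real.log_le_log (Real.exp_pos _) h1
  rw [Real.log_exp, div_le_iff₀ hr] at this
  unfold ls; linarith

lemma ls_le (hδ : 0 < δ) (hY : Y.Nonempty) {x : En n} {c : ℝ} (hc : ∀ y ∈ Y, inner ℝ y x ≤ c) :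
    ls Y δ x ≤ c + δ * Real.log Y.card * ‖x‖ := by
  have hcard : 0 < (Y.card : ℝ) := by exact_mod_cast hY.card_pos
  rcases eq_or_ne x 0 with rfl | hx
  · obtain ⟨y, hy⟩ := hY; simpa [ls] using hc y hy
  have hr : 0 < δ * ‖x‖ := mul_pos hδ (norm_pos_iff.2 hx)
  have h1 : ∑ y ∈ Y, Real.exp (inner ℝ y x / (δ * ‖x‖)) ≤ Y.card * Real.exp (c / (δ * ‖x‖)) := by
    rw [← nsmul_eq_mul]
    exact Finset.sum_le_card_nsmul _ _ _ fun y hy => Real.exp_le_exp.2 (by gcongr; exact hc y hy)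
  have := Real.log_le_log (Finset.sum_pos (fun y _ => Real.exp_pos _) hY) h1
  rw [Real.log_mul hcard.ne' (by positivity), Real.log_exp] at this
  have := mul_le_mul_of_nonneg_left this hr.le
  rw [mul_add, mul_div_cancel₀ _ hr.ne'] at this
  unfold ls; linarith

lemma approx {K : Set (En n)} (hne : K.Nonempty) (hcv : Convex ℝ K) (hcp : IsCompact K) {ε : ℝ} (hε : 0 < ε) :
    ∃ h : En n → ℝ, Good h ∧ ConvexOn ℝ Set.univ h ∧ K ⊆ Kh h ∧ Kh h ⊆ Metric.cthickening ε K := by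
  obtain ⟨η, h0, h1, h2⟩ : ∃ η : ℝ, 0 < η ∧ η < 1 ∧ η ≤ ε / 2 :=
    ⟨min (1/2) (ε/2), by positivity, by have := min_le_left (1/2) (ε/2); linarith, min_le_right _ _⟩
  obtain ⟨t, htK, htf, hcov⟩ := hcp.finite_cover_balls h0
  set Y := htf.toFinset
  have hY : Y.Nonempty := by
    obtain ⟨x, hx⟩ := hne
    obtain ⟨y, hy, -⟩ := Set.mem_iUnion₂.1 (hcov hx)
    exact ⟨y, by simpa [Y] using hy⟩
  obtain ⟨δ, hδ, hδ2⟩ : ∃ δ : ℝ, 0 < δ ∧ δ * Real.log Y.card ≤ ε / 2 := by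
    have hl : 0 ≤ Real.log Y.card := Real.log_natCast_nonneg _
    refine ⟨ε / 2 / (Real.log Y.card + 1), by positivity, ?_⟩
    rw [div_mul_eq_mul_div, div_le_iff₀ (by positivity)]; nlinarith
  have hc := ls_convex hδ hY
  refine ⟨hp (ls Y δ) η, good_hp (ls_hom1 hδ hY) hc h0 h1, ?_, ?_, ?_⟩
  · exact hc.add ((convexOn_norm convex_univ).smul h0.le)
  · intro y hy x
    obtain ⟨z, hz, hyz⟩ := Set.mem_iUnion₂.1 (hcov hy)
    have h3 := ls_ge (Y := Y) hδ (y := z) (by simpa [Y] using hz) x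
    have h4 := real_inner_le_norm (y - z) x
    rw [Metric.mem_ball, dist_eq_norm] at hyz
    rw [inner_sub_left] at h4
    have := mul_le_mul_of_nonneg_right hyz.le (norm_nonneg x)
    unfold hp; linarith
  · intro y hy
    obtain ⟨p, hp, hpq⟩ := exists_proj hne hcp.isClosed hcv y
    rw [mem_cth hne hε.le]
    have h3 := infDist_normal hp hpq
    rw [add_sub_cancel] at h3
    rw [h3]
    have h4 := hy (y - p)
    have h5 := ls_le (Y := Y) (x := y - p) (c := inner ℝ p (y - p)) hδ hY fun z hz => by
      have := hpq z (htK (by simpa [Y] using hz)); rw [inner_sub_left] at this; linarith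
    have h6 : inner ℝ (y - p) (y - p) = ‖y - p‖ ^ 2 := real_inner_self_eq_norm_sq _
    rw [inner_sub_left] at h6
    have h7 := mul_le_mul_of_nonneg_right hδ2 (norm_nonneg (y - p))
    have h8 := mul_le_mul_of_nonneg_right h2 (norm_nonneg (y - p))
    unfold _root_.hp at h4
    by_contra! hcon
    nlinarith

lemma PV_mono {A B : Set (En n)} {a b : ℝ} (hb : Bornology.IsBounded B)
    (h : Metric.cthickening a A ⊆ Metric.cthickening b B) : PV A a ≤ PV B b :=
  measureReal_mono h (cth_fin hb b)

lemma PV_tendsto {K : Set (En n)} (hcp : IsCompact K) {t : ℝ} (ht : 0 ≤ t) :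
    Tendsto (fun ε => PV K (t + ε)) (𝓝[>] 0) (𝓝 (PV K t)) := by
  have h1 := (tendsto_measure_cthickening_of_isCompact (μ := volume) (hcp.cthickening (r := t))).mono_left
    (nhdsWithin_le_nhds (s := Set.Ioi (0:ℝ)))
  have := (ENNReal.tendsto_toReal (cth_fin hcp.isBounded t)).comp h1
  refine this.congr' ?_
  filter_upwards [self_mem_nhdsWithin] with ε hε
  rw [Function.comp, PV, Measure.real, cthickening_cthickening (le_of_lt hε) ht, add_comm]

theorem ddi_convex (hn : 3 ≤ n) {K : Set (En n)} (hne : K.Nonempty) (hcv : Convex ℝ K) (hcp : IsCompact K) : DDI K := by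
  intro s δ hs hδ
  have key : ∀ ε : ℝ, 0 < ε → δ * ((max (PV K δ - PV K (0 + ε)) 0 / δ) ^ (1 / ((n - 1 : ℕ) : ℝ)) +
    ((sg n).real Set.univ) ^ (1 / ((n - 1 : ℕ) : ℝ)) * s) ^ (n - 1) ≤ PV K (s + 2 * δ + ε) - PV K (s + δ) := by
    intro ε hε
    obtain ⟨h, H, hc, h1, h2⟩ := approx hne hcv hcp hε
    have hb : Bornology.IsBounded (Kh h) := hcp.isBounded.cthickening.subset h2
    have hlo : ∀ t, PV K t ≤ PV (Kh h) t := fun t => PV_mono hb (Metric.cthickening_subset_of_subset t h1)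
    have hup : ∀ t, 0 ≤ t → PV (Kh h) t ≤ PV K (t + ε) := fun t ht => PV_mono hcp.isBounded
      ((Metric.cthickening_subset_of_subset t h2).trans (cthickening_cthickening ht hε.le K).subset)
    have h0 : 0 ≤ PV (Kh h) δ - PV (Kh h) 0 := by
      rw [PV_sub hb hδ.le]; exact ENNReal.toReal_nonneg
    have hm : max (PV K δ - PV K (0 + ε)) 0 ≤ PV (Kh h) δ - PV (Kh h) 0 :=
      max_le (by linarith [hlo δ, hup 0 le_rfl]) h0
    calc _ ≤ δ * (((PV (Kh h) δ - PV (Kh h) 0) / δ) ^ (1 / ((n - 1 : ℕ) : ℝ)) +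
            ((sg n).real Set.univ) ^ (1 / ((n - 1 : ℕ) : ℝ)) * s) ^ (n - 1) := by gcongr
      _ ≤ _ := ddi_Kh hn H hc hb s δ hs hδ
      _ ≤ _ := by linarith [hlo (s + δ), hup (s + 2 * δ) (by positivity)]
  have h0 : 0 ≤ PV K δ - PV K 0 := by
    rw [PV_sub hcp.isBounded hδ.le]; exact ENNReal.toReal_nonneg
  have hR := (PV_tendsto hcp (t := s + 2 * δ) (by positivity)).sub_const (PV K (s + δ))
  have hL := (((((PV_tendsto hcp (le_refl (0:ℝ))).const_sub (PV K δ)).max (tendsto_const_nhds (x := (0:ℝ)))).div_const δ).rpow_const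
    (p := 1 / ((n - 1 : ℕ) : ℝ)) (Or.inr (by positivity))).add_const (((sg n).real Set.univ) ^ (1 / ((n - 1 : ℕ) : ℝ)) * s)
  have hL := (hL.pow (n - 1)).const_mul δ
  rw [max_eq_left h0] at hL
  refine le_of_tendsto_of_tendsto hL hR ?_
  filter_upwards [self_mem_nhdsWithin] with ε hε using key ε hε
end partC

section partD
variable {n : ℕ}

lemma hm_le {ι : Type*} {d : ℕ} {k : NNReal} {S : Set ι} {α β : ι → En n}
    (h : ∀ p ∈ S, ∀ q ∈ S, dist (α p) (α q) ≤ k * dist (β p) (β q)) :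
    μHE[d] (α '' S) ≤ (k : ENNReal) ^ d * μHE[d] (β '' S) := by
  rcases S.eq_empty_or_nonempty with rfl | ⟨p0, hp0⟩
  · simp
  have : Nonempty ι := ⟨p0⟩
  have hinv : ∀ p ∈ S, β (Function.invFunOn β S (β p)) = β p ∧ Function.invFunOn β S (β p) ∈ S := fun p hp =>
    ⟨Function.invFunOn_eq ⟨p, hp, rfl⟩, Function.invFunOn_mem ⟨p, hp, rfl⟩⟩
  set f : En n → En n := fun z => α (Function.invFunOn β S z)
  have hf : LipschitzOnWith k f (β '' S) := by
    refine LipschitzOnWith.of_dist_le_mul ?_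
    rintro _ ⟨p, hp, rfl⟩ _ ⟨q, hq, rfl⟩
    have := h _ (hinv p hp).2 _ (hinv q hq).2
    rwa [(hinv p hp).1, (hinv q hq).1] at this
  have him : f '' (β '' S) = α '' S := by
    rw [Set.image_image]
    refine Set.image_congr fun p hp => ?_
    have := h _ (hinv p hp).2 _ hp
    rw [(hinv p hp).1, dist_self, mul_zero] at this
    exact dist_le_zero.1 this
  have := hf.hausdorffMeasure_image_le (d := d) (by positivity)
  rw [him] at this
  simp only [Measure.euclideanHausdorffMeasure_def, Measure.smul_apply]
  rw [mul_smul_comm]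
  gcongr
  simpa using this

lemma cyl_vol {N0 : En n} (hN : ‖N0‖ = 1) {A : Set (En n)} (hA : ∀ a ∈ A, inner ℝ N0 a = 0) {s : ℝ}
    (ht : MeasurableSet {z : En n | ∃ a ∈ A, ∃ r ∈ Set.Ioc 0 s, z = a + r • N0}) :
    volume {z : En n | ∃ a ∈ A, ∃ r ∈ Set.Ioc 0 s, z = a + r • N0} = ENNReal.ofReal s * μHE[n - 1] A := by
  have hN0 : N0 ≠ 0 := by rintro rfl; simp at hN
  have hNN : inner ℝ N0 N0 = (1:ℝ) := by rw [real_inner_self_eq_norm_sq, hN]; norm_num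
  have h1 := EuclideanGeometry.euclideanHausdorffMeasure_eq_lintegral (0 : En n) hN0 ht
  rw [finrank_euclideanSpace_fin, EuclideanSpace.euclideanHausdorffMeasure_eq_volume] at h1
  rw [h1, ← ofReal_norm, hN, ENNReal.ofReal_one, one_mul]
  have h2 : ∀ r : ℝ, μHE[n - 1] ({z : En n | ∃ a ∈ A, ∃ r ∈ Set.Ioc 0 s, z = a + r • N0} ∩
      (AffineSubspace.mk' (r • N0 +ᵥ (0 : En n)) (Submodule.span ℝ {N0})ᗮ)) = (Set.Ioc 0 s).indicator (fun _ => μHE[n - 1] A) r := by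
    intro r
    have h3 : ∀ z : En n, z ∈ (AffineSubspace.mk' (r • N0 +ᵥ (0 : En n)) (Submodule.span ℝ {N0})ᗮ) ↔ inner ℝ N0 z = r := by
      intro z
      rw [AffineSubspace.mem_mk', Submodule.mem_orthogonal_singleton_iff_inner_right]
      simp [inner_sub_right, inner_smul_right, hN, sub_eq_zero]
    by_cases hr : r ∈ Set.Ioc 0 s
    · rw [Set.indicator_of_mem hr]
      have : {z : En n | ∃ a ∈ A, ∃ r ∈ Set.Ioc 0 s, z = a + r • N0} ∩
          (AffineSubspace.mk' (r • N0 +ᵥ (0 : En n)) (Submodule.span ℝ {N0})ᗮ) = (fun a => a + r • N0) '' A := by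
        ext z
        simp only [Set.mem_inter_iff, SetLike.mem_coe, h3, Set.mem_image]
        constructor
        · rintro ⟨⟨a, ha, r', hr', rfl⟩, h4⟩
          rw [inner_add_right, hA a ha, inner_smul_right, hNN] at h4
          exact ⟨a, ha, by rw [← h4]; simp⟩
        · rintro ⟨a, ha, rfl⟩
          exact ⟨⟨a, ha, r, hr, rfl⟩, by rw [inner_add_right, hA a ha, inner_smul_right, hNN]; simp⟩
      rw [this]
      exact (IsometryEquiv.addRight (r • N0)).isometry.euclideanHausdorffMeasure_image A
    · rw [Set.indicator_of_notMem hr]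
      convert measure_empty (μ := (μHE[n - 1] : Measure (En n)))
      refine Set.eq_empty_of_forall_notMem fun z ⟨⟨a, ha, r', hr', h5⟩, h4⟩ => ?_
      rw [SetLike.mem_coe, h3, h5, inner_add_right, hA a ha, inner_smul_right, hNN] at h4
      apply hr; rw [← h4]; simpa using hr'
  simp_rw [h2]
  rw [lintegral_indicator measurableSet_Ioc, lintegral_const]
  simp [mul_comm]

structure Reg (K : Set (En n)) (N : En n → En n) (L : NNReal) : Prop where
  cp : IsCompact K
  cv : Convex ℝ K
  ne : K.Nonempty
  un : ∀ x ∈ frontier K, ‖N x‖ = 1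
  lip : LipschitzWith L N
  half : ∀ x ∈ frontier K, ∀ q ∈ K, inner ℝ (q - x) (N x) ≤ 0
  proj : ∀ y ∉ K, ∃ x ∈ frontier K, ∃ r : ℝ, 0 < r ∧ y = x + r • N x

variable {K : Set (En n)} {N : En n → En n} {L : NNReal}

namespace Reg
lemma frK (R : Reg K N L) {x : En n} (hx : x ∈ frontier K) : x ∈ K := R.cp.isClosed.frontier_subset hx

lemma dist_tube (R : Reg K N L) {x : En n} (hx : x ∈ frontier K) {r : ℝ} (hr : 0 ≤ r) :
    Metric.infDist (x + r • N x) K = r := by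
  rw [infDist_normal (R.frK hx) fun q hq => by
    rw [inner_smul_right]; exact mul_nonpos_of_nonneg_of_nonpos hr (R.half x hx q hq)]
  rw [norm_smul, R.un x hx, Real.norm_of_nonneg hr, mul_one]

def pj (R : Reg K N L) (y : En n) : En n := (exists_proj R.ne R.cp.isClosed R.cv y).choose
lemma pj_mem (R : Reg K N L) (y : En n) : R.pj y ∈ K := (exists_proj R.ne R.cp.isClosed R.cv y).choose_spec.1
lemma pj_spec (R : Reg K N L) (y : En n) : ∀ q ∈ K, inner ℝ (q - R.pj y) (y - R.pj y) ≤ 0 :=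
  (exists_proj R.ne R.cp.isClosed R.cv y).choose_spec.2

lemma proj_lip {p p' y y' : En n} (hp : p ∈ K) (hp' : p' ∈ K) (h : ∀ q ∈ K, inner ℝ (q - p) (y - p) ≤ 0)
    (h' : ∀ q ∈ K, inner ℝ (q - p') (y' - p') ≤ 0) : dist p p' ≤ dist y y' := by
  have h1 := h p' hp'
  have h2 := h' p hp
  have h3 : ‖p - p'‖ ^ 2 ≤ inner ℝ (p - p') (y - y') := by
    rw [← real_inner_self_eq_norm_sq]
    have e1 : inner ℝ (p' - p) (y - p) = - inner ℝ (p - p') (y - p) := by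
      rw [← inner_neg_left, neg_sub]
    rw [e1] at h1
    simp only [inner_sub_right] at *
    linarith
  rw [dist_eq_norm, dist_eq_norm]
  have h4 := real_inner_le_norm (p - p') (y - y')
  rcases (norm_nonneg (p - p')).eq_or_lt with h0 | h0
  · rw [← h0]; positivity
  · nlinarith

lemma pj_lip (R : Reg K N L) : LipschitzWith 1 R.pj := LipschitzWith.of_dist_le_mul fun y y' => by
  simpa using proj_lip (R.pj_mem y) (R.pj_mem y') (R.pj_spec y) (R.pj_spec y')

lemma pj_tube (R : Reg K N L) {x : En n} (hx : x ∈ frontier K) {r : ℝ} (hr : 0 ≤ r) : R.pj (x + r • N x) = x := by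
  refine dist_le_zero.1 ((proj_lip (y' := x + r • N x) (R.pj_mem _) (R.frK hx) (R.pj_spec _) fun q hq => ?_).trans (dist_self _).le)
  rw [add_sub_cancel_left, inner_smul_right]
  exact mul_nonpos_of_nonneg_of_nonpos hr (R.half x hx q hq)

def sh (K : Set (En n)) (a b : ℝ) : Set (En n) := Metric.cthickening b K \ Metric.cthickening a K

lemma mem_sh (R : Reg K N L) {a b : ℝ} (ha : 0 ≤ a) {y : En n} :
    y ∈ sh K a b ↔ ∃ x ∈ frontier K, ∃ r ∈ Set.Ioc a b, y = x + r • N x := by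
  rcases lt_or_ge b a with hba | hab
  · simp only [Set.Ioc_eq_empty (not_lt.2 hba.le), Set.mem_empty_iff_false, false_and, exists_false, and_false, iff_false]
    exact fun h => h.2 (Metric.cthickening_mono hba.le K h.1)
  rw [sh, Set.mem_sdiff, mem_cth R.ne ha, mem_cth R.ne (ha.trans hab), not_le]
  constructor
  · rintro ⟨h1, h2⟩
    have : y ∉ K := fun h => by rw [Metric.infDist_zero_of_mem h] at h2; linarith
    obtain ⟨x, hx, r, hr, rfl⟩ := R.proj y this
    rw [R.dist_tube hx hr.le] at h1 h2
    exact ⟨x, hx, r, ⟨h2, h1⟩, rfl⟩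
  · rintro ⟨x, hx, r, hr, rfl⟩
    rw [R.dist_tube hx (ha.trans hr.1.le)]; exact ⟨hr.2, hr.1⟩

def tb (N : En n → En n) (E : Set (En n)) (s : ℝ) : Set (En n) := (fun p : En n × ℝ => p.1 + p.2 • N p.1) '' (E ×ˢ Set.Ioc 0 s)

lemma tb_eq (R : Reg K N L) {E : Set (En n)} (hE : E ⊆ frontier K) (s : ℝ) : tb N E s = sh K 0 s ∩ R.pj ⁻¹' E := by
  ext y
  rw [Set.mem_inter_iff, R.mem_sh le_rfl]
  constructor
  · rintro ⟨⟨x, r⟩, ⟨hx, hr⟩, rfl⟩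
    exact ⟨⟨x, hE hx, r, hr, rfl⟩, by rw [Set.mem_preimage, R.pj_tube (hE hx) hr.1.le]; exact hx⟩
  · rintro ⟨⟨x, hx, r, hr, rfl⟩, h⟩
    rw [Set.mem_preimage, R.pj_tube hx hr.1.le] at h
    exact ⟨(x, r), ⟨h, hr⟩, rfl⟩

lemma inner_small (R : Reg K N L) {x0 x x' : En n} {ρ : ℝ} (hx : x ∈ frontier K) (hx' : x' ∈ frontier K)
    (hd : dist x x0 ≤ ρ) (hd' : dist x' x0 ≤ ρ) : |inner ℝ (N x0) (x - x')| ≤ L * ρ * ‖x - x'‖ := by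
  have a1 := R.half x hx x' (R.frK hx')
  have a2 := R.half x' hx' x (R.frK hx)
  have b1 := (R.lip.dist_le_mul x x0).trans (mul_le_mul_of_nonneg_left hd L.2)
  have b2 := (R.lip.dist_le_mul x' x0).trans (mul_le_mul_of_nonneg_left hd' L.2)
  rw [dist_eq_norm] at b1 b2
  have c1 := (abs_real_inner_le_norm (N x - N x0) (x - x')).trans (mul_le_mul_of_nonneg_right b1 (norm_nonneg _))
  have c2 := (abs_real_inner_le_norm (N x' - N x0) (x - x')).trans (mul_le_mul_of_nonneg_right b2 (norm_nonneg _))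
  rw [abs_le] at *
  rw [← neg_sub x x', inner_neg_left, real_inner_comm] at a1
  rw [real_inner_comm] at a2
  simp only [inner_sub_left] at c1 c2
  constructor <;> linarith [c1.1, c1.2, c2.1, c2.2]

def PN (N0 x : En n) : En n := x - (inner ℝ N0 x) • N0

lemma local_cmp (R : Reg K N L) {x0 : En n} (hx0 : x0 ∈ frontier K) {k : NNReal} (hk : 1 < k) :
    ∃ ρ > 0, ∀ E : Set (En n), MeasurableSet E → E ⊆ frontier K ∩ Metric.ball x0 ρ → ∀ s ∈ Set.Ioo 0 ρ,
      volume (tb N E s) ≤ (k : ENNReal) ^ (2 * n) * (ENNReal.ofReal s * μHE[n - 1] E) ∧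
      ENNReal.ofReal s * μHE[n - 1] E ≤ (k : ENNReal) ^ (2 * n) * volume (tb N E s) := by
  have hk' : (1:ℝ) < k := by exact_mod_cast hk
  have hkp : (0:ℝ) < k := by linarith
  have hc : 0 < 1 - 1 / (k:ℝ) := by rw [sub_pos, div_lt_one hkp]; exact hk'
  have hck : (1 - 1 / (k:ℝ)) * k = k - 1 := by field_simp
  obtain ⟨ρ, hρ, hLρ⟩ : ∃ ρ : ℝ, 0 < ρ ∧ 12 * (L * ρ) ≤ (1 - 1 / (k:ℝ)) := by
    have hL : (0:ℝ) ≤ L := L.2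
    refine ⟨(1 - 1 / (k:ℝ)) / (12 * (L + 1)), by positivity, ?_⟩
    rw [mul_div_assoc', mul_div_assoc', div_le_iff₀ (by positivity)]; nlinarith
  have hLρ0 : 0 ≤ L * ρ := mul_nonneg L.2 hρ.le
  have hc1 : 1 - 1 / (k:ℝ) ≤ 1 := by have : 0 < 1 / (k:ℝ) := by positivity
                                     linarith
  refine ⟨ρ, hρ, fun E hEm hE s hs => ?_⟩
  set N0 := N x0
  have hN : ‖N0‖ = 1 := R.un x0 hx0
  have hNN : inner ℝ N0 N0 = (1:ℝ) := by rw [real_inner_self_eq_norm_sq, hN]; norm_num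
  have hPo : ∀ x, inner ℝ N0 (PN N0 x) = 0 := fun x => by
    rw [PN, inner_sub_right, inner_smul_right, hNN]; ring
  have hPs : ∀ x x', PN N0 x - PN N0 x' = PN N0 (x - x') := fun x x' => by
    simp only [PN, inner_sub_right, sub_smul]; abel
  have hPn : ∀ x, ‖x‖ ≤ ‖PN N0 x‖ + |inner ℝ N0 x| := fun x => by
    calc ‖x‖ = ‖PN N0 x + (inner ℝ N0 x) • N0‖ := by simp [PN]
      _ ≤ _ := (norm_add_le _ _).trans (by rw [norm_smul, hN, mul_one, Real.norm_eq_abs])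
  have hpy : ∀ x (r : ℝ), ‖PN N0 x + r • N0‖ ^ 2 = ‖PN N0 x‖ ^ 2 + r ^ 2 := fun x r => by
    rw [norm_add_sq_real, inner_smul_right, real_inner_comm, hPo, norm_smul, hN, mul_one, Real.norm_eq_abs, sq_abs]; ring
  have hP1 : ∀ x, ‖PN N0 x‖ ≤ ‖x‖ := fun x => by
    have := hpy x (inner ℝ N0 x)
    rw [show PN N0 x + (inner ℝ N0 x) • N0 = x by simp [PN]] at this
    exact (sq_le_sq₀ (norm_nonneg _) (norm_nonneg _)).1 (by nlinarith [sq_nonneg (inner ℝ N0 x : ℝ)])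
  -- comparison of x and Px
  have hxP : ∀ x ∈ E, ∀ x' ∈ E, dist x x' ≤ k * dist (PN N0 x) (PN N0 x') := by
    intro x hx x' hx'
    have h1 := R.inner_small (hE hx).1 (hE hx').1 (hE hx).2.le (hE hx').2.le
    have h2 := hPn (x - x')
    rw [dist_eq_norm, dist_eq_norm, hPs]
    have h3 : ‖x - x'‖ ≤ ‖PN N0 (x - x')‖ + (1 - 1 / k) * ‖x - x'‖ := by
      nlinarith [norm_nonneg (x - x')]
    have h4 : 1 / (k:ℝ) * ‖x - x'‖ ≤ ‖PN N0 (x - x')‖ := by linarith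
    rw [div_mul_eq_mul_div, one_mul, div_le_iff₀ hkp] at h4; linarith
  set α : En n × ℝ → En n := fun p => p.1 + p.2 • N p.1 with hα
  set β : En n × ℝ → En n := fun p => PN N0 p.1 + p.2 • N0 with hβ
  have herr : ∀ p ∈ E ×ˢ Set.Ioc 0 s, ∀ q ∈ E ×ˢ Set.Ioc 0 s,
      ‖(α p - α q) - (β p - β q)‖ ≤ (1 - 1 / k) * dist (β p) (β q) := by
    rintro ⟨x, r⟩ ⟨hx, hr⟩ ⟨x', r'⟩ ⟨hx', hr'⟩
    simp only at hx hx' hr hr'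
    have h1 := R.inner_small (hE hx).1 (hE hx').1 (hE hx).2.le (hE hx').2.le
    have hD : ‖x - x'‖ ≤ 2 * ‖PN N0 (x - x')‖ := by
      have := hPn (x - x')
      nlinarith [norm_nonneg (x - x')]
    have eβ : β (x, r) - β (x', r') = PN N0 (x - x') + (r - r') • N0 := by
      simp only [β, ← hPs, sub_smul]; abel
    have hA : ‖PN N0 (x - x')‖ ≤ dist (β (x, r)) (β (x', r')) ∧ |r - r'| ≤ dist (β (x, r)) (β (x', r')) := by
      rw [dist_eq_norm, eβ]
      have := hpy (x - x') (r - r')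
      constructor
      · exact (sq_le_sq₀ (norm_nonneg _) (norm_nonneg _)).1 (by nlinarith [sq_nonneg (r - r')])
      · exact (sq_le_sq₀ (abs_nonneg _) (norm_nonneg _)).1 (by rw [sq_abs]; nlinarith [sq_nonneg ‖PN N0 (x - x')‖])
    have e : (α (x, r) - α (x', r')) - (β (x, r) - β (x', r')) =
        (inner ℝ N0 (x - x')) • N0 + r • (N x - N x') + (r - r') • (N x' - N0) := by
      rw [eβ]; simp only [α, PN, smul_sub, sub_smul]; abel
    rw [e]
    have l1 := R.lip.dist_le_mul x x'
    have l2 := (R.lip.dist_le_mul x' x0).trans (mul_le_mul_of_nonneg_left (hE hx').2.le L.2)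
    rw [dist_eq_norm, dist_eq_norm] at l1
    rw [dist_eq_norm] at l2
    have t1 : ‖(inner ℝ N0 (x - x')) • N0‖ ≤ L * ρ * ‖x - x'‖ := by
      rw [norm_smul, hN, mul_one]; exact h1
    have t2 : ‖r • (N x - N x')‖ ≤ L * ρ * ‖x - x'‖ := by
      rw [norm_smul, Real.norm_of_nonneg hr.1.le]
      calc r * ‖N x - N x'‖ ≤ ρ * (L * ‖x - x'‖) := mul_le_mul (hr.2.trans hs.2.le) l1 (norm_nonneg _) hρ.le
        _ = _ := by ring
    have t3 : ‖(r - r') • (N x' - N0)‖ ≤ |r - r'| * (L * ρ) := by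
      rw [norm_smul, Real.norm_eq_abs]; exact mul_le_mul_of_nonneg_left l2 (abs_nonneg _)
    refine (norm_add₃_le).trans ?_
    have hd0 : 0 ≤ dist (β (x, r)) (β (x', r')) := dist_nonneg
    have m1 : L * ρ * ‖x - x'‖ ≤ L * ρ * (2 * dist (β (x, r)) (β (x', r'))) :=
      mul_le_mul_of_nonneg_left (by linarith [hA.1]) hLρ0
    have m2 := mul_le_mul_of_nonneg_right hA.2 hLρ0
    nlinarith
  have hab : ∀ p ∈ E ×ˢ Set.Ioc 0 s, ∀ q ∈ E ×ˢ Set.Ioc 0 s, dist (α p) (α q) ≤ k * dist (β p) (β q) := by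
    intro p hp q hq
    have h1 := herr p hp q hq
    have h2 : ‖α p - α q‖ ≤ ‖β p - β q‖ + ‖(α p - α q) - (β p - β q)‖ := by
      simpa using norm_add_le (β p - β q) ((α p - α q) - (β p - β q))
    have h3 : 1 + (1 - 1 / (k:ℝ)) ≤ k := by nlinarith
    rw [dist_eq_norm] at *
    nlinarith [dist_nonneg (x := β p) (y := β q), dist_eq_norm (β p) (β q), norm_nonneg (β p - β q)]
  have hba : ∀ p ∈ E ×ˢ Set.Ioc 0 s, ∀ q ∈ E ×ˢ Set.Ioc 0 s, dist (β p) (β q) ≤ k * dist (α p) (α q) := by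
    intro p hp q hq
    have h1 := herr p hp q hq
    have h2 : ‖β p - β q‖ ≤ ‖α p - α q‖ + ‖(α p - α q) - (β p - β q)‖ := by
      simpa using norm_sub_le (α p - α q) ((α p - α q) - (β p - β q))
    have h4 : 1 / (k:ℝ) * dist (β p) (β q) ≤ dist (α p) (α q) := by
      rw [dist_eq_norm] at *; rw [dist_eq_norm]; linarith
    rw [div_mul_eq_mul_div, one_mul, div_le_iff₀ hkp] at h4; linarith
  -- measures
  have hβc : Continuous β := by
    simp only [β, PN]; fun_prop
  have hβset : β '' (E ×ˢ Set.Ioc 0 s) = {z : En n | ∃ a ∈ PN N0 '' E, ∃ r ∈ Set.Ioc 0 s, z = a + r • N0} := by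
    ext z; constructor
    · rintro ⟨⟨x, r⟩, ⟨hx, hr⟩, rfl⟩; exact ⟨_, ⟨x, hx, rfl⟩, r, hr, rfl⟩
    · rintro ⟨_, ⟨x, hx, rfl⟩, r, hr, rfl⟩; exact ⟨(x, r), ⟨hx, hr⟩, rfl⟩
  have hβm : MeasurableSet (β '' (E ×ˢ Set.Ioc 0 s)) := by
    refine (hEm.prod measurableSet_Ioc).image_of_continuousOn_injOn hβc.continuousOn fun p hp q hq hpq => ?_
    have : dist (α p) (α q) ≤ 0 := by simpa [hpq] using hab p hp q hq
    have e1 := dist_le_zero.1 this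
    have hp1 := (hE hp.1).1
    have hq1 := (hE hq.1).1
    have e2 : p.1 = q.1 := by
      rw [← R.pj_tube hp1 hp.2.1.le, ← R.pj_tube hq1 hq.2.1.le]; exact congrArg _ e1
    have e3 : p.2 = q.2 := by
      rw [← R.dist_tube hp1 hp.2.1.le, ← R.dist_tube hq1 hq.2.1.le]; exact congrArg (Metric.infDist · K) e1
    exact Prod.ext e2 e3
  have hv : volume (β '' (E ×ˢ Set.Ioc 0 s)) = ENNReal.ofReal s * μHE[n - 1] (PN N0 '' E) := by
    rw [hβset] at hβm ⊢
    exact cyl_vol hN (by rintro _ ⟨x, -, rfl⟩; exact hPo x) hβm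
  have v1 := hm_le (d := n) hab
  have v2 := hm_le (d := n) hba
  rw [EuclideanSpace.euclideanHausdorffMeasure_eq_volume, hv] at v1 v2
  have v3 := hm_le (d := n - 1) (S := E) (α := fun x => x) (β := PN N0) (k := k) hxP
  have v4 := hm_le (d := n - 1) (S := E) (β := fun x => x) (α := PN N0) (k := 1) fun x _ x' _ => by
    rw [dist_eq_norm, dist_eq_norm, hPs]; simpa using hP1 _
  rw [Set.image_id'] at v3 v4
  have hk1 : (1 : ENNReal) ≤ k := by exact_mod_cast hk.le
  constructor
  · calc volume (tb N E s) ≤ _ := v1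
      _ ≤ (k : ENNReal) ^ (2 * n) * (ENNReal.ofReal s * μHE[n - 1] E) := by
        refine mul_le_mul' (pow_le_pow_right₀ hk1 (by omega)) (mul_le_mul' le_rfl (by simpa using v4))
  · calc ENNReal.ofReal s * μHE[n - 1] E ≤ ENNReal.ofReal s * ((k : ENNReal) ^ (n - 1) * μHE[n - 1] (PN N0 '' E)) := by gcongr
      _ = (k : ENNReal) ^ (n - 1) * (ENNReal.ofReal s * μHE[n - 1] (PN N0 '' E)) := by ring
      _ ≤ (k : ENNReal) ^ n * ((k : ENNReal) ^ n * volume (tb N E s)) := by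
        refine mul_le_mul' (pow_le_pow_right₀ hk1 (by omega)) v2
      _ = _ := by ring
end Reg
end partD

section partD2
variable {n : ℕ} {K : Set (En n)} {N : En n → En n} {L : NNReal}
namespace Reg

lemma sh_meas (a b : ℝ) : MeasurableSet (sh K a b) :=
  Metric.isClosed_cthickening.measurableSet.diff Metric.isClosed_cthickening.measurableSet

lemma sh_fin (R : Reg K N L) (a b : ℝ) : volume (sh K a b) ≠ ⊤ :=
  ((measure_mono Set.sdiff_subset).trans_lt (cth_fin R.cp.isBounded b).lt_top).ne

def nu (R : Reg K N L) (s : ℝ) : Measure (En n) := (volume.restrict (sh K 0 s)).map R.pj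

lemma nu_apply (R : Reg K N L) (s : ℝ) {E : Set (En n)} (hm : MeasurableSet E) :
    R.nu s E = volume (tb N (E ∩ frontier K) s) := by
  have hpm := R.pj_lip.continuous.measurable
  rw [nu, Measure.map_apply hpm hm, Measure.restrict_apply (hpm hm),
    R.tb_eq Set.inter_subset_right, Set.inter_comm]
  congr 1
  ext y
  simp only [Set.mem_inter_iff, Set.mem_preimage]
  refine ⟨fun ⟨h1, h2⟩ => ⟨h1, h2, ?_⟩, fun ⟨h1, h2, _⟩ => ⟨h1, h2⟩⟩
  obtain ⟨x, hx, r, hr, rfl⟩ := (R.mem_sh le_rfl).1 h1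
  rw [R.pj_tube hx hr.1.le]; exact hx

lemma nu_fin (R : Reg K N L) (s : ℝ) : IsFiniteMeasure (R.nu s) := by
  have : IsFiniteMeasure (volume.restrict (sh K 0 s)) := ⟨by simpa using (R.sh_fin 0 s).lt_top⟩
  unfold nu; infer_instance

lemma fin_cover {μ ν : Measure (En n)} {t : Finset (En n)} {U : En n → Set (En n)} (hU : ∀ x, MeasurableSet (U x))
    (h : ∀ x ∈ t, ∀ E, MeasurableSet E → E ⊆ U x → μ E ≤ ν E) :
    ∀ E, MeasurableSet E → E ⊆ ⋃ x ∈ t, U x → μ E ≤ ν E := by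
  induction t using Finset.induction_on with
  | empty => intro E _ hE; simp at hE; simp [hE]
  | insert x t hx ih =>
    intro E hEm hE
    rw [← measure_inter_add_sdiff E (hU x) , ← measure_inter_add_sdiff (μ := ν) E (hU x)]
    refine add_le_add (h x (by simp) _ (hEm.inter (hU x)) Set.inter_subset_right)
      (ih (fun y hy => h y (by simp [hy])) _ (hEm.diff (hU x)) fun y hy => ?_)
    have := hE hy.1
    simp only [Finset.mem_insert, Set.mem_iUnion, exists_prop] at this ⊢
    obtain ⟨z, rfl | hz, hyz⟩ := this
    · exact absurd hyz hy.2
    · exact ⟨z, hz, hyz⟩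

lemma fr_meas : MeasurableSet (frontier K) := isClosed_frontier.measurableSet

lemma global_cmp (R : Reg K N L) {k : NNReal} (hk : 1 < k) : ∀ᶠ s : ℝ in 𝓝[>] 0,
    R.nu s ≤ ((k : ENNReal) ^ (2 * n) * ENNReal.ofReal s) • (μHE[n - 1]).restrict (frontier K) ∧
    ENNReal.ofReal s • (μHE[n - 1]).restrict (frontier K) ≤ ((k : ENNReal) ^ (2 * n)) • R.nu s := by
  have hloc : ∀ x : En n, ∃ ρ > 0, x ∈ frontier K → ∀ E : Set (En n), MeasurableSet E → E ⊆ frontier K ∩ Metric.ball x ρ → ∀ s ∈ Set.Ioo 0 ρ,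
      volume (tb N E s) ≤ (k : ENNReal) ^ (2 * n) * (ENNReal.ofReal s * μHE[n - 1] E) ∧
      ENNReal.ofReal s * μHE[n - 1] E ≤ (k : ENNReal) ^ (2 * n) * volume (tb N E s) := by
    intro x
    by_cases hx : x ∈ frontier K
    · obtain ⟨ρ, h1, h2⟩ := R.local_cmp hx hk; exact ⟨ρ, h1, fun _ => h2⟩
    · exact ⟨1, one_pos, fun h => absurd h hx⟩
  choose ρ hρ hl using hloc
  have hfc : IsCompact (frontier K) := R.cp.of_isClosed_subset isClosed_frontier R.cp.isClosed.frontier_subset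
  obtain ⟨t, ht, hcov⟩ := hfc.elim_nhds_subcover (fun x => Metric.ball x (ρ x)) fun x _ => Metric.ball_mem_nhds x (hρ x)
  have hev : ∀ᶠ s : ℝ in 𝓝[>] 0, ∀ x ∈ t, s < ρ x := by
    rw [Finset.eventually_all]
    exact fun x _ => nhdsWithin_le_nhds (eventually_lt_nhds (hρ x))
  filter_upwards [hev, self_mem_nhdsWithin] with s hs h0
  have hst : ∀ E : Set (En n), E ∩ frontier K ⊆ ⋃ x ∈ t, Metric.ball x (ρ x) := fun E => Set.inter_subset_right.trans hcov
  have hloc : ∀ x ∈ t, ∀ E, MeasurableSet E → E ⊆ Metric.ball x (ρ x) →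
     volume (tb N (E ∩ frontier K) s) ≤ (k : ENNReal) ^ (2 * n) * (ENNReal.ofReal s * μHE[n - 1] (E ∩ frontier K)) ∧
      ENNReal.ofReal s * μHE[n - 1] (E ∩ frontier K) ≤ (k : ENNReal) ^ (2 * n) * volume (tb N (E ∩ frontier K) s) := fun x hx E hEm hE =>
    hl x (ht x hx) _ (hEm.inter fr_meas) (fun y hy => ⟨hy.2, hE hy.1⟩) s ⟨h0, hs x hx⟩
  have hnull : R.nu s (frontier K)ᶜ = 0 := by
    rw [R.nu_apply s fr_meas.compl]; simp [tb]
  constructor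
  · refine Measure.le_iff.2 fun E hE => ?_
    rw [← measure_inter_add_sdiff E (fr_meas (K := K)), measure_mono_null (show E \ frontier K ⊆ (frontier K)ᶜ from fun y hy => hy.2) hnull, add_zero]
    refine (fin_cover (t := t) (fun x => Metric.isOpen_ball.measurableSet) (fun x hx E hEm hEx => ?_) _ (hE.inter fr_meas) (hst E)).trans (measure_mono Set.inter_subset_left)
    rw [R.nu_apply s hEm, Measure.smul_apply, Measure.restrict_apply hEm, smul_eq_mul, mul_assoc]
    exact (hloc x hx E hEm hEx).1
  · refine Measure.le_iff.2 fun E hE => ?_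
    have e : (ENNReal.ofReal s • (μHE[n - 1]).restrict (frontier K)) E = (ENNReal.ofReal s • (μHE[n - 1]).restrict (frontier K)) (E ∩ frontier K) := by
      simp only [Measure.smul_apply, Measure.restrict_apply hE, Measure.restrict_apply (hE.inter fr_meas), Set.inter_assoc, Set.inter_self]
    rw [e]
    refine (fin_cover (t := t) (fun x => Metric.isOpen_ball.measurableSet) (fun x hx E hEm hEx => ?_) _ (hE.inter fr_meas) (hst E)).trans (measure_mono Set.inter_subset_left)
    rw [Measure.smul_apply, Measure.smul_apply, R.nu_apply s hEm, Measure.restrict_apply hEm, smul_eq_mul, smul_eq_mul]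
    exact (hloc x hx E hEm hEx).2

abbrev mS (K : Set (En n)) : Measure (En n) := (μHE[n - 1]).restrict (frontier K)

lemma mS_fin (R : Reg K N L) : IsFiniteMeasure (mS K) := by
  obtain ⟨s, h, h0⟩ := ((R.global_cmp (k := 2) (by norm_num)).and self_mem_nhdsWithin).exists
  have h1 := h.2 Set.univ
  have := R.nu_fin s
  have h0 : 0 < s := h0
  refine ⟨?_⟩
  by_contra hcon
  rw [not_lt, top_le_iff] at hcon
  rw [Measure.smul_apply, hcon, smul_eq_mul, ENNReal.mul_top (by simpa using h0), top_le_iff, Measure.smul_apply, smul_eq_mul] at h1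
  exact (ENNReal.mul_lt_top (by simp) (measure_lt_top _ _)).ne h1

lemma cont_int {μ : Measure (En n)} [IsFiniteMeasure μ] {C : Set (En n)} (hC : IsCompact C) (hm : μ Cᶜ = 0) {g : En n → ℝ} (hg : Continuous g) :
    Integrable g μ := by
  obtain ⟨M, hM⟩ := hC.exists_bound_of_continuousOn hg.continuousOn
  refine Integrable.of_bound hg.aestronglyMeasurable M ?_
  filter_upwards [show ∀ᵐ x ∂μ, x ∈ C from hm] with x hx using hM x hx

lemma nu_null (R : Reg K N L) (s : ℝ) : R.nu s (frontier K)ᶜ = 0 := by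
  rw [R.nu_apply s fr_meas.compl]; simp [tb]

lemma fr_cp (R : Reg K N L) : IsCompact (frontier K) :=
  R.cp.of_isClosed_subset isClosed_frontier R.cp.isClosed.frontier_subset

lemma mS_int (R : Reg K N L) {g : En n → ℝ} (hg : Continuous g) : Integrable g (mS K) := by
  have := R.mS_fin
  exact cont_int R.fr_cp (by simp [Measure.restrict_apply fr_meas.compl]) hg

lemma nu_int (R : Reg K N L) (s : ℝ) {g : En n → ℝ} (hg : Continuous g) : Integrable g (R.nu s) := by
  have := R.nu_fin s
  exact cont_int R.fr_cp (R.nu_null s) hg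

lemma nu_tendsto_nonneg (R : Reg K N L) {g : En n → ℝ} (hg : Continuous g) (h0 : ∀ x ∈ frontier K, 0 ≤ g x) :
    Tendsto (fun s => s⁻¹ * ∫ x, g x ∂(R.nu s)) (𝓝[>] 0) (𝓝 (∫ x, g x ∂(mS K))) := by
  have hae : 0 ≤ᵐ[mS K] g := by
    filter_upwards [ae_restrict_mem fr_meas] with x hx using h0 x hx
  have hae' : ∀ s, 0 ≤ᵐ[R.nu s] g := fun s => by
    filter_upwards [show ∀ᵐ x ∂(R.nu s), x ∈ frontier K from R.nu_null s] with x hx using h0 x hx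
  set I := ∫ x, g x ∂(mS K)
  have key : ∀ k : NNReal, 1 < k → ∀ᶠ s : ℝ in 𝓝[>] 0, s⁻¹ * ∫ x, g x ∂(R.nu s) ≤ (k:ℝ) ^ (2 * n) * I ∧
      I / (k:ℝ) ^ (2 * n) ≤ s⁻¹ * ∫ x, g x ∂(R.nu s) := by
    intro k hk
    filter_upwards [R.global_cmp hk, self_mem_nhdsWithin] with s hs hs0
    have hs0 : 0 < s := hs0
    have hkp : (0:ℝ) < k := by exact_mod_cast (zero_lt_one.trans hk)
    have a1 := integral_mono_measure hs.1 ((hae.filter_mono (Measure.ae_smul_measure_le _)))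
      ((R.mS_int hg).smul_measure (ENNReal.mul_ne_top (by simp) (by simp)))
    have a2 := integral_mono_measure hs.2 (((hae' s).filter_mono (Measure.ae_smul_measure_le _)))
      ((R.nu_int s hg).smul_measure (by simp))
    rw [integral_smul_measure] at a1 a2
    rw [integral_smul_measure] at a2
    simp only [ENNReal.toReal_mul, ENNReal.toReal_pow, ENNReal.coe_toReal, ENNReal.toReal_ofReal hs0.le, smul_eq_mul] at a1 a2
    constructor
    · rw [inv_mul_le_iff₀ hs0]; linarith
    · rw [div_le_iff₀ (by positivity), mul_assoc, ← div_eq_inv_mul, le_div_iff₀ hs0]; linarith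
  have hcont : ∀ {F : ℝ → ℝ} {p : ℝ → Prop}, ContinuousAt F 1 → (∀ᶠ y in 𝓝 (F 1), p y) → ∃ k : NNReal, 1 < k ∧ p (F k) := by
    intro F p hF hp
    have := (hF.eventually hp).filter_mono (nhdsWithin_le_nhds (s := Set.Ioi (1:ℝ)))
    obtain ⟨k, hk, hk1⟩ := (this.and self_mem_nhdsWithin).exists
    have hk1 : 1 < k := hk1
    exact ⟨⟨k, by linarith⟩, by exact_mod_cast hk1, hk⟩
  refine tendsto_order.2 ⟨fun u hu => ?_, fun u hu => ?_⟩
  · obtain ⟨k, hk, h1⟩ := hcont (F := fun k => I / k ^ (2 * n)) (p := fun y => u < y)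
      (ContinuousAt.div continuousAt_const (by fun_prop) (by simp)) (eventually_gt_nhds (by simpa using hu))
    filter_upwards [key k hk] with s hs using h1.trans_le hs.2
  · obtain ⟨k, hk, h1⟩ := hcont (F := fun k => k ^ (2 * n) * I) (p := fun y => y < u)
      (by fun_prop) (eventually_lt_nhds (by simpa using hu))
    filter_upwards [key k hk] with s hs using hs.1.trans_lt h1

lemma nu_tendsto (R : Reg K N L) {g : En n → ℝ} (hg : Continuous g) :
    Tendsto (fun s => s⁻¹ * ∫ x, g x ∂(R.nu s)) (𝓝[>] 0) (𝓝 (∫ x, g x ∂(mS K))) := by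
  obtain ⟨M, hM⟩ := R.fr_cp.exists_bound_of_continuousOn hg.continuousOn
  have h1 := R.nu_tendsto_nonneg (g := fun x => g x + |M|) (by fun_prop) fun x hx => by
    have := (abs_le.1 ((hM x hx).trans (le_abs_self M))).1; linarith
  have h2 := R.nu_tendsto_nonneg (g := fun _ => |M|) (by fun_prop) fun x hx => abs_nonneg M
  have h3 := h1.sub h2
  have := R.mS_fin
  rw [integral_add (R.mS_int hg) (integrable_const _), add_sub_cancel_right] at h3
  refine h3.congr fun s => ?_
  have := R.nu_fin s
  rw [integral_add (R.nu_int s hg) (integrable_const _)]; ring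

lemma sh_tendsto (R : Reg K N L) {f : En n → ℝ} (hf : Continuous f) :
    Tendsto (fun s => s⁻¹ * ∫ y in sh K 0 s, f y) (𝓝[>] 0) (𝓝 (∫ x, f x ∂(mS K))) := by
  have hpc := R.pj_lip.continuous
  have h1 := R.nu_tendsto hf
  have e1 : ∀ s, ∫ x, f x ∂(R.nu s) = ∫ y in sh K 0 s, f (R.pj y) := fun s => by
    rw [nu, integral_map hpc.measurable.aemeasurable hf.aestronglyMeasurable]
  have hI : ∀ s, ∀ g : En n → ℝ, Continuous g → IntegrableOn g (sh K 0 s) := fun s g hg =>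
    (hg.continuousOn.integrableOn_compact (R.cp.cthickening (r := s))).mono_set Set.sdiff_subset
  have h2 : Tendsto (fun s => s⁻¹ * (∫ y in sh K 0 s, f y) - s⁻¹ * ∫ x, f x ∂(R.nu s)) (𝓝[>] 0) (𝓝 0) := by
    have hA := R.nu_tendsto (g := fun _ => (1:ℝ)) continuous_const
    set A := ∫ x, (1:ℝ) ∂(mS K)
    have hA0 : 0 ≤ A := integral_nonneg fun _ => zero_le_one
    have hu := (R.cp.cthickening (r := 1)).uniformContinuousOn_of_continuous hf.continuousOn
    rw [Metric.uniformContinuousOn_iff] at hu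
    rw [Metric.tendsto_nhds]
    intro ε hε
    obtain ⟨δ, hδ, hδ2⟩ := hu (ε / (A + 2)) (by positivity)
    filter_upwards [self_mem_nhdsWithin, nhdsWithin_le_nhds (eventually_lt_nhds hδ), nhdsWithin_le_nhds (eventually_lt_nhds (zero_lt_one (α := ℝ))),
      hA.eventually_lt_const (show A < A + 1 by linarith)] with s hs0 hsδ hs1 hsA
    have hs0 : 0 < s := hs0
    rw [dist_zero_right, ← mul_sub, e1, ← integral_sub (hI s f hf) (hI s (fun y => f (R.pj y)) (hf.comp hpc)), norm_mul, Real.norm_of_nonneg (by positivity)]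
    have b := norm_setIntegral_le_of_norm_le_const (μ := volume) (s := sh K 0 s) (f := fun y => f y - f (R.pj y)) (C := ε / (A + 2)) (R.sh_fin 0 s).lt_top fun y hy => by
      obtain ⟨x, hx, r, hr, rfl⟩ := (R.mem_sh le_rfl).1 hy
      rw [R.pj_tube hx hr.1.le, ← dist_eq_norm]
      refine (hδ2 _ (Metric.cthickening_mono hs1.le K hy.1) _ (Metric.self_subset_cthickening _ (R.frK hx)) ?_).le
      rw [dist_eq_norm, add_sub_cancel_left, norm_smul, R.un x hx, mul_one, Real.norm_of_nonneg hr.1.le]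
      exact hr.2.trans_lt hsδ
    have e2 : ∫ x, (1:ℝ) ∂(R.nu s) = volume.real (sh K 0 s) := by
      rw [nu, integral_map hpc.measurable.aemeasurable aestronglyMeasurable_const]; simp
    rw [e2] at hsA
    calc _ ≤ s⁻¹ * (ε / (A + 2) * volume.real (sh K 0 s)) := by gcongr
      _ = ε / (A + 2) * (s⁻¹ * volume.real (sh K 0 s)) := by ring
      _ < ε / (A + 2) * (A + 2) := by gcongr; linarith
      _ = ε := by field_simp
  simpa using h2.add h1
end Reg
end partD2

section partD3
variable {n : ℕ} {K : Set (En n)} {N : En n → En n} {L : NNReal}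

lemma det_exp (L : ℝ) (hL : 0 ≤ L) {η : ℝ} (hη : 0 < η) : ∃ s0 > 0, ∀ s : ℝ, 0 < s → s < s0 → ∀ A : Matrix (Fin n) (Fin n) ℝ,
    (∀ i j, |A i j| ≤ L) → 1 - s * A.trace - η * s ≤ (1 - s • A).det := by
  let D : (Fin n → Fin n → ℝ) → ℝ := fun A => ((1 : Matrix (Fin n) (Fin n) ℝ) + Matrix.of A).det
  have hd : DifferentiableAt ℝ D 0 := by
    simp only [D, Matrix.det_apply', Matrix.add_apply, Matrix.of_apply]
    fun_prop
  have hD := hd.hasFDerivAt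
  have htr : ∀ A, fderiv ℝ D 0 A = (Matrix.of A).trace := by
    intro A
    have h1 : HasDerivAt (fun s : ℝ => D (s • A)) (fderiv ℝ D 0 A) 0 := by
      have h2 : HasDerivAt (fun s : ℝ => s • A) A 0 := by simpa using (hasDerivAt_id (0:ℝ)).smul_const A
      have h3 : HasFDerivAt D (fderiv ℝ D 0) ((fun s : ℝ => s • A) 0) := by simpa using hD
      exact h3.comp_hasDerivAt 0 h2
    let p := ((1 + (Polynomial.X : Polynomial ℝ) • (Matrix.of A).map Polynomial.C : Matrix (Fin n) (Fin n) (Polynomial ℝ)).det).divX.divX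
    have h4 : (fun s : ℝ => D (s • A)) = fun s => 1 + (Matrix.of A).trace * s + p.eval s * s ^ 2 := by
      funext s
      exact Matrix.det_one_add_smul s (Matrix.of A)
    rw [h4] at h1
    have h5 : HasDerivAt (fun s : ℝ => 1 + (Matrix.of A).trace * s + p.eval s * s ^ 2) ((Matrix.of A).trace) 0 := by
      have := (((hasDerivAt_id (0:ℝ)).const_mul (Matrix.of A).trace).const_add 1).add ((p.hasDerivAt 0).mul (hasDerivAt_pow 2 (0:ℝ)))
      exact this.congr_deriv (by simp)
    exact h1.unique h5
  have ho := hD.isLittleO.def (show 0 < η / (L + 1) by positivity)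
  obtain ⟨d, hd0, hd⟩ := Metric.eventually_nhds_iff.1 ho
  refine ⟨d / (L + 1), by positivity, fun s hs hs0 A hA => ?_⟩
  have hn : ‖(fun i j => -(s * A i j) : Fin n → Fin n → ℝ)‖ ≤ s * L := by
    refine (pi_norm_le_iff_of_nonneg (by positivity)).2 fun i => (pi_norm_le_iff_of_nonneg (by positivity)).2 fun j => ?_
    rw [norm_neg, norm_mul, Real.norm_of_nonneg hs.le]
    exact mul_le_mul_of_nonneg_left (hA i j) hs.le
  rw [lt_div_iff₀ (by positivity)] at hs0
  have h := hd (y := fun i j => -(s * A i j)) (by rw [dist_zero_right]; exact hn.trans_lt (by linarith))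
  rw [htr] at h
  have e1 : D (fun i j => -(s * A i j)) = (1 - s • A).det := by
    simp only [D]; congr 1
  have e2 : D 0 = 1 := by simp [D]
  have e3 : (Matrix.of fun i j => -(s * A i j)).trace = -(s * A.trace) := by
    simp [Matrix.trace, Finset.mul_sum]
  rw [sub_zero, e1, e2, e3] at h
  have h6 := (abs_le.1 (h.trans (mul_le_mul_of_nonneg_left hn (by positivity)))).1
  have : η / (L + 1) * (s * L) ≤ η * s := by
    rw [div_mul_eq_mul_div, div_le_iff₀ (by positivity)]; nlinarith [mul_pos hη hs]
  linarith

def dv (N : En n → En n) (y : En n) : ℝ := ∑ j, pd (fun z => N z j) j y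

namespace Reg

lemma sh_vol (R : Reg K N L) {a b : ℝ} (hab : a ≤ b) : volume.real (sh K a b) = PV K b - PV K a :=
  (PV_sub R.cp.isBounded hab).symm

lemma sh_shift (R : Reg K N L) {s ρ σ : ℝ} (hs : 0 ≤ s) (hρ : 0 ≤ ρ) (hρσ : ρ ≤ σ) :
    PV K (s + σ) - PV K (s + ρ) ≤ (1 + s * L) ^ n * (PV K σ - PV K ρ) := by
  rw [← R.sh_vol (by linarith), ← R.sh_vol hρσ]
  let k : NNReal := 1 + s.toNNReal * L
  have h1 := hm_le (n := n) (d := n) (k := k) (S := sh K ρ σ) (α := fun y => y + s • N (R.pj y)) (β := id) fun p _ q _ => by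
    have e : p + s • N (R.pj p) - (q + s • N (R.pj q)) = (p - q) + s • (N (R.pj p) - N (R.pj q)) := by module
    have h2 := R.lip.dist_le_mul (R.pj p) (R.pj q)
    have h3 := R.pj_lip.dist_le_mul p q
    simp only [id, dist_eq_norm, NNReal.coe_one, one_mul] at *
    rw [e]
    refine (norm_add_le _ _).trans ?_
    rw [norm_smul, Real.norm_of_nonneg hs]
    have h4 : s * ‖N (R.pj p) - N (R.pj q)‖ ≤ s * (L * ‖p - q‖) := by gcongr; exact h2.trans (by gcongr)
    simp only [k, NNReal.coe_add, NNReal.coe_one, NNReal.coe_mul, Real.coe_toNNReal s hs]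
    linarith
  have e : (μHE[n] : Measure (En n)) = volume := by
    rw [EuclideanSpace.euclideanHausdorffMeasure_eq_volume]
  rw [e, Set.image_id] at h1
  have hsub : sh K (s + ρ) (s + σ) ⊆ (fun y => y + s • N (R.pj y)) '' sh K ρ σ := by
    intro y hy
    obtain ⟨x, hx, r, hr, rfl⟩ := (R.mem_sh (by linarith)).1 hy
    refine ⟨x + (r - s) • N x, (R.mem_sh hρ).2 ⟨x, hx, r - s, ⟨by linarith [hr.1], by linarith [hr.2]⟩, rfl⟩, ?_⟩
    simp only
    rw [R.pj_tube hx (by linarith [hr.1])]; module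
  have h2 := (measure_mono hsub).trans h1
  have h3 := ENNReal.toReal_mono (ENNReal.mul_ne_top (by simp) (R.sh_fin ρ σ)) h2
  rw [ENNReal.toReal_mul, ENNReal.toReal_pow, ENNReal.coe_toReal] at h3
  simpa [k, Real.coe_toNNReal s hs, Measure.real] using h3

lemma push_sub (R : Reg K N L) {s ρ σ η0 : ℝ} (hnr : ∀ q, Metric.infDist q K ≤ η0 → q ∉ K → ‖N q‖ = 1)
    (hs : 0 < s) (hρ : 0 ≤ ρ) (hσ : 0 < σ) (h0 : s + σ ≤ η0) :
    (fun q => q - s • N q) '' sh K (s + ρ) (s + σ) ⊆ sh K ρ (σ + L ^ 2 * s * (s + σ) ^ 3 / (2 * σ)) := by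
  rintro _ ⟨q, hq, rfl⟩
  obtain ⟨x, hx, r, hr, hqe⟩ := (R.mem_sh (by linarith)).1 hq
  have hr0 : 0 < r := by linarith [hr.1]
  have hd : Metric.infDist q K = r := by rw [hqe]; exact R.dist_tube hx hr0.le
  have hqK : q ∉ K := fun h => by rw [Metric.infDist_zero_of_mem h] at hd; linarith
  have hNq := hnr q (by rw [hd]; linarith [hr.2]) hqK
  have hNx := R.un x hx
  have hlip := R.lip.dist_le_mul q x
  rw [dist_eq_norm, dist_eq_norm, hqe, add_sub_cancel_left, ← hqe, norm_smul, hNx, mul_one, Real.norm_of_nonneg hr0.le] at hlip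
  set w := N q - N x
  have hin : inner ℝ (N x) w = - ‖w‖ ^ 2 / 2 := by
    have : ‖N q‖ ^ 2 = ‖N x + w‖ ^ 2 := by simp [w]
    rw [norm_add_sq_real, hNq, hNx] at this; linarith
  have hB : q - s • N q = x + ((r - s) • N x - s • w) := by
    have : q - s • N q = (x + r • N x) - s • N q := by rw [← hqe]
    rw [this]; simp only [w]; module
  have hnorm : ‖(r - s) • N x - s • w‖ ^ 2 = (r - s) ^ 2 + s * r * ‖w‖ ^ 2 := by
    rw [norm_sub_sq_real, inner_smul_left, inner_smul_right, hin, norm_smul, norm_smul, hNx, mul_pow, mul_pow, Real.norm_eq_abs, Real.norm_eq_abs, sq_abs, sq_abs]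
    simp; ring
  have hr1 := hr.1
  have hr2 := hr.2
  have hsr : 0 < r - s := by linarith
  simp only [hB]
  rw [sh, Set.mem_sdiff, mem_cth R.ne (by positivity), mem_cth R.ne hρ, not_le]
  constructor
  · refine (Metric.infDist_le_dist_of_mem (R.frK hx)).trans ?_
    rw [dist_eq_norm, add_sub_cancel_left]
    refine abs_le_of_sq_le_sq' ?_ (by positivity) |>.2
    rw [hnorm]
    have h1 : ‖w‖ ^ 2 ≤ (L * r) ^ 2 := by gcongr
    have h2 : (r - s) ^ 2 ≤ σ ^ 2 := by gcongr; linarith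
    have h3 : s * r * ‖w‖ ^ 2 ≤ L ^ 2 * s * (s + σ) ^ 3 := by
      calc _ ≤ s * r * (L * r) ^ 2 := by gcongr
        _ = L ^ 2 * s * r ^ 3 := by ring
        _ ≤ _ := by gcongr
    have h4 : (σ + L ^ 2 * s * (s + σ) ^ 3 / (2 * σ)) ^ 2 = σ ^ 2 + L ^ 2 * s * (s + σ) ^ 3 + (L ^ 2 * s * (s + σ) ^ 3 / (2 * σ)) ^ 2 := by
      field_simp; ring
    rw [h4]; nlinarith [sq_nonneg (L ^ 2 * s * (s + σ) ^ 3 / (2 * σ))]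
  · refine lt_of_lt_of_le (b := r - s) (by linarith) ?_
    refine (Metric.le_infDist R.ne).2 fun p hp => ?_
    have h1 := R.half x hx p hp
    have h2 := real_inner_le_norm (N x) (x + ((r - s) • N x - s • w) - p)
    rw [hNx, one_mul, ← dist_eq_norm] at h2
    refine le_trans ?_ h2
    have e : x + ((r - s) • N x - s • w) - p = ((r - s) • N x - s • w) - (p - x) := by module
    rw [e, inner_sub_right, inner_sub_right, inner_smul_right, inner_smul_right, real_inner_self_eq_norm_sq, hNx, hin, real_inner_comm]
    nlinarith [mul_nonneg hs.le (sq_nonneg ‖w‖)]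

lemma push (R : Reg K N L) (hN : ContDiff ℝ 1 N) {η0 : ℝ} (hnr : ∀ q, Metric.infDist q K ≤ η0 → q ∉ K → ‖N q‖ = 1) {η : ℝ} (hη : 0 < η) :
    ∃ s0 > 0, ∀ s ρ σ : ℝ, 0 < s → s < s0 → 0 ≤ ρ → 0 < σ → ρ ≤ σ → s + σ ≤ η0 →
    PV K (s + σ) - PV K (s + ρ) ≤ PV K (σ + L ^ 2 * s * (s + σ) ^ 3 / (2 * σ)) - PV K ρ +
      s * (∫ y in sh K (s + ρ) (s + σ), dv N y) + η * s * (PV K (s + σ) - PV K (s + ρ)) := by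
  obtain ⟨s1, hs1, hdet⟩ := det_exp (n := n) L L.2 hη
  refine ⟨min s1 (1 / (L + 1)), by positivity, fun s ρ σ hs hs0 hρ hσ hρσ h0 => ?_⟩
  have hss1 := hs0.trans_le (min_le_left _ _)
  have hss2 := hs0.trans_le (min_le_right _ _)
  rw [lt_div_iff₀ (by positivity)] at hss2
  set S := sh K (s + ρ) (s + σ)
  have hNd : Differentiable ℝ N := hN.differentiable one_ne_zero
  have hNi : ∀ i, ContDiff ℝ 1 (fun y => N y i) := fun i => (EuclideanSpace.proj (𝕜 := ℝ) i).contDiff.comp hN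
  have hpdc : ∀ i j, Continuous (pd (fun y => N y i) j) := fun i j =>
    (contDiff_iff_contDiffAt.2 fun x => pd_contDiffAt (m := 0) (hNi i).contDiffAt (by norm_num) j).continuous
  have hBd : ∀ q, DifferentiableAt ℝ (fun q => q - s • N q) q := fun q => by have := hNd q; fun_prop
  have hdetc : ∀ q, (fderiv ℝ (fun q => q - s • N q) q).det = (1 - s • (Matrix.of fun i j => pd (fun y => N y i) j q)).det := by
    intro q
    rw [det_fderiv (hBd q)]
    congr 1
    ext i j
    have hd1 : DifferentiableAt ℝ (fun y => N y i) q := ((hNi i).differentiable one_ne_zero) q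
    have e : (fun y => (y - s • N y) i) = fun y : En n => y i + (-s) * N y i := by funext y; simp; ring
    simp only [Matrix.of_apply]
    rw [e, pd_add (diff_coord q i) (hd1.const_mul _), pd_const_mul, pd_coord]
    simp [Matrix.one_apply, sub_eq_add_neg]
  have hinj : Set.InjOn (fun q => q - s • N q) S := by
    intro q _ q' _ h
    have e : q - q' = s • (N q - N q') := by
      have h : q - s • N q = q' - s • N q' := h
      rw [smul_sub, ← sub_eq_zero, ← sub_eq_zero.2 h]; module
    have h1 := R.lip.dist_le_mul q q'
    rw [dist_eq_norm, dist_eq_norm] at h1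
    have h2 : ‖q - q'‖ ≤ s * (L * ‖q - q'‖) := by
      conv_lhs => rw [e, norm_smul, Real.norm_of_nonneg hs.le]
      gcongr
    have h3 : ‖q - q'‖ = 0 := by
      by_contra hc
      have : 0 < ‖q - q'‖ := lt_of_le_of_ne (norm_nonneg _) (Ne.symm hc)
      nlinarith
    exact sub_eq_zero.1 (norm_eq_zero.1 h3)
  have hcv := integral_image_eq_integral_abs_det_fderiv_smul (volume : Measure (En n)) (sh_meas (K := K) (s + ρ) (s + σ))
    (fun q _ => (hBd q).hasFDerivAt.hasFDerivWithinAt) hinj (fun _ => (1:ℝ))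
  have hI : ∀ g : En n → ℝ, Continuous g → IntegrableOn g S := fun g hg =>
    (hg.continuousOn.integrableOn_compact (R.cp.cthickening (r := s + σ))).mono_set Set.sdiff_subset
  have hdvc : Continuous (dv N) := by unfold dv; exact continuous_finsetSum _ fun j _ => hpdc j j
  have hvol : ∀ c : ℝ, ∫ y in S, c = (PV K (s + σ) - PV K (s + ρ)) * c := fun c => by
    rw [setIntegral_const, smul_eq_mul, R.sh_vol (by linarith)]
  have hm : ∫ y in S, (1 - s * dv N y - η * s) ≤ ∫ q in S, |(fderiv ℝ (fun q => q - s • N q) q).det| • (1:ℝ) := by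
    refine setIntegral_mono (hI _ (by fun_prop)) (hI _ ?_) fun q => ?_
    · simp only [hdetc, smul_eq_mul, mul_one]
      refine (Continuous.matrix_det ?_).abs
      refine continuous_const.sub (Continuous.const_smul (continuous_matrix fun i j => hpdc i j) s)
    · simp only [smul_eq_mul, mul_one]
      refine le_trans ?_ (le_abs_self _)
      rw [hdetc]
      refine hdet s hs hss1 (Matrix.of fun i j => pd (fun y => N y i) j q) fun i j => ?_
      have hl : LipschitzWith L (fun y => N y i) := LipschitzWith.of_dist_le_mul fun y z => by
        refine le_trans ?_ (R.lip.dist_le_mul y z)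
        rw [dist_eq_norm, dist_eq_norm]
        exact PiLp.norm_apply_le (N y - N z) i
      have h1 := (fderiv ℝ (fun y => N y i) q).le_opNorm (EuclideanSpace.single j 1)
      rw [PiLp.norm_single, norm_one, mul_one] at h1
      exact h1.trans (norm_fderiv_le_of_lipschitz ℝ hl)
  rw [← hcv, setIntegral_const, smul_eq_mul, mul_one] at hm
  have e1 : ∫ y in S, (1 - s * dv N y - η * s) = (PV K (s + σ) - PV K (s + ρ)) - s * (∫ y in S, dv N y) - (PV K (s + σ) - PV K (s + ρ)) * (η * s) := by
    rw [integral_sub (hI _ (by fun_prop)) (hI _ (by fun_prop)), integral_sub (hI _ (by fun_prop)) (hI _ (by fun_prop)), hvol, hvol, integral_const_mul, mul_one]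
  have he : 0 ≤ L ^ 2 * s * (s + σ) ^ 3 / (2 * σ) := by positivity
  have h5 : volume.real ((fun q => q - s • N q) '' S) ≤ PV K (σ + L ^ 2 * s * (s + σ) ^ 3 / (2 * σ)) - PV K ρ := by
    rw [← R.sh_vol (by linarith)]
    exact measureReal_mono (R.push_sub hnr hs hρ hσ h0) (R.sh_fin _ _)
  linarith
end Reg
end partD3

section partE1
variable {n : ℕ} {K : Set (En n)} {N : En n → En n} {L : NNReal}

lemma bern {x y : ℝ} (hx : 0 ≤ x) (hy : 0 ≤ y) (k : ℕ) : x ^ (k + 1) + (k + 1) * x ^ k * y ≤ (x + y) ^ (k + 1) := by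
  induction k with
  | zero => simp
  | succ k ih =>
    have h1 := mul_le_mul_of_nonneg_right ih (add_nonneg hx hy)
    rw [← pow_succ] at h1
    refine le_trans ?_ h1
    push_cast
    have : 0 ≤ (k + 1) * x ^ k * y ^ 2 := by positivity
    have e : (x ^ (k + 1) + (k + 1) * x ^ k * y) * (x + y) = x ^ (k + 1 + 1) + (k + 1 + 1) * x ^ (k + 1) * y + (k + 1) * x ^ k * y ^ 2 := by ring
    linarith

lemma tend_mul {c : ℝ} (hc : 0 < c) : Tendsto (fun s : ℝ => c * s) (𝓝[>] 0) (𝓝[>] 0) := by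
  refine tendsto_nhdsWithin_iff.2 ⟨?_, ?_⟩
  · have : Tendsto (fun s : ℝ => c * s) (𝓝 0) (𝓝 (c * 0)) := (continuous_const.mul continuous_id).tendsto 0
    rw [mul_zero] at this
    exact this.mono_left nhdsWithin_le_nhds
  · filter_upwards [self_mem_nhdsWithin] with s hs using mul_pos hc hs

lemma tend_cube {c : ℝ} (hc : 0 < c) : Tendsto (fun s : ℝ => c * s ^ 3) (𝓝[>] 0) (𝓝[>] 0) := by
  refine tendsto_nhdsWithin_iff.2 ⟨?_, ?_⟩
  · have : Tendsto (fun s : ℝ => c * s ^ 3) (𝓝 0) (𝓝 (c * 0 ^ 3)) := (continuous_const.mul (continuous_id.pow 3)).tendsto 0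
    rw [zero_pow three_ne_zero, mul_zero] at this
    exact this.mono_left nhdsWithin_le_nhds
  · filter_upwards [self_mem_nhdsWithin] with s hs using mul_pos hc (pow_pos hs 3)

namespace Reg

lemma sh_split (R : Reg K N L) {f : En n → ℝ} (hf : Continuous f) {a b : ℝ} (ha : 0 ≤ a) (hab : a ≤ b) :
    ∫ y in sh K a b, f y = (∫ y in sh K 0 b, f y) - ∫ y in sh K 0 a, f y := by
  have hI : ∀ a b, IntegrableOn f (sh K a b) := fun a b =>
    (hf.continuousOn.integrableOn_compact (R.cp.cthickening (r := b))).mono_set Set.sdiff_subset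
  have h1 := Metric.cthickening_mono ha K
  have h2 := Metric.cthickening_mono hab K
  have e : sh K 0 b = sh K 0 a ∪ sh K a b := by
    ext y; simp only [sh, Set.mem_union, Set.mem_sdiff]
    constructor
    · rintro ⟨u, v⟩; by_cases hy : y ∈ Metric.cthickening a K
      · exact Or.inl ⟨hy, v⟩
      · exact Or.inr ⟨u, hy⟩
    · rintro (⟨u, v⟩ | ⟨u, v⟩)
      · exact ⟨h2 u, v⟩
      · exact ⟨u, fun h => v (h1 h)⟩
  have hd : Disjoint (sh K 0 a) (sh K a b) := Set.disjoint_left.2 fun y hy hy' => hy'.2 hy.1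
  rw [e, setIntegral_union hd (sh_meas a b) (hI _ _) (hI _ _)]; ring

lemma Q_tendsto (R : Reg K N L) : Tendsto (fun s => (PV K s - PV K 0) / s) (𝓝[>] 0) (𝓝 ((mS K).real Set.univ)) := by
  have h := R.sh_tendsto (f := fun _ => (1:ℝ)) continuous_const
  have := R.mS_fin
  rw [integral_const, smul_eq_mul, mul_one] at h
  refine h.congr' ?_
  filter_upwards [self_mem_nhdsWithin] with s hs
  have hs : 0 < s := hs
  rw [setIntegral_const, R.sh_vol hs.le, smul_eq_mul, mul_one, div_eq_inv_mul]

lemma main_eps (hn : 3 ≤ n) (R : Reg K N L) (hN : ContDiff ℝ 1 N) (hdvc : Continuous (dv N)) {η0 : ℝ} (h0 : 0 < η0)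
    (hnr : ∀ q, Metric.infDist q K ≤ η0 → q ∉ K → ‖N q‖ = 1) {ε : ℝ} (hε : 0 < ε) :
    ((n - 1 : ℕ) : ℝ) * (((mS K).real Set.univ) ^ (1 / ((n - 1 : ℕ) : ℝ))) ^ (n - 2) * ((sg n).real Set.univ) ^ (1 / ((n - 1 : ℕ) : ℝ))
      ≤ n * (ε * L) * (mS K).real Set.univ + 0 + (∫ x, dv N x ∂(mS K)) + ε * (mS K).real Set.univ := by
  set a := (mS K).real Set.univ
  set b := ∫ x, dv N x ∂(mS K)
  set w := ((sg n).real Set.univ) ^ (1 / ((n - 1 : ℕ) : ℝ))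
  have hw : 0 ≤ w := by positivity
  set α := 1 / ((n - 1 : ℕ) : ℝ) with hα
  let Q : ℝ → ℝ := fun s => (PV K s - PV K 0) / s
  let D : ℝ → ℝ := fun s => s⁻¹ * ∫ y in sh K 0 s, dv N y
  have hQ : Tendsto Q (𝓝[>] 0) (𝓝 a) := R.Q_tendsto
  have hD : Tendsto D (𝓝[>] 0) (𝓝 b) := R.sh_tendsto hdvc
  obtain ⟨s0, hs0, hpush⟩ := R.push hN hnr hε
  let c : ℝ := L ^ 2 * (1 + 2 * ε) ^ 3 / (4 * ε) + 1
  have hc : 0 < c := by positivity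
  have hid : Tendsto (fun s : ℝ => s) (𝓝[>] 0) (𝓝 0) := tendsto_id.mono_left nhdsWithin_le_nhds
  have t1 : Tendsto (fun s => s⁻¹ * ((1 + ε * s * L) ^ n - 1) * Q (ε * s)) (𝓝[>] 0) (𝓝 (n * (ε * L) * a)) := by
    refine Tendsto.mul ?_ (hQ.comp (tend_mul hε))
    have h1 : HasDerivAt (fun s : ℝ => (1 + ε * s * L) ^ n) (n * (ε * L)) 0 := by
      have h2 := ((((hasDerivAt_id (0:ℝ)).const_mul ε).mul_const (L:ℝ)).const_add 1).pow n
      exact h2.congr_deriv (by simp)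
    have h3 := h1.tendsto_slope_zero_right
    simpa using h3
  have t2 : Tendsto (fun s => (1 + 2 * (ε * s) * L) ^ n * (c * s / ε) * Q (c * s ^ 3)) (𝓝[>] 0) (𝓝 0) := by
    have h1 : Tendsto (fun s : ℝ => (1 + 2 * (ε * s) * L) ^ n * (c * s / ε)) (𝓝[>] 0) (𝓝 0) := by
      have : Continuous (fun s : ℝ => (1 + 2 * (ε * s) * L) ^ n * (c * s / ε)) := by fun_prop
      have h2 := (this.tendsto 0).mono_left (nhdsWithin_le_nhds (s := Set.Ioi 0))
      simpa using h2
    simpa using h1.mul (hQ.comp (tend_cube hc))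
  have tgen : ∀ {F : ℝ → ℝ} {l : ℝ}, Tendsto F (𝓝[>] 0) (𝓝 l) →
      Tendsto (fun s => ((1 + 2 * ε) * F ((1 + 2 * ε) * s) - (1 + ε) * F ((1 + ε) * s)) / ε) (𝓝[>] 0) (𝓝 l) := by
    intro F l hF
    have h1 := hF.comp (tend_mul (show 0 < 1 + 2 * ε by positivity))
    have h2 := hF.comp (tend_mul (show 0 < 1 + ε by positivity))
    have h3 := ((h1.const_mul (1 + 2 * ε)).sub (h2.const_mul (1 + ε))).div_const ε
    have e : ((1 + 2 * ε) * l - (1 + ε) * l) / ε = l := by field_simp; ring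
    rw [e] at h3; exact h3
  have t3 := tgen hD
  have t4 := (tgen hQ).const_mul ε
  have tl : Tendsto (fun s => ((n - 1 : ℕ) : ℝ) * (Q (ε * s) ^ α) ^ (n - 2) * w) (𝓝[>] 0) (𝓝 (((n - 1 : ℕ) : ℝ) * (a ^ α) ^ (n - 2) * w)) :=
    ((((hQ.comp (tend_mul hε)).rpow_const (Or.inr (by positivity))).pow (n - 2)).const_mul _).mul_const w
  refine le_of_tendsto_of_tendsto tl (((t1.add t2).add t3).add t4) ?_
  filter_upwards [self_mem_nhdsWithin, nhdsWithin_le_nhds (eventually_lt_nhds hs0),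
    nhdsWithin_le_nhds (eventually_lt_nhds (show 0 < η0 / (1 + 2 * ε) by positivity))] with s hs hss0 hsη
  have hs : 0 < s := hs
  rw [lt_div_iff₀ (by positivity)] at hsη
  have hδ : 0 < ε * s := by positivity
  set δ := ε * s with hδd
  have hbd := R.cp.isBounded
  have hddi := ddi_convex hn R.ne R.cv R.cp s δ hs.le hδ
  have hp := hpush s δ (2 * δ) hs hss0 hδ.le (by positivity) (by linarith) (by rw [hδd]; linarith)
  have hmono : ∀ {u v : ℝ}, u ≤ v → PV K u ≤ PV K v := fun huv => PV_mono hbd (Metric.cthickening_mono huv K)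
  have he : L ^ 2 * s * (s + 2 * δ) ^ 3 / (2 * (2 * δ)) ≤ c * s ^ 3 := by
    have : L ^ 2 * s * (s + 2 * δ) ^ 3 / (2 * (2 * δ)) = (c - 1) * s ^ 3 := by
      simp only [c, hδd, add_sub_cancel_right]; field_simp; ring
    rw [this]; nlinarith [pow_pos hs 3]
  have h1 := hmono (show 2 * δ + L ^ 2 * s * (s + 2 * δ) ^ 3 / (2 * (2 * δ)) ≤ 2 * δ + c * s ^ 3 by linarith)
  have h2 := R.sh_shift (s := 2 * δ) (ρ := 0) (σ := c * s ^ 3) (by positivity) le_rfl (by positivity)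
  have h3 := R.sh_shift (s := δ) (ρ := 0) (σ := δ) hδ.le le_rfl hδ.le
  rw [add_zero] at h2 h3
  rw [← two_mul] at h3
  have q1 : PV K (c * s ^ 3) - PV K 0 = c * s ^ 3 * Q (c * s ^ 3) := by simp only [Q]; field_simp
  have q2 : PV K δ - PV K 0 = δ * Q δ := by simp only [Q]; field_simp
  rw [q1] at h2
  rw [q2] at h3
  have hQ0 : 0 ≤ Q δ := div_nonneg (sub_nonneg.2 (hmono hδ.le)) hδ.le
  have hb := bern (x := Q δ ^ α) (y := w * s) (Real.rpow_nonneg hQ0 α) (by positivity) (n - 2)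
  have e1 : n - 2 + 1 = n - 1 := by omega
  have e2 : ((n - 2 : ℕ) : ℝ) + 1 = ((n - 1 : ℕ) : ℝ) := by rw [← e1]; push_cast; ring
  have e3 : (Q δ ^ α) ^ (n - 1) = Q δ := by
    rw [hα, one_div]; exact Real.rpow_inv_natCast_pow hQ0 (by omega)
  rw [e1, e2, e3] at hb
  have hb2 := (mul_le_mul_of_nonneg_left hb hδ.le).trans hddi
  have hsplit := R.sh_split hdvc (a := s + δ) (b := s + 2 * δ) (by positivity) (by linarith)
  rw [hsplit] at hp
  have es1 : s + δ = (1 + ε) * s := by rw [hδd]; ring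
  have es2 : s + 2 * δ = (1 + 2 * ε) * s := by rw [hδd]; ring
  rw [es1, es2] at hp hb2
  rw [es2] at h1
  have d1 : ∀ k, 0 < k → ∫ y in sh K 0 (k * s), dv N y = k * s * D (k * s) := fun k hk => by
    simp only [D]; field_simp
  have d2 : ∀ k, 0 < k → PV K (k * s) = PV K 0 + k * s * Q (k * s) := fun k hk => by
    simp only [Q]; field_simp; ring
  rw [d1 _ (by positivity), d1 _ (by positivity)] at hp
  have d3 := d2 (1 + 2 * ε) (by positivity)
  have d4 := d2 (1 + ε) (by positivity)
  have hfin : δ * s * (((n - 1 : ℕ) : ℝ) * (Q δ ^ α) ^ (n - 2) * w) ≤ δ * s * (s⁻¹ * ((1 + δ * L) ^ n - 1) * Q δ + (1 + 2 * δ * L) ^ n * (c * s / ε) * Q (c * s ^ 3) +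
      ((1 + 2 * ε) * D ((1 + 2 * ε) * s) - (1 + ε) * D ((1 + ε) * s)) / ε +
      ε * (((1 + 2 * ε) * Q ((1 + 2 * ε) * s) - (1 + ε) * Q ((1 + ε) * s)) / ε)) := by
    have f1 : δ * s * (s⁻¹ * ((1 + δ * L) ^ n - 1) * Q δ) = (1 + δ * L) ^ n * (δ * Q δ) - δ * Q δ := by field_simp
    have f2 : δ * s * ((1 + 2 * δ * L) ^ n * (c * s / ε) * Q (c * s ^ 3)) = (1 + 2 * δ * L) ^ n * (c * s ^ 3 * Q (c * s ^ 3)) := by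
      rw [show δ * s * ((1 + 2 * δ * L) ^ n * (c * s / ε) * Q (c * s ^ 3)) = (1 + 2 * δ * L) ^ n * (δ * s * (c * s / ε) * Q (c * s ^ 3)) by ring]
      congr 2; rw [hδd]; field_simp
    have f3 : ∀ u v : ℝ, δ * s * ((u - v) / ε) = s * (s * u - s * v) := fun u v => by rw [hδd]; field_simp
    rw [mul_add, mul_add, mul_add, f1, f2, f3]
    have f4 : ∀ u v : ℝ, δ * s * (ε * ((u - v) / ε)) = ε * s * (s * u - s * v) := fun u v => by rw [hδd]; field_simp
    rw [f4]
    rw [d3, d4] at hp hb2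
    clear_value δ
    linarith [hp, hb2, h1, h2, h3, q2]
  exact le_of_mul_le_mul_left hfin (by positivity)

lemma main_lim (hn : 3 ≤ n) (R : Reg K N L) (hN : ContDiff ℝ 1 N) (hdvc : Continuous (dv N)) {η0 : ℝ} (h0 : 0 < η0)
    (hnr : ∀ q, Metric.infDist q K ≤ η0 → q ∉ K → ‖N q‖ = 1) :
    ((n - 1 : ℕ) : ℝ) * (((mS K).real Set.univ) ^ (1 / ((n - 1 : ℕ) : ℝ))) ^ (n - 2) * ((sg n).real Set.univ) ^ (1 / ((n - 1 : ℕ) : ℝ))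
      ≤ ∫ x, dv N x ∂(mS K) := by
  refine le_of_forall_pos_le_add fun ε hε => ?_
  have ha : 0 ≤ (mS K).real Set.univ := measureReal_nonneg
  set a := (mS K).real Set.univ
  have h := R.main_eps hn hN hdvc h0 hnr (ε := ε / (n * L * a + a + 1)) (by positivity)
  refine h.trans ?_
  have : ε / (n * L * a + a + 1) * (n * L * a + a) ≤ ε := by
    rw [div_mul_eq_mul_div, div_le_iff₀ (by positivity)]; nlinarith
  linarith
end Reg
end partE1

section partE2
variable {n : ℕ} {K : Set (En n)}

lemma reg_ball (hn : 3 ≤ n) : Reg (Metric.closedBall (0 : En n) 1) id 1 where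
  cp := isCompact_closedBall _ _
  cv := convex_closedBall _ _
  ne := ⟨0, by simp⟩
  un := fun x hx => by rw [frontier_closedBall _ one_ne_zero] at hx; simpa using hx
  lip := LipschitzWith.id
  half := fun x hx q hq => by
    rw [frontier_closedBall _ one_ne_zero, mem_sphere_zero_iff_norm] at hx
    rw [mem_closedBall_zero_iff] at hq
    have := real_inner_le_norm q x
    rw [id, inner_sub_left, real_inner_self_eq_norm_sq, hx]
    rw [hx] at this; linarith
  proj := fun y hy => by
    rw [mem_closedBall_zero_iff, not_le] at hy
    have hy0 : ‖y‖ ≠ 0 := by linarith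
    refine ⟨‖y‖⁻¹ • y, ?_, ‖y‖ - 1, by linarith, ?_⟩
    · rw [frontier_closedBall _ one_ne_zero, mem_sphere_zero_iff_norm, norm_smul, norm_inv, norm_norm, inv_mul_cancel₀ hy0]
    · simp only [id]
      rw [smul_smul, ← add_smul, sub_mul, mul_inv_cancel₀ hy0, one_mul, add_sub_cancel, one_smul]

lemma ball_area (hn : 3 ≤ n) : (μHE[n - 1] (Metric.sphere (0 : En n) 1)).toReal = (sg n).real Set.univ := by
  have R := reg_ball hn
  have : Nontrivial (En n) := by
    have : NeZero n := ⟨by omega⟩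
    infer_instance
  have h1 := R.Q_tendsto
  have e1 : (Reg.mS (Metric.closedBall (0 : En n) 1)).real Set.univ = (μHE[n - 1] (Metric.sphere (0 : En n) 1)).toReal := by
    rw [Measure.real, Measure.restrict_apply_univ, frontier_closedBall _ one_ne_zero]
  rw [e1] at h1
  have hv : ∀ t : ℝ, 0 ≤ t → PV (Metric.closedBall (0 : En n) 1) t = (1 + t) ^ n * volume.real (Metric.ball (0 : En n) 1) := by
    intro t ht
    rw [PV, cthickening_closedBall ht zero_le_one, Measure.addHaar_real_closedBall _ _ (by positivity), finrank_euclideanSpace_fin, add_comm]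
  have h2 : HasDerivAt (fun s : ℝ => (1 + s) ^ n * volume.real (Metric.ball (0 : En n) 1)) (n * volume.real (Metric.ball (0 : En n) 1)) 0 := by
    have h2 := (((hasDerivAt_id (0:ℝ)).const_add 1).pow n).mul_const (volume.real (Metric.ball (0 : En n) 1))
    exact h2.congr_deriv (by simp)
  have h3 := h2.tendsto_slope_zero_right
  have h4 := h3.congr' (f₂ := fun s => (PV (Metric.closedBall (0 : En n) 1) s - PV (Metric.closedBall (0 : En n) 1) 0) / s) (by
    filter_upwards [self_mem_nhdsWithin] with s hs
    have hs : 0 < s := hs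
    rw [hv s hs.le, hv 0 le_rfl, zero_add, smul_eq_mul, div_eq_inv_mul])
  rw [tendsto_nhds_unique h1 h4, Measure.toSphere_real_apply_univ, finrank_euclideanSpace_fin]

section field
variable {φ : En n → ℝ}

lemma gr_norm (x : En n) : ‖gr φ x‖ = √(gradSq φ x) := by
  rw [EuclideanSpace.norm_eq]; congr 1
  simp [gr, gradSq]

lemma phi_line (hφ : ContDiff ℝ (⊤ : ℕ∞) φ) (x v : En n) : HasDerivAt (fun t : ℝ => φ (x + t • v)) (inner ℝ (gr φ x) v) 0 := by
  rw [inner_gr]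
  exact ((hφ.differentiable (by simp)) x).hasFDerivAt.hasLineDerivAt v

lemma phi_half (hφ : ContDiff ℝ (⊤ : ℕ∞) φ) (hcv : Convex ℝ K) (hφK : K = {x | φ x ≤ 0}) {x q : En n} (hx : φ x = 0) (hq : q ∈ K) :
    inner ℝ (q - x) (gr φ x) ≤ 0 := by
  have h := (phi_line hφ x (q - x)).tendsto_slope_zero_right
  rw [real_inner_comm]
  refine le_of_tendsto h ?_
  have hxK : x ∈ K := by rw [hφK]; exact hx.le
  filter_upwards [self_mem_nhdsWithin, nhdsWithin_le_nhds (eventually_lt_nhds (zero_lt_one (α := ℝ)))] with t ht0 ht1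
  have ht0 : 0 < t := ht0
  have hm : x + t • (q - x) ∈ K := hcv.add_smul_sub_mem hxK hq ⟨ht0.le, ht1.le⟩
  rw [hφK] at hm
  have hm : φ (x + t • (q - x)) ≤ 0 := hm
  simp only [zero_add, zero_smul, add_zero, hx, sub_zero, smul_eq_mul]
  exact mul_nonpos_of_nonneg_of_nonpos (by positivity) hm

lemma perp_aux {u g : En n} {l : ℝ} (hl : l * ‖g‖ ^ 2 = inner ℝ g u) : ‖u - l • g‖ ^ 2 = inner ℝ (u - l • g) u := by
  have h : inner ℝ (u - l • g) (l • g) = 0 := by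
    rw [inner_smul_right, inner_sub_left, real_inner_smul_left, real_inner_self_eq_norm_sq, hl, real_inner_comm, sub_self, mul_zero]
  rw [← real_inner_self_eq_norm_sq, inner_sub_right, h, sub_zero]

lemma phi_proj (hφ : ContDiff ℝ (⊤ : ℕ∞) φ) (hcv : Convex ℝ K) (hcp : IsCompact K) (hne : K.Nonempty) (hφK : K = {x | φ x ≤ 0})
    (hφfr : frontier K = {x | φ x = 0}) (hreg : ∀ x ∈ frontier K, gradSq φ x ≠ 0) {y : En n} (hy : y ∉ K) :
    ∃ x ∈ frontier K, ∃ r : ℝ, 0 < r ∧ y = x + r • gr φ x := by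
  obtain ⟨p, hp, hpq⟩ := exists_proj hne hcp.isClosed hcv y
  set u := y - p with hu
  have hu0 : u ≠ 0 := fun h => hy (by rw [sub_eq_zero.1 h]; exact hp)
  have hupos : 0 < ‖u‖ ^ 2 := by have := norm_pos_iff.2 hu0; positivity
  have hpf : p ∈ frontier K := by
    rw [hcp.isClosed.frontier_eq]
    refine ⟨hp, fun hi => ?_⟩
    have hc : Tendsto (fun t : ℝ => p + t • u) (𝓝[>] 0) (𝓝 p) := by
      have : Continuous (fun t : ℝ => p + t • u) := by fun_prop
      simpa using (this.tendsto 0).mono_left (nhdsWithin_le_nhds (s := Set.Ioi 0))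
    obtain ⟨t, ht, ht0⟩ := ((hc.eventually (mem_interior_iff_mem_nhds.1 hi)).and self_mem_nhdsWithin).exists
    have ht0 : 0 < t := ht0
    have := hpq _ ht
    rw [add_sub_cancel_left, inner_smul_left, real_inner_self_eq_norm_sq] at this
    simp only [conj_trivial] at this
    nlinarith [mul_pos ht0 hupos]
  have hp0 : φ p = 0 := by rw [hφfr] at hpf; exact hpf
  set g := gr φ p
  have hg : 0 < ‖g‖ ^ 2 := by
    have h0 : 0 ≤ gradSq φ p := Finset.sum_nonneg fun i _ => sq_nonneg _
    show 0 < ‖gr φ p‖ ^ 2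
    rw [gr_norm, Real.sq_sqrt h0]
    exact lt_of_le_of_ne h0 (Ne.symm (hreg p hpf))
  have hv : ∀ v, inner ℝ g v < 0 → inner ℝ v u ≤ 0 := by
    intro v hv
    have h := (phi_line hφ p v).tendsto_slope_zero_right
    obtain ⟨t, ht, ht0⟩ := ((h.eventually_lt_const hv).and self_mem_nhdsWithin).exists
    have ht0 : 0 < t := ht0
    simp only [zero_add, zero_smul, add_zero, hp0, sub_zero, smul_eq_mul] at ht
    have hm : p + t • v ∈ K := by
      rw [hφK]
      exact (neg_of_mul_neg_right ht (by positivity)).le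
    have := hpq _ hm
    rw [add_sub_cancel_left, inner_smul_left] at this
    simp only [conj_trivial] at this
    exact nonpos_of_mul_nonpos_right this ht0
  set l := inner ℝ g u / ‖g‖ ^ 2
  have hl : l * ‖g‖ ^ 2 = inner ℝ g u := div_mul_cancel₀ _ hg.ne'
  have hperp : ∀ ε : ℝ, 0 < ε → ‖u - l • g‖ ^ 2 ≤ ε * inner ℝ g u := by
    intro ε hε
    have h := hv (u - l • g - ε • g) (by
      rw [inner_sub_right, inner_sub_right, inner_smul_right, inner_smul_right, real_inner_self_eq_norm_sq, hl]
      nlinarith [mul_pos hε hg])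
    have e : ‖u - l • g‖ ^ 2 = inner ℝ (u - l • g) u := perp_aux hl
    rw [e]
    rw [inner_sub_left, inner_smul_left (r := ε)] at h
    simp only [conj_trivial] at h
    linarith
  have hgu : 0 ≤ inner ℝ g u := by have := hperp 1 one_pos; nlinarith [sq_nonneg ‖u - l • g‖]
  have hz : ‖u - l • g‖ ^ 2 ≤ 0 := by
    refine le_of_forall_pos_le_add fun ε hε => ?_
    refine (hperp (ε / (inner ℝ g u + 1)) (by positivity)).trans ?_
    rw [zero_add, div_mul_eq_mul_div, div_le_iff₀ (by positivity)]; nlinarith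
  have hul : u = l • g := by
    have : ‖u - l • g‖ = 0 := by nlinarith [norm_nonneg (u - l • g)]
    exact sub_eq_zero.1 (norm_eq_zero.1 this)
  refine ⟨p, hpf, l, ?_, by rw [← hul, hu]; module⟩
  refine lt_of_le_of_ne (by positivity) fun h => hu0 ?_
  rw [hul, ← h, zero_smul]

lemma field (hφ : ContDiff ℝ (⊤ : ℕ∞) φ) (hcv : Convex ℝ K) (hcp : IsCompact K) (hne : K.Nonempty) (hφK : K = {x | φ x ≤ 0})
    (hφfr : frontier K = {x | φ x = 0}) (hreg : ∀ x ∈ frontier K, gradSq φ x ≠ 0) :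
    ∃ (N : En n → En n) (L : NNReal), Reg K N L ∧ ContDiff ℝ 1 N ∧ Continuous (dv N) ∧
      (∃ η0 > 0, ∀ q, Metric.infDist q K ≤ η0 → q ∉ K → ‖N q‖ = 1) ∧
      ∀ x ∈ frontier K, dv N x = ∑ j, pd (fun y => pd φ j y / √(gradSq φ y)) j x := by
  have hpd : ∀ i, ContDiff ℝ 2 (pd φ i) := fun i =>
    contDiff_iff_contDiffAt.2 fun x => pd_contDiffAt (m := 2) (hφ.of_le (m := 3) (by exact WithTop.coe_le_coe.2 le_top)).contDiffAt (by norm_num) i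
  have hgs : ContDiff ℝ 2 (gradSq φ) := by
    unfold gradSq; exact ContDiff.sum fun i _ => (hpd i).pow 2
  have hgr : ContDiff ℝ 2 (gr φ) := by
    rw [contDiff_euclidean]; exact fun i => hpd i
  have hfc : IsCompact (frontier K) := hcp.of_isClosed_subset isClosed_frontier hcp.isClosed.frontier_subset
  obtain ⟨B, hB⟩ := hfc.isBounded.subset_ball (0 : En n)
  let W : Set (En n) := {x | gradSq φ x ≠ 0} ∩ Metric.ball 0 B
  have hWo : IsOpen W := (isOpen_ne.preimage hgs.continuous).inter Metric.isOpen_ball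
  have hfW : frontier K ⊆ W := fun x hx => ⟨hreg x hx, hB hx⟩
  obtain ⟨χ, h0, h1, -⟩ := exists_contMDiffMap_zero_one_nhds_of_isClosed (n := 2) (modelWithCornersSelf ℝ (En n)) hWo.isClosed_compl
    hfc.isClosed (Set.disjoint_left.2 fun x hx hx' => hx (hfW hx'))
  have hχ : ContDiff ℝ 2 (χ : En n → ℝ) := χ.contMDiff.contDiff
  have hts : tsupport (χ : En n → ℝ) ⊆ W := by
    intro x hx
    by_contra hxW
    exact (notMem_tsupport_iff_eventuallyEq.2 (eventually_nhdsSet_iff_forall.1 h0 x hxW)) hx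
  let N : En n → En n := fun y => χ y • ((√(gradSq φ y))⁻¹ • gr φ y)
  have hNts : tsupport N ⊆ tsupport (χ : En n → ℝ) := tsupport_smul_subset_left _ _
  have hN2 : ContDiff ℝ 2 N := by
    refine contDiff_iff_contDiffAt.2 fun x => ?_
    by_cases hx : x ∈ tsupport N
    swap
    · exact (contDiffAt_const (c := 0)).congr_of_eventuallyEq (notMem_tsupport_iff_eventuallyEq.1 hx)
    have hxg : gradSq φ x ≠ 0 := (hts (hNts hx)).1
    have hg0 : 0 ≤ gradSq φ x := Finset.sum_nonneg fun i _ => sq_nonneg _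
    refine hχ.contDiffAt.smul (ContDiffAt.smul ((hgs.contDiffAt.sqrt hxg).inv ?_) hgr.contDiffAt)
    rw [Real.sqrt_ne_zero hg0]; exact hxg
  have hNc : HasCompactSupport N := by
    refine HasCompactSupport.intro' (K := Metric.closedBall 0 B) (isCompact_closedBall _ _) Metric.isClosed_closedBall fun x hx => ?_
    refine image_eq_zero_of_notMem_tsupport fun h => hx (Metric.ball_subset_closedBall (hts (hNts h)).2)
  obtain ⟨L, hL⟩ := (hN2.of_le one_le_two).lipschitzWith_of_hasCompactSupport hNc one_ne_zero
  have hnear : ∀ x ∈ frontier K, ∀ᶠ z in 𝓝 x, χ z = 1 := eventually_nhdsSet_iff_forall.1 h1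
  have hone : ∀ z ∈ W, χ z = 1 → ‖N z‖ = 1 := by
    intro z hz hz1
    have hg0 : 0 ≤ gradSq φ z := Finset.sum_nonneg fun i _ => sq_nonneg _
    have : √(gradSq φ z) ≠ 0 := by rw [Real.sqrt_ne_zero hg0]; exact hz.1
    simp only [N, hz1, one_smul]
    rw [norm_smul, norm_inv, gr_norm, Real.norm_of_nonneg (Real.sqrt_nonneg _), inv_mul_cancel₀ this]
  have hNx : ∀ x ∈ frontier K, N x = (√(gradSq φ x))⁻¹ • gr φ x := fun x hx => by
    simp only [N, (hnear x hx).self_of_nhds, one_smul]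
  have R : Reg K N L := {
    cp := hcp
    cv := hcv
    ne := hne
    un := fun x hx => hone x (hfW hx) (hnear x hx).self_of_nhds
    lip := hL
    half := fun x hx q hq => by
      rw [hNx x hx, inner_smul_right]
      exact mul_nonpos_of_nonneg_of_nonpos (by positivity) (phi_half hφ hcv hφK (by rw [hφfr] at hx; exact hx) hq)
    proj := fun y hy => by
      obtain ⟨x, hx, r, hr, e⟩ := phi_proj hφ hcv hcp hne hφK hφfr hreg hy
      have hg0 : 0 < gradSq φ x := lt_of_le_of_ne (Finset.sum_nonneg fun i _ => sq_nonneg _) (Ne.symm (hreg x hx))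
      have hsq := Real.sqrt_pos.2 hg0
      refine ⟨x, hx, r * √(gradSq φ x), by positivity, ?_⟩
      rw [hNx x hx, smul_smul, mul_assoc, mul_inv_cancel₀ hsq.ne', mul_one, e] }
  have hNi : ∀ i, ContDiff ℝ 2 (fun y => N y i) := fun i => (EuclideanSpace.proj (𝕜 := ℝ) i).contDiff.comp hN2
  refine ⟨N, L, R, hN2.of_le one_le_two, ?_, ?_, ?_⟩
  · unfold dv
    exact continuous_finsetSum _ fun j _ => (contDiff_iff_contDiffAt.2 fun x => pd_contDiffAt (m := 1) (hNi j).contDiffAt (by norm_num) j).continuous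
  · let V : Set (En n) := W ∩ interior {z | χ z = 1}
    have hV : frontier K ⊆ V := fun x hx => ⟨hfW hx, mem_interior_iff_mem_nhds.2 (hnear x hx)⟩
    obtain ⟨δ, hδ, hδV⟩ := hfc.exists_thickening_subset_open (hWo.inter isOpen_interior) hV
    refine ⟨δ / 2, by positivity, fun q hq hqK => ?_⟩
    obtain ⟨x, hx, r, hr, rfl⟩ := R.proj q hqK
    rw [R.dist_tube hx hr.le] at hq
    have hmem : x + r • N x ∈ V := hδV (Metric.mem_thickening_iff.2 ⟨x, hx, by
      rw [dist_eq_norm, add_sub_cancel_left, norm_smul, R.un x hx, mul_one, Real.norm_of_nonneg hr.le]; linarith⟩)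
    exact hone _ hmem.1 (show _ ∈ {z | χ z = 1} from interior_subset hmem.2)
  · intro x hx
    unfold dv
    refine Finset.sum_congr rfl fun j _ => pd_congr ?_ j
    filter_upwards [hnear x hx] with z hz
    simp [N, hz, gr, div_eq_inv_mul]
end field
end partE2

theorem aleksandrov_fenchel_special {n : ℕ} (hn : 3 ≤ n)
    (K : Set (EuclideanSpace ℝ (Fin n))) (hKconv : Convex ℝ K) (hKcomp : IsCompact K)
    (hKint : (interior K).Nonempty)
    (φ : EuclideanSpace ℝ (Fin n) → ℝ) (hφ : ContDiff ℝ (⊤ : ℕ∞) φ)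
    (hφK : K = {x | φ x ≤ 0}) (hφfr : frontier K = {x | φ x = 0})
    (hφreg : ∀ x ∈ frontier K, gradSq φ x ≠ 0)
    (H0 : EuclideanSpace ℝ (Fin n) → ℝ)
    (hH0 : ∀ x ∈ frontier K,
      H0 x = ∑ j, pd (fun y => pd φ j y / Real.sqrt (gradSq φ y)) j x) :
    (1 / (2 * ((n : ℝ) - 1) * sphereVol n)) * (∫ x in frontier K, H0 x ∂(μH[(n : ℝ) - 1]))
      ≥ (1 / 2) * ((μH[(n : ℝ) - 1] (frontier K)).toReal / sphereVol n) ^ (((n : ℝ) - 2) / ((n : ℝ) - 1)) := by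
  obtain ⟨N, L, R, hN1, hdvc, ⟨η0, h0, hnr⟩, hdv⟩ := field hφ hKconv hKcomp (hKint.mono interior_subset) hφK hφfr hφreg
  have hmain := R.main_lim hn hN1 hdvc h0 hnr
  have hcast : ((n - 1 : ℕ) : ℝ) = (n : ℝ) - 1 := by rw [Nat.cast_sub (by omega)]; simp
  set c := Measure.addHaarScalarFactor (volume : Measure (En (n - 1))) μH[((n - 1 : ℕ) : ℝ)] with hc
  have hc0 : c ≠ 0 := Measure.addHaarScalarFactor_volume_hausdorffMeasure_ne_zero (n - 1)
  have hE : (μHE[n - 1] : Measure (En n)) = c • μH[(n : ℝ) - 1] := by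
    rw [Measure.euclideanHausdorffMeasure_def, ← hcast]
  have hcp : (0:ℝ) < c := by exact_mod_cast pos_iff_ne_zero.2 hc0
  have hω := ball_area hn
  have hωp := sg_pos hn
  set ω := (sg n).real Set.univ
  have e1 : ω = c * sphereVol n := by
    rw [← hω, hE, sphereVol, Measure.smul_apply, ENNReal.smul_def, smul_eq_mul, ENNReal.toReal_mul, ENNReal.coe_toReal]
  have e2 : (Reg.mS K).real Set.univ = c * (μH[(n : ℝ) - 1] (frontier K)).toReal := by
    rw [Measure.real, Measure.restrict_apply_univ, hE, Measure.smul_apply, ENNReal.smul_def, smul_eq_mul, ENNReal.toReal_mul, ENNReal.coe_toReal]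
  have e3 : ∫ x, dv N x ∂(Reg.mS K) = c * ∫ x in frontier K, H0 x ∂(μH[(n : ℝ) - 1]) := by
    rw [Reg.mS, hE, Measure.restrict_smul, integral_smul_nnreal_measure, NNReal.smul_def, smul_eq_mul]
    congr 1
    exact setIntegral_congr_fun isClosed_frontier.measurableSet fun x hx => by rw [hdv x hx, hH0 x hx]
  rw [e3, e2] at hmain
  set I := ∫ x in frontier K, H0 x ∂(μH[(n : ℝ) - 1])
  set S := (μH[(n : ℝ) - 1] (frontier K)).toReal with hS
  have hS0 : 0 ≤ S := ENNReal.toReal_nonneg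
  have hv : 0 < sphereVol n := by
    rw [e1] at hωp; exact (mul_pos_iff_of_pos_left hcp).1 hωp
  rw [e1] at hmain
  set v := sphereVol n
  have hn3 : (3:ℝ) ≤ n := by exact_mod_cast hn
  have hm : (0:ℝ) < (n:ℝ) - 1 := by linarith
  have hpow : ((c * S) ^ (1 / ((n - 1 : ℕ) : ℝ))) ^ (n - 2) * (c * v) ^ (1 / ((n - 1 : ℕ) : ℝ)) = (c * v) * (S / v) ^ (((n : ℝ) - 2) / ((n : ℝ) - 1)) := by
    have a1 : c * S = (c * v) * (S / v) := by field_simp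
    have hcv : 0 < c * v := mul_pos hcp hv
    have a2 : 1 / ((n:ℝ) - 1) * ((n - 2 : ℕ) : ℝ) = ((n : ℝ) - 2) / ((n : ℝ) - 1) := by
      rw [Nat.cast_sub (by omega)]; push_cast; ring
    rw [← Real.rpow_natCast, hcast, ← Real.rpow_mul (by positivity), a2, a1, Real.mul_rpow hcv.le (by positivity), mul_right_comm, ← Real.rpow_add hcv,
      show ((n : ℝ) - 2) / ((n : ℝ) - 1) + 1 / ((n:ℝ) - 1) = 1 by field_simp; ring, Real.rpow_one]
  rw [mul_assoc, hpow, hcast] at hmain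
  set X := (S / v) ^ (((n : ℝ) - 2) / ((n : ℝ) - 1))
  have h5 : ((n:ℝ) - 1) * (v * X) ≤ I := by
    refine le_of_mul_le_mul_left (a := (c:ℝ)) ?_ hcp
    linarith
  have h6 : 1 / (2 * ((n:ℝ) - 1) * v) * I = I / (2 * ((n:ℝ) - 1) * v) := by ring
  rw [ge_iff_le, h6, le_div_iff₀ (mul_pos (mul_pos two_pos hm) hv)]
  linarith
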